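/- arXiv:math/0407226 — 2 statements merged into one kernel-verified Lean document; each statement's English description precedes it below -/
import Mathlib

section
/- Suppose char F ≠ 2 and a sums-of-squares formula of type [r,s,n] exists over F. Let c = ⌊(s-1)/2⌋. Then 2^(c-i+1) divides C(r+i-1, i) for all i with n-r < i ≤ c. -/
section Clifford

/-- A finite-dimensional space over an algebraically closed field of characteristic not two that
carries `m` pairwise anticommuting operators with nonzero scalar squares has dimension divisible
by `2 ^ (m / 2)`. -/
theorem two_pow_dvd_finrank_of_isAlgClosed {K : Type*} [Field K] [IsAlgClosed K]
    (h2 : (2 : K) ≠ 0) (m : ℕ) :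
    ∀ (W : Type*) [AddCommGroup W] [Module K W] [FiniteDimensional K W]
      (g : Fin m → W →ₗ[K] W) (c : Fin m → K), (∀ i, c i ≠ 0) →
      (∀ i w, g i (g i w) = c i • w) →
      (∀ i j, i ≠ j → ∀ w, g i (g j w) = -g j (g i w)) →
      2 ^ (m / 2) ∣ Module.finrank K W := by
  induction m using Nat.twoStepInduction with
  | zero => intros; simp
  | one => intros; simp
  | more m ih _ =>
    intro W _ _ _ g c hc hsq hanti
    obtain ⟨l, hl⟩ := IsAlgClosed.exists_pow_nat_eq (-(c 0 * c 1)) (n := 2) (by norm_num)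
    have hl0 : l ≠ 0 := by
      rintro rfl
      have := mul_ne_zero (hc 0) (hc 1)
      exact this (by simpa using hl.symm)
    have h01 : (0 : Fin (m + 2)) ≠ 1 := by simp
    set e : W →ₗ[K] W := g 0 ∘ₗ g 1 with he
    have hee : ∀ w, e (e w) = (l ^ 2) • w := by
      intro w
      simp only [he, LinearMap.comp_apply]
      rw [hanti 1 0 h01.symm, map_neg, hsq 0, hsq 1, hl, smul_smul, neg_smul]
    let P : Submodule K W := LinearMap.ker (e - l • LinearMap.id)
    let N : Submodule K W := LinearMap.ker (e + l • LinearMap.id)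
    have hP : ∀ w, w ∈ P ↔ e w = l • w := by
      intro w; simp [P, sub_eq_zero]
    have hN : ∀ w, w ∈ N ↔ e w = -(l • w) := by
      intro w; simp [N, add_eq_zero_iff_eq_neg]
    have hcompl : IsCompl P N := by
      constructor
      · rw [Submodule.disjoint_def]
        intro w h1 h2'
        rw [hP] at h1
        rw [hN, h1] at h2'
        have : (2 * l) • w = 0 := by
          rw [two_mul, add_smul]; nth_rewrite 1 [h2']; simp
        exact (smul_eq_zero.mp this).resolve_left (mul_ne_zero h2 hl0)
      · rw [codisjoint_iff, eq_top_iff]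
        intro w _
        have : w = (2 * l)⁻¹ • (l • w + e w) + (2 * l)⁻¹ • (l • w - e w) := by
          rw [← smul_add]
          have : l • w + e w + (l • w - e w) = (2 * l) • w := by
            rw [two_mul, add_smul]; abel
          rw [this, smul_smul, inv_mul_cancel₀ (mul_ne_zero h2 hl0), one_smul]
        rw [this]
        refine Submodule.add_mem_sup (P.smul_mem _ ?_) (N.smul_mem _ ?_)
        · rw [hP, map_add, map_smul, hee, smul_add, smul_smul, sq, add_comm]
        · rw [hN, map_sub, map_smul, hee, smul_sub, smul_smul, sq, neg_sub]
    have he0 : ∀ w, e (g 0 w) = -g 0 (e w) := by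
      intro w
      simp only [he, LinearMap.comp_apply]
      rw [hanti 1 0 h01.symm, map_neg]
    have hPN : ∀ w ∈ P, g 0 w ∈ N := by
      intro w hw
      rw [hN, he0, (hP w).1 hw, map_smul]
    have hNP : ∀ w ∈ N, g 0 w ∈ P := by
      intro w hw
      rw [hP, he0, (hN w).1 hw, map_neg, map_smul, neg_neg]
    have hinj : Function.Injective (g 0) := by
      rw [← LinearMap.ker_eq_bot, LinearMap.ker_eq_bot']
      intro w hw
      have := hsq 0 w
      rw [hw, map_zero] at this
      exact (smul_eq_zero.mp this.symm).resolve_left (hc 0)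
    have hle1 : Module.finrank K P ≤ Module.finrank K N := by
      refine LinearMap.finrank_le_finrank_of_injective (f := (g 0).restrict hPN) ?_
      intro a b hab
      exact Subtype.ext (hinj (congrArg Subtype.val hab))
    have hle2 : Module.finrank K N ≤ Module.finrank K P := by
      refine LinearMap.finrank_le_finrank_of_injective (f := (g 0).restrict hNP) ?_
      intro a b hab
      exact Subtype.ext (hinj (congrArg Subtype.val hab))
    have hdim := Submodule.finrank_add_eq_of_isCompl hcompl
    have hpres : ∀ i : Fin m, ∀ w ∈ P, g i.succ.succ w ∈ P := by
      intro i w hw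
      rw [hP]
      have h0 : (0 : Fin (m + 2)) ≠ i.succ.succ := (Fin.succ_ne_zero _).symm
      have h1 : (1 : Fin (m + 2)) ≠ i.succ.succ := by
        intro h; simp [Fin.ext_iff] at h
      have hw' := (hP w).1 hw
      simp only [he, LinearMap.comp_apply] at hw' ⊢
      rw [hanti 1 _ h1, map_neg, hanti 0 _ h0, neg_neg, hw', map_smul]
    have key := ih P (fun i => (g i.succ.succ).restrict (hpres i)) (fun i => c i.succ.succ)
      (fun i => hc _) (fun i w => Subtype.ext (by simpa using hsq i.succ.succ w))
      (fun i j hij w => Subtype.ext (by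
        simpa using hanti i.succ.succ j.succ.succ (by simpa using hij) w))
    have h3 : (m + 2) / 2 = m / 2 + 1 := by omega
    rw [h3, pow_succ, ← hdim, show Module.finrank K P + Module.finrank K N =
      Module.finrank K P * 2 by omega]
    exact Nat.mul_dvd_mul_right key 2

theorem two_pow_dvd_finrank_submodule {F : Type*} [Field F] (h2 : (2 : F) ≠ 0) {m : ℕ}
    {M : Type*} [AddCommGroup M] [Module F M] (g : Fin m → M →ₗ[F] M) (c : Fin m → F)
    (hc : ∀ i, c i ≠ 0) (hsq : ∀ i w, g i (g i w) = c i • w)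
    (hanti : ∀ i j, i ≠ j → ∀ w, g i (g j w) = -g j (g i w))
    (U : Submodule F M) [FiniteDimensional F U] (hU : ∀ i, ∀ w ∈ U, g i w ∈ U) :
    2 ^ (m / 2) ∣ Module.finrank F U := by
  let K := AlgebraicClosure F
  let g' : Fin m → U →ₗ[F] U := fun i => (g i).restrict (hU i)
  have hsq' : ∀ i, g' i ∘ₗ g' i = c i • LinearMap.id := fun i =>
    LinearMap.ext fun w => Subtype.ext (by simpa [g'] using hsq i w)
  have hanti' : ∀ i j, i ≠ j → g' i ∘ₗ g' j = -(g' j ∘ₗ g' i) := fun i j hij =>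
    LinearMap.ext fun w => Subtype.ext (by simpa [g'] using hanti i j hij w)
  have h2K : (2 : K) ≠ 0 := by
    intro h
    apply h2
    apply (algebraMap F K).injective
    rw [map_ofNat, map_zero, h]
  have key := two_pow_dvd_finrank_of_isAlgClosed h2K m (TensorProduct F K U)
    (fun i => (g' i).baseChange K) (fun i => algebraMap F K (c i))
    (fun i => by simpa using hc i)
    (fun i w => by
      rw [← LinearMap.comp_apply, ← LinearMap.baseChange_comp, hsq' i, LinearMap.baseChange_smul,
        LinearMap.baseChange_id]
      simp [algebraMap_smul])
    (fun i j hij w => by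
      rw [← LinearMap.comp_apply, ← LinearMap.baseChange_comp, hanti' i j hij,
        LinearMap.baseChange_neg, LinearMap.baseChange_comp]
      rfl)
  rwa [Module.finrank_baseChange] at key

end Clifford

section AlternatingSum

open PowerSeries in
/-- `HasAltSum f a` says that the generating function of `f` is rational with `1` as its only
possible pole, and takes the value `a` at `-1`; `a` is the regularized sum `∑ (-1) ^ k * f k`. -/
def HasAltSum (f : ℕ → ℚ) (a : ℚ) : Prop :=
  ∃ (N : ℕ) (p : Polynomial ℚ),
    (1 - X) ^ N * PowerSeries.mk f = (p : PowerSeries ℚ) ∧ p.eval (-1) = 2 ^ N * a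

namespace HasAltSum

open PowerSeries

variable {f g : ℕ → ℚ} {a b : ℚ}

theorem coe_one_sub_X_pow (N : ℕ) :
    (((1 - Polynomial.X) ^ N : Polynomial ℚ) : PowerSeries ℚ) = (1 - X) ^ N := by
  simp

theorem eval_one_sub_X_pow (N : ℕ) :
    ((1 - Polynomial.X) ^ N : Polynomial ℚ).eval (-1) = 2 ^ N := by
  simp only [Polynomial.eval_pow, Polynomial.eval_sub, Polynomial.eval_one, Polynomial.eval_X]
  norm_num

theorem congr (hf : HasAltSum f a) (h : ∀ k, f k = g k) : HasAltSum g a := by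
  rwa [show g = f from funext fun k => (h k).symm]

theorem unique (hf : HasAltSum f a) (hf' : HasAltSum f b) : a = b := by
  obtain ⟨N, p, hp, hpa⟩ := hf
  obtain ⟨N', p', hp', hpa'⟩ := hf'
  have h : (1 - Polynomial.X) ^ N' * p = (1 - Polynomial.X) ^ N * p' := by
    apply Polynomial.coe_injective ℚ
    rw [Polynomial.coe_mul, Polynomial.coe_mul, ← hp, ← hp', coe_one_sub_X_pow,
      coe_one_sub_X_pow]
    ring
  have h' := congrArg (Polynomial.eval (-1)) h
  rw [Polynomial.eval_mul, Polynomial.eval_mul, eval_one_sub_X_pow, eval_one_sub_X_pow, hpa,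
    hpa'] at h'
  have h2 : (2 : ℚ) ^ N * 2 ^ N' ≠ 0 := by positivity
  apply mul_left_cancel₀ h2
  linear_combination h'

theorem add (hf : HasAltSum f a) (hg : HasAltSum g b) :
    HasAltSum (fun k => f k + g k) (a + b) := by
  obtain ⟨N, p, hp, hpa⟩ := hf
  obtain ⟨N', p', hp', hpa'⟩ := hg
  refine ⟨N + N', (1 - Polynomial.X) ^ N' * p + (1 - Polynomial.X) ^ N * p', ?_, ?_⟩
  · have : PowerSeries.mk (fun k => f k + g k) = PowerSeries.mk f + PowerSeries.mk g := by
      ext; simp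
    rw [this, Polynomial.coe_add, Polynomial.coe_mul, Polynomial.coe_mul, ← hp, ← hp',
      coe_one_sub_X_pow, coe_one_sub_X_pow]
    ring
  · rw [Polynomial.eval_add, Polynomial.eval_mul, Polynomial.eval_mul, eval_one_sub_X_pow,
      eval_one_sub_X_pow, hpa, hpa']
    ring

theorem const_mul (c : ℚ) (hf : HasAltSum f a) : HasAltSum (fun k => c * f k) (c * a) := by
  obtain ⟨N, p, hp, hpa⟩ := hf
  refine ⟨N, Polynomial.C c * p, ?_, ?_⟩
  · have : PowerSeries.mk (fun k => c * f k) = PowerSeries.C c * PowerSeries.mk f := by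
      ext; simp
    rw [this, Polynomial.coe_mul, Polynomial.coe_C, ← hp]
    ring
  · rw [Polynomial.eval_mul, Polynomial.eval_C, hpa]
    ring

theorem sub (hf : HasAltSum f a) (hg : HasAltSum g b) :
    HasAltSum (fun k => f k - g k) (a - b) := by
  simpa [sub_eq_add_neg] using hf.add (hg.const_mul (-1))

theorem of_polynomial (p : Polynomial ℚ) : HasAltSum p.coeff (p.eval (-1)) :=
  ⟨0, p, by rw [pow_zero, one_mul]; ext; simp, by simp⟩

theorem of_finite_support (K : ℕ) (hf : ∀ k, K ≤ k → f k = 0) :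
    HasAltSum f (∑ k ∈ Finset.range K, (-1) ^ k * f k) := by
  let p : Polynomial ℚ := ∑ k ∈ Finset.range K, Polynomial.monomial k (f k)
  have hp : p.coeff = f := by
    funext k
    simp only [p, Polynomial.finsetSum_coeff, Polynomial.coeff_monomial,
      Finset.sum_ite_eq', Finset.mem_range]
    split_ifs with h
    · rfl
    · exact (hf k (not_lt.1 h)).symm
  have := of_polynomial p
  rw [hp] at this
  convert this using 1
  simp [p, Polynomial.eval_finsetSum, mul_comm]

theorem mk_eq (f : ℕ → ℚ) :
    PowerSeries.mk f = PowerSeries.C (f 0) + X * PowerSeries.mk (fun k => f (k + 1)) := by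
  ext k
  cases k with
  | zero => simp
  | succ k => simp [PowerSeries.coeff_succ_X_mul]

theorem succ (hf : HasAltSum f a) : HasAltSum (fun k => f (k + 1)) (f 0 - a) := by
  obtain ⟨N, p, hp, hpa⟩ := hf
  have hX : (Polynomial.X : Polynomial ℚ) ∣ p - (1 - Polynomial.X) ^ N * Polynomial.C (f 0) := by
    rw [Polynomial.X_dvd_iff, ← Polynomial.coeff_coe, Polynomial.coe_sub, Polynomial.coe_mul,
      ← hp, coe_one_sub_X_pow, Polynomial.coe_C]
    simp
  obtain ⟨r, hr⟩ := hX
  refine ⟨N, r, ?_, ?_⟩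
  · have h1 := congrArg (fun t : Polynomial ℚ => (t : PowerSeries ℚ)) hr
    simp only [Polynomial.coe_sub, Polynomial.coe_mul, ← hp, coe_one_sub_X_pow, Polynomial.coe_C,
      Polynomial.coe_X] at h1
    rw [mk_eq f] at h1
    apply mul_left_cancel₀ (PowerSeries.X_ne_zero (R := ℚ))
    linear_combination h1
  · have h1 := congrArg (Polynomial.eval (-1)) hr
    rw [Polynomial.eval_sub, Polynomial.eval_mul, Polynomial.eval_mul, eval_one_sub_X_pow, hpa,
      Polynomial.eval_C, Polynomial.eval_X] at h1
    linear_combination h1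

theorem exists_of_forward_difference (h : ∃ b, HasAltSum (fun k => f (k + 1) - f k) b) :
    ∃ a, HasAltSum f a := by
  obtain ⟨b, N, p, hp, -⟩ := h
  refine ⟨_, N + 1, Polynomial.X * p + (1 - Polynomial.X) ^ N * Polynomial.C (f 0), ?_,
    (mul_div_cancel₀ _ (by positivity : (2 : ℚ) ^ (N + 1) ≠ 0)).symm⟩
  have h1 : (1 - X) * PowerSeries.mk f =
      PowerSeries.C (f 0) + X * PowerSeries.mk (fun k => f (k + 1) - f k) := by
    ext k
    cases k with
    | zero => simp [sub_mul]
    | succ k => simp [sub_mul, PowerSeries.coeff_succ_X_mul]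
  rw [pow_succ, mul_assoc, h1, Polynomial.coe_add, Polynomial.coe_mul, Polynomial.coe_mul, ← hp,
    coe_one_sub_X_pow, Polynomial.coe_C, Polynomial.coe_X]
  ring

end HasAltSum

end AlternatingSum

section Graded

open MvPolynomial

/-- A grading, by finite-dimensional pieces, of a module over a polynomial ring. -/
structure PolyGrading (F : Type*) [Field F] (s : ℕ) (M : Type*) [AddCommGroup M] [Module F M]
    [Module (MvPolynomial (Fin s) F) M] where
  /-- the homogeneous elements of a given degree -/
  piece : ℕ → Submodule F M
  /-- the homogeneous component of a given degree -/
  proj : ℕ → M →ₗ[F] M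
  finite : ∀ k, FiniteDimensional F (piece k)
  proj_of_mem : ∀ {k v}, v ∈ piece k → proj k v = v
  proj_of_mem_of_ne : ∀ {k l v}, v ∈ piece l → l ≠ k → proj k v = 0
  iSup_piece : ⨆ k, piece k = ⊤
  X_smul_mem : ∀ {k v} (i : Fin s), v ∈ piece k → (X i : MvPolynomial (Fin s) F) • v ∈ piece (k + 1)

theorem mem_pi_univ {F κ M : Type*} [Field F] [AddCommGroup M] [Module F M]
    (p : Submodule F M) (v : κ → M) :
    v ∈ Submodule.pi Set.univ (fun _ => p) ↔ ∀ t, v t ∈ p := by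
  simp [Submodule.mem_pi]

/-- Functions with values in a submodule. -/
def piUnivEquiv {F κ M : Type*} [Field F] [AddCommGroup M] [Module F M] (p : Submodule F M) :
    Submodule.pi (Set.univ : Set κ) (fun _ => p) ≃ₗ[F] (κ → p) where
  toFun v t := ⟨v.1 t, (mem_pi_univ p v.1).1 v.2 t⟩
  invFun w := ⟨fun t => (w t).1, (mem_pi_univ p _).2 fun t => (w t).2⟩
  map_add' _ _ := rfl
  map_smul' _ _ := rfl
  left_inv _ := rfl
  right_inv _ := rfl

theorem finrank_pi_univ {F κ M : Type*} [Field F] [AddCommGroup M] [Module F M] [Fintype κ]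
    (p : Submodule F M) [FiniteDimensional F p] :
    Module.finrank F (Submodule.pi (Set.univ : Set κ) (fun _ => p)) =
      Fintype.card κ * Module.finrank F p := by
  rw [(piUnivEquiv p).finrank_eq, Module.finrank_pi_fintype]
  simp

namespace PolyGrading

variable {F : Type*} [Field F] {s : ℕ} {M : Type*} [AddCommGroup M] [Module F M]
    [Module (MvPolynomial (Fin s) F) M]

/-- The grading of the polynomial ring by total degree. -/
noncomputable def polynomial (F : Type*) [Field F] (s : ℕ) :
    PolyGrading F s (MvPolynomial (Fin s) F) where
  piece := homogeneousSubmodule (Fin s) F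
  proj := homogeneousComponent
  finite k := Module.Finite.iff_fg.2 (homogeneousSubmodule_fg _ _ k)
  proj_of_mem hv := homogeneousComponent_eq_self hv
  proj_of_mem_of_ne hv hlk := by rw [homogeneousComponent_of_mem hv, if_neg hlk.symm]
  iSup_piece := by
    rw [eq_top_iff]
    intro v _
    rw [← sum_homogeneousComponent v]
    exact Submodule.sum_mem _ fun k _ =>
      Submodule.mem_iSup_of_mem k (homogeneousComponent_isHomogeneous k v)
  X_smul_mem i hv := by
    rw [smul_eq_mul, mul_comm]
    exact IsHomogeneous.mul hv (isHomogeneous_X F i)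

/-- The componentwise grading of a finite power of a graded module. -/
def pi (G : PolyGrading F s M) (κ : Type*) [Fintype κ] : PolyGrading F s (κ → M) where
  piece k := Submodule.pi Set.univ (fun _ => G.piece k)
  proj k := (G.proj k).compLeft κ
  finite k := by
    have := G.finite k
    exact Module.Finite.equiv (piUnivEquiv (κ := κ) (G.piece k)).symm
  proj_of_mem hv := funext fun t => G.proj_of_mem ((mem_pi_univ _ _).1 hv t)
  proj_of_mem_of_ne hv hlk := funext fun t => G.proj_of_mem_of_ne ((mem_pi_univ _ _).1 hv t) hlk
  iSup_piece := by
    classical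
    rw [eq_top_iff]
    intro v _
    have hv : v = ∑ t, LinearMap.single F (fun _ : κ => M) t (v t) :=
      (Finset.univ_sum_single v).symm
    rw [hv]
    refine Submodule.sum_mem _ fun t _ => ?_
    have h : v t ∈ ⨆ k, G.piece k := by rw [G.iSup_piece]; trivial
    have h' := Submodule.mem_map_of_mem (f := LinearMap.single F (fun _ : κ => M) t) h
    rw [Submodule.map_iSup] at h'
    have hle : ∀ k, (G.piece k).map (LinearMap.single F (fun _ : κ => M) t) ≤
        Submodule.pi Set.univ (fun _ => G.piece k) := ?_
    · exact iSup_mono hle h'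
    intro k
    rintro _ ⟨w, hw, rfl⟩
    rw [mem_pi_univ]
    intro t'
    by_cases htt : t' = t
    · subst htt; simpa using hw
    · simp [Pi.single_eq_of_ne htt]
  X_smul_mem i hv := (mem_pi_univ _ _).2 fun t => G.X_smul_mem i ((mem_pi_univ _ _).1 hv t)

theorem mem_pi_piece (G : PolyGrading F s M) {κ : Type*} [Fintype κ] {k : ℕ} {v : κ → M} :
    v ∈ (G.pi κ).piece k ↔ ∀ t, v t ∈ G.piece k :=
  mem_pi_univ _ _

/-- A family of subspaces of the homogeneous pieces that is stable under the variables. -/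
structure IsGradedSub (G : PolyGrading F s M) (N : ℕ → Submodule F M) : Prop where
  le : ∀ k, N k ≤ G.piece k
  X_smul_mem : ∀ {k v} (i : Fin s), v ∈ N k → (X i : MvPolynomial (Fin s) F) • v ∈ N (k + 1)

theorem exists_eq_single_add {m : Fin s →₀ ℕ} {d : ℕ} (hm : m.degree = d + 1) :
    ∃ i m', m = Finsupp.single i 1 + m' ∧ m'.degree = d := by
  have h0 : m ≠ 0 := by rintro rfl; simp at hm
  obtain ⟨i, hi⟩ := Finsupp.ne_iff.1 h0
  have hle : Finsupp.single i 1 ≤ m := by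
    rw [Finsupp.single_le_iff]; simpa [Nat.one_le_iff_ne_zero] using hi
  refine ⟨i, m - Finsupp.single i 1, (add_tsub_cancel_of_le hle).symm, ?_⟩
  have := congrArg Finsupp.degree (add_tsub_cancel_of_le hle)
  rw [map_add, hm, Finsupp.degree_single] at this
  omega

theorem monomial_single_add_smul {V : Type*} [AddCommGroup V] [Module (MvPolynomial (Fin s) F) V]
    (i : Fin s) (m : Fin s →₀ ℕ) (c : F) (v : V) :
    (monomial (Finsupp.single i 1 + m) c : MvPolynomial (Fin s) F) • v =
      (X i : MvPolynomial (Fin s) F) • (monomial m c : MvPolynomial (Fin s) F) • v := by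
  rw [smul_smul, X, monomial_mul, one_mul]

variable [IsScalarTower F (MvPolynomial (Fin s) F) M]

namespace IsGradedSub

variable {G : PolyGrading F s M} {N N' : ℕ → Submodule F M}

theorem monomial_smul_mem (hN : G.IsGradedSub N) (c : F) (d : ℕ) :
    ∀ {k : ℕ} {v : M} (m : Fin s →₀ ℕ), m.degree = d → v ∈ N k →
      (monomial m c : MvPolynomial (Fin s) F) • v ∈ N (k + d) := by
  induction d with
  | zero =>
    intro k v m hm hv
    rw [Finsupp.degree_eq_zero_iff] at hm
    subst hm
    have : (monomial 0 c : MvPolynomial (Fin s) F) • v = c • v := by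
      rw [← algebraMap_smul (MvPolynomial (Fin s) F) c v]; rfl
    rw [this]
    exact (N k).smul_mem c hv
  | succ d ih =>
    intro k v m hm hv
    obtain ⟨i, m', rfl, hm'⟩ := exists_eq_single_add hm
    rw [monomial_single_add_smul]
    exact hN.X_smul_mem i (ih m' hm' hv)

/-- In large degrees a graded submodule of a Noetherian module is generated by its previous
piece. -/
theorem eventually_le [IsNoetherian (MvPolynomial (Fin s) F) M] (hN : G.IsGradedSub N) :
    ∃ K, ∀ k, K ≤ k → ∀ P : Submodule F M,
      (∀ (i : Fin s), ∀ v ∈ N k, (X i : MvPolynomial (Fin s) F) • v ∈ P) → N (k + 1) ≤ P := by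
  let c : ℕ →o Submodule (MvPolynomial (Fin s) F) M :=
    { toFun := fun K => Submodule.span _ {v | ∃ j ≤ K, v ∈ N j}
      monotone' := fun a b hab => Submodule.span_mono
        (by rintro v ⟨j, hj, hv⟩; exact ⟨j, hj.trans hab, hv⟩) }
  obtain ⟨K, hK⟩ := monotone_stabilizes_iff_noetherian.mpr inferInstance c
  refine ⟨K, fun k hk P hP v hv => ?_⟩
  have hvc : v ∈ c k := by
    rw [← hK k hk, hK (k + 1) (by omega)]
    exact Submodule.subset_span ⟨k + 1, le_rfl, hv⟩
  have main : ∀ p : MvPolynomial (Fin s) F, G.proj (k + 1) (p • v) ∈ P := by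
    refine Submodule.span_induction (p := fun w _ => ∀ p : MvPolynomial (Fin s) F,
      G.proj (k + 1) (p • w) ∈ P) ?_ ?_ ?_ ?_ hvc
    · rintro w ⟨j, hj, hw⟩ p
      induction p using MvPolynomial.induction_on' with
      | monomial m a =>
        have hmem := hN.monomial_smul_mem a m.degree m rfl hw
        by_cases hd : j + m.degree = k + 1
        · obtain ⟨d, hd'⟩ : ∃ d, m.degree = d + 1 := ⟨m.degree - 1, by omega⟩
          rw [hd] at hmem
          rw [G.proj_of_mem (hN.le _ hmem)]
          obtain ⟨i, m', rfl, hm'⟩ := exists_eq_single_add hd'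
          rw [monomial_single_add_smul]
          apply hP
          have := hN.monomial_smul_mem a d m' hm' hw
          rwa [show j + d = k by omega] at this
        · rw [G.proj_of_mem_of_ne (hN.le _ hmem) hd]
          exact P.zero_mem
      | add p q hp hq =>
        rw [add_smul, map_add]
        exact P.add_mem hp hq
    · intro p; simp
    · intro x y _ _ hx hy p
      rw [smul_add, map_add]
      exact P.add_mem (hx p) (hy p)
    · intro a x _ hx p
      rw [smul_smul]
      exact hx _
  have := main 1
  rwa [one_smul, G.proj_of_mem (hN.le _ hv)] at this

end IsGradedSub

end PolyGrading

theorem finrank_map_add_finrank_inf_ker {F M M' : Type*} [Field F] [AddCommGroup M]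
    [Module F M] [AddCommGroup M'] [Module F M'] (f : M →ₗ[F] M') (A : Submodule F M)
    [FiniteDimensional F A] :
    Module.finrank F (A.map f) + Module.finrank F ↥(A ⊓ LinearMap.ker f) =
      Module.finrank F A := by
  have h := LinearMap.finrank_range_add_finrank_ker (f.domRestrict A)
  rw [LinearMap.range_domRestrict, LinearMap.ker_domRestrict] at h
  rw [← h, ← Submodule.map_comap_subtype, Submodule.finrank_map_subtype_eq]

theorem finrank_inf_comap_add_finrank_sup_map {F M M' : Type*} [Field F] [AddCommGroup M]
    [Module F M] [AddCommGroup M'] [Module F M'] (f : M →ₗ[F] M') (A : Submodule F M)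
    (B : Submodule F M') [FiniteDimensional F A] [FiniteDimensional F B] :
    Module.finrank F ↥(A ⊓ B.comap f) + Module.finrank F ↥(B ⊔ A.map f) =
      Module.finrank F A + Module.finrank F B := by
  have h1 := Submodule.finrank_sup_add_finrank_inf_eq B (A.map f)
  have h2 := finrank_map_add_finrank_inf_ker f A
  have h3 := finrank_map_add_finrank_inf_ker f (A ⊓ B.comap f)
  have h4 : (A ⊓ B.comap f).map f = B ⊓ A.map f := by
    ext w
    constructor
    · rintro ⟨v, ⟨hv, hv'⟩, rfl⟩
      exact ⟨hv', v, hv, rfl⟩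
    · rintro ⟨hw, v, hv, rfl⟩
      exact ⟨v, ⟨hv, hw⟩, rfl⟩
  have h5 : A ⊓ B.comap f ⊓ LinearMap.ker f = A ⊓ LinearMap.ker f := by
    rw [inf_assoc, inf_eq_right.2 (LinearMap.ker_le_comap f)]
  rw [h4, h5] at h3
  omega

namespace PolyGrading

variable {F : Type*} [Field F] {s : ℕ} {M : Type*} [AddCommGroup M] [Module F M]
    [Module (MvPolynomial (Fin s) F) M]
    {G : PolyGrading F s M} {N N' : ℕ → Submodule F M}

namespace IsGradedSub

theorem finiteDimensional (hN : G.IsGradedSub N) (k : ℕ) : FiniteDimensional F (N k) := by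
  have := G.finite k
  exact Submodule.finiteDimensional_of_le (hN.le k)

/-- For a map `f` of degree one, the family `N' + f N`. -/
def supMap (N N' : ℕ → Submodule F M) (f : M →ₗ[F] M) : ℕ → Submodule F M
  | 0 => N' 0
  | k + 1 => N' (k + 1) ⊔ (N k).map f

theorem supMap_isGradedSub (hN : G.IsGradedSub N) (hN' : G.IsGradedSub N') {f : M →ₗ[F] M}
    (hf : ∀ k, ∀ v ∈ N k, f v ∈ G.piece (k + 1))
    (hfX : ∀ (i : Fin s) v, f ((X i : MvPolynomial (Fin s) F) • v) =
      (X i : MvPolynomial (Fin s) F) • f v) :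
    G.IsGradedSub (supMap N N' f) where
  le k := by
    cases k with
    | zero => exact hN'.le 0
    | succ k =>
      refine sup_le (hN'.le _) ?_
      rintro _ ⟨v, hv, rfl⟩
      exact hf k v hv
  X_smul_mem {k v} i hv := by
    cases k with
    | zero => exact Submodule.mem_sup_left (hN'.X_smul_mem i hv)
    | succ k =>
      obtain ⟨a, ha, _, ⟨b, hb, rfl⟩, rfl⟩ := Submodule.mem_sup.1 hv
      rw [smul_add, ← hfX]
      exact Submodule.add_mem_sup (hN'.X_smul_mem i ha)
        (Submodule.mem_map_of_mem (hN.X_smul_mem i hb))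

theorem infComap_isGradedSub (hN : G.IsGradedSub N) (hN' : G.IsGradedSub N') {f : M →ₗ[F] M}
    (hfX : ∀ (i : Fin s) v, f ((X i : MvPolynomial (Fin s) F) • v) =
      (X i : MvPolynomial (Fin s) F) • f v) :
    G.IsGradedSub (fun k => N k ⊓ (N' (k + 1)).comap f) where
  le k := inf_le_left.trans (hN.le k)
  X_smul_mem {k v} i hv := by
    refine ⟨hN.X_smul_mem i hv.1, ?_⟩
    rw [SetLike.mem_coe, Submodule.mem_comap, hfX]
    exact hN'.X_smul_mem i hv.2

theorem finrank_infComap_add_finrank_supMap (hN : G.IsGradedSub N) (hN' : G.IsGradedSub N')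
    (f : M →ₗ[F] M) (k : ℕ) :
    Module.finrank F ↥(N k ⊓ (N' (k + 1)).comap f) + Module.finrank F (supMap N N' f (k + 1)) =
      Module.finrank F (N k) + Module.finrank F (N' (k + 1)) := by
  have := hN.finiteDimensional k
  have := hN'.finiteDimensional (k + 1)
  exact finrank_inf_comap_add_finrank_sup_map f _ _

theorem exists_hasAltSum_aux [IsScalarTower F (MvPolynomial (Fin s) F) M]
    [IsNoetherian (MvPolynomial (Fin s) F) M] (j : ℕ) :
    ∀ {N N' : ℕ → Submodule F M}, G.IsGradedSub N → G.IsGradedSub N' → (∀ k, N' k ≤ N k) →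
      (∀ (i : Fin s), j ≤ i → ∀ k, ∀ v ∈ N k, (X i : MvPolynomial (Fin s) F) • v ∈ N' (k + 1)) →
      ∃ a, HasAltSum (fun k => (Module.finrank F (N k) : ℚ) - Module.finrank F (N' k)) a := by
  induction j with
  | zero =>
    intro N N' hN hN' hle hX
    obtain ⟨K, hK⟩ := hN.eventually_le
    refine ⟨_, HasAltSum.of_finite_support (K + 1) ?_⟩
    intro k hk
    obtain ⟨k, rfl⟩ : ∃ l, k = l + 1 := ⟨k - 1, by omega⟩
    have h : N (k + 1) = N' (k + 1) :=
      le_antisymm (hK k (by omega) _ fun i v hv => hX i (Nat.zero_le _) k v hv) (hle _)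
    rw [h, sub_self]
  | succ j ih =>
    intro N N' hN hN' hle hX
    by_cases hj : j < s
    · let f : M →ₗ[F] M :=
        (LinearMap.lsmul (MvPolynomial (Fin s) F) M (X ⟨j, hj⟩)).restrictScalars F
      have hf : ∀ v, f v = (X ⟨j, hj⟩ : MvPolynomial (Fin s) F) • v := fun v => rfl
      have hfX : ∀ (i : Fin s) v, f ((X i : MvPolynomial (Fin s) F) • v) =
          (X i : MvPolynomial (Fin s) F) • f v := fun i v => by rw [hf, hf, smul_comm]
      have hC := supMap_isGradedSub hN hN' (f := f) (fun k v hv => hN.le _ (hN.X_smul_mem _ hv)) hfX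
      have hK := infComap_isGradedSub hN hN' hfX
      have hCN : ∀ k, supMap N N' f k ≤ N k := by
        intro k
        cases k with
        | zero => exact hle 0
        | succ k =>
          refine sup_le (hle _) ?_
          rintro _ ⟨v, hv, rfl⟩
          exact hN.X_smul_mem _ hv
      have hN'C : ∀ k, N' k ≤ supMap N N' f k := by
        intro k
        cases k with
        | zero => exact le_rfl
        | succ k => exact le_sup_left
      have hN'K : ∀ k, N' k ≤ N k ⊓ (N' (k + 1)).comap f :=
        fun k => le_inf (hle k) fun v hv => hN'.X_smul_mem _ hv
      obtain ⟨a, ha⟩ := ih hN hC hCN (by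
        intro i hi k v hv
        rcases hi.eq_or_lt with h | h
        · refine Submodule.mem_sup_right ⟨v, hv, ?_⟩
          rw [hf]
          congr
        · exact hN'C _ (hX i h k v hv))
      obtain ⟨b, hb⟩ := ih hK hN' hN'K (by
        intro i hi k v hv
        rcases hi.eq_or_lt with h | h
        · have := hv.2
          rw [SetLike.mem_coe, Submodule.mem_comap, hf] at this
          convert this
          exact h.symm
        · exact hX i h k v hv.1)
      apply HasAltSum.exists_of_forward_difference
      refine ⟨_, (ha.succ.sub hb).congr fun k => ?_⟩
      have := finrank_infComap_add_finrank_supMap hN hN' f k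
      have := congrArg (Nat.cast : ℕ → ℚ) this
      push_cast at this
      linarith
    · exact ih hN hN' hle fun i hi => absurd (hi.trans_lt i.2) hj

theorem exists_hasAltSum_sub [IsScalarTower F (MvPolynomial (Fin s) F) M]
    [IsNoetherian (MvPolynomial (Fin s) F) M] (hN : G.IsGradedSub N)
    (hN' : G.IsGradedSub N') (hle : ∀ k, N' k ≤ N k) :
    ∃ a, HasAltSum (fun k => (Module.finrank F (N k) : ℚ) - Module.finrank F (N' k)) a :=
  exists_hasAltSum_aux s hN hN' hle fun i hi => absurd i.2 (not_lt.2 hi)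

theorem bot : G.IsGradedSub (fun _ => ⊥) where
  le _ := bot_le
  X_smul_mem i hv := by simp_all

theorem exists_hasAltSum [IsScalarTower F (MvPolynomial (Fin s) F) M]
    [IsNoetherian (MvPolynomial (Fin s) F) M] (hN : G.IsGradedSub N) :
    ∃ a, HasAltSum (fun k => (Module.finrank F (N k) : ℚ)) a := by
  simpa using hN.exists_hasAltSum_sub bot fun _ => bot_le

end IsGradedSub

end PolyGrading

end Graded

section Fock

/-- The sign picked up when moving the index `k` to its place in the ordered set `T`. -/
def fockSign {n : ℕ} (k : Fin n) (T : Finset (Fin n)) : ℤ := (-1) ^ (T.filter (· < k)).card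

theorem fockSign_insert {n : ℕ} {j : Fin n} (k : Fin n) {T : Finset (Fin n)} (hj : j ∉ T) :
    fockSign k (insert j T) = if j < k then -fockSign k T else fockSign k T := by
  unfold fockSign
  rw [Finset.filter_insert]
  split_ifs with h
  · rw [Finset.card_insert_of_notMem (by simp [hj]), pow_succ]
    ring
  · rfl

theorem fockSign_erase {n : ℕ} {j : Fin n} (k : Fin n) {T : Finset (Fin n)} (hj : j ∈ T) :
    fockSign k (T.erase j) = if j < k then -fockSign k T else fockSign k T := by
  have h := fockSign_insert k (Finset.notMem_erase j T)
  rw [Finset.insert_erase hj] at h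
  rw [h]
  split_ifs <;> simp

theorem fockSign_mul_self {n : ℕ} (k : Fin n) (T : Finset (Fin n)) :
    fockSign k T * fockSign k T = 1 := by
  unfold fockSign
  rw [← mul_pow]
  simp

variable {R W : Type*} [CommRing R] [AddCommGroup W] [Module R W] {n : ℕ}

/-- The annihilation operators on functions on the subsets of `Fin n`. -/
def lower (R : Type*) {W : Type*} [CommRing R] [AddCommGroup W] [Module R W] {n : ℕ} (k : Fin n) :
    (Finset (Fin n) → W) →ₗ[R] (Finset (Fin n) → W) where
  toFun f T := if k ∈ T then 0 else fockSign k T • f (insert k T)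
  map_add' f g := by
    funext T
    simp only [Pi.add_apply]
    split_ifs <;> simp
  map_smul' c f := by
    funext T
    simp only [Pi.smul_apply, RingHom.id_apply]
    split_ifs
    · simp
    · rw [smul_comm]

/-- The creation operators on functions on the subsets of `Fin n`. -/
def raise (R : Type*) {W : Type*} [CommRing R] [AddCommGroup W] [Module R W] {n : ℕ} (k : Fin n) :
    (Finset (Fin n) → W) →ₗ[R] (Finset (Fin n) → W) where
  toFun f T := if k ∈ T then fockSign k T • f (T.erase k) else 0
  map_add' f g := by
    funext T
    simp only [Pi.add_apply]
    split_ifs <;> simp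
  map_smul' c f := by
    funext T
    simp only [Pi.smul_apply, RingHom.id_apply]
    split_ifs
    · rw [smul_comm]
    · simp

/-- The parity operator on functions on the subsets of `Fin n`. -/
def parity (R : Type*) {W : Type*} [CommRing R] [AddCommGroup W] [Module R W] {n : ℕ} :
    (Finset (Fin n) → W) →ₗ[R] (Finset (Fin n) → W) where
  toFun f T := ((-1 : ℤ) ^ T.card) • f T
  map_add' f g := by
    funext T
    simp
  map_smul' c f := by
    funext T
    simp only [Pi.smul_apply, RingHom.id_apply]
    rw [smul_comm]

theorem lower_apply (k : Fin n) (f : Finset (Fin n) → W) (T : Finset (Fin n)) :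
    lower R k f T = if k ∈ T then 0 else fockSign k T • f (insert k T) := rfl

theorem raise_apply (k : Fin n) (f : Finset (Fin n) → W) (T : Finset (Fin n)) :
    raise R k f T = if k ∈ T then fockSign k T • f (T.erase k) else 0 := rfl

theorem parity_apply (f : Finset (Fin n) → W) (T : Finset (Fin n)) :
    parity R f T = ((-1 : ℤ) ^ T.card) • f T := rfl

theorem lower_lower_self (k : Fin n) (f : Finset (Fin n) → W) :
    lower R k (lower R k f) = 0 := by
  funext T
  simp [lower_apply]

theorem raise_raise_self (k : Fin n) (f : Finset (Fin n) → W) :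
    raise R k (raise R k f) = 0 := by
  funext T
  simp [raise_apply]

theorem lower_lower (k l : Fin n) (f : Finset (Fin n) → W) :
    lower R k (lower R l f) = -lower R l (lower R k f) := by
  rcases eq_or_ne k l with rfl | hkl
  · simp [lower_lower_self]
  funext T
  simp only [lower_apply, Pi.neg_apply, Finset.mem_insert, hkl, hkl.symm, false_or]
  by_cases hk : k ∈ T <;> by_cases hl : l ∈ T <;> simp only [hk, hl, if_true, if_false, smul_zero,
    neg_zero]
  rw [fockSign_insert l hk, fockSign_insert k hl, smul_smul, smul_smul, Finset.insert_comm,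
    ← neg_smul]
  congr 1
  rcases lt_or_gt_of_ne hkl with h | h
  · simp only [h, h.not_gt, if_true, if_false]; ring
  · simp only [h, h.not_gt, if_true, if_false]; ring

theorem raise_raise (k l : Fin n) (f : Finset (Fin n) → W) :
    raise R k (raise R l f) = -raise R l (raise R k f) := by
  rcases eq_or_ne k l with rfl | hkl
  · simp [raise_raise_self]
  funext T
  simp only [raise_apply, Pi.neg_apply, Finset.mem_erase, hkl, hkl.symm, ne_eq, not_false_iff,
    true_and]
  by_cases hk : k ∈ T <;> by_cases hl : l ∈ T <;> simp only [hk, hl, if_true, if_false, smul_zero,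
    neg_zero]
  rw [fockSign_erase l hk, fockSign_erase k hl, smul_smul, smul_smul, Finset.erase_right_comm,
    ← neg_smul]
  congr 1
  rcases lt_or_gt_of_ne hkl with h | h
  · simp only [h, h.not_gt, if_true, if_false]; ring
  · simp only [h, h.not_gt, if_true, if_false]; ring

theorem lower_raise_self (k : Fin n) (f : Finset (Fin n) → W) :
    lower R k (raise R k f) + raise R k (lower R k f) = f := by
  funext T
  simp only [raise_apply, lower_apply, Pi.add_apply]
  by_cases hk : k ∈ T
  · simp only [hk, if_true, Finset.mem_erase, ne_eq, not_true, false_and, if_false, zero_add,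
      Finset.insert_erase hk]
    rw [fockSign_erase k hk, if_neg (lt_irrefl _), smul_smul, fockSign_mul_self, one_smul]
  · simp only [hk, if_false, Finset.mem_insert_self, if_true, add_zero, Finset.erase_insert hk]
    rw [fockSign_insert k hk, if_neg (lt_irrefl _), smul_smul, fockSign_mul_self, one_smul]

theorem lower_raise_of_ne {k l : Fin n} (hkl : k ≠ l) (f : Finset (Fin n) → W) :
    lower R k (raise R l f) = -raise R l (lower R k f) := by
  funext T
  simp only [raise_apply, lower_apply, Pi.neg_apply, Finset.mem_insert, Finset.mem_erase, hkl,
    hkl.symm, false_or, ne_eq, not_false_iff, true_and]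
  by_cases hk : k ∈ T <;> by_cases hl : l ∈ T <;> simp only [hk, hl, if_true, if_false, smul_zero,
    neg_zero]
  rw [fockSign_insert l hk, fockSign_erase k hl, smul_smul, smul_smul,
    Finset.erase_insert_of_ne hkl, ← neg_smul]
  congr 1
  rcases lt_or_gt_of_ne hkl with h | h
  · simp only [h, h.not_gt, if_true, if_false]; ring
  · simp only [h, h.not_gt, if_true, if_false]; ring

theorem lower_raise (k l : Fin n) (f : Finset (Fin n) → W) :
    lower R k (raise R l f) + raise R l (lower R k f) = if k = l then f else 0 := by
  split_ifs with h
  · subst h; exact lower_raise_self k f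
  · rw [lower_raise_of_ne h]; abel

theorem parity_parity (f : Finset (Fin n) → W) : parity R (parity R f) = f := by
  funext T
  simp only [parity_apply, smul_smul, ← mul_pow]
  simp

theorem parity_lower (k : Fin n) (f : Finset (Fin n) → W) :
    parity R (lower R k f) = -lower R k (parity R f) := by
  funext T
  simp only [parity_apply, lower_apply, Pi.neg_apply]
  split_ifs with h
  · simp
  · rw [Finset.card_insert_of_notMem h, pow_succ, smul_smul, smul_smul, ← neg_smul]
    congr 1
    ring

theorem parity_raise (k : Fin n) (f : Finset (Fin n) → W) :
    parity R (raise R k f) = -raise R k (parity R f) := by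
  funext T
  simp only [parity_apply, raise_apply, Pi.neg_apply]
  split_ifs with h
  · rw [← Finset.card_erase_add_one h, pow_succ, smul_smul, smul_smul, ← neg_smul]
    congr 1
    ring
  · simp

end Fock

section CliffordOperators

variable {R W : Type*} [CommRing R] [AddCommGroup W] [Module R W] {n : ℕ}

/-- Anticommuting operators with square `1`. -/
def cliffordPos (R : Type*) {W : Type*} [CommRing R] [AddCommGroup W] [Module R W] {n : ℕ}
    (i : Fin n) : (Finset (Fin n) → W) →ₗ[R] (Finset (Fin n) → W) := lower R i + raise R i

/-- Anticommuting operators with square `-1`. -/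
def cliffordNeg (R : Type*) {W : Type*} [CommRing R] [AddCommGroup W] [Module R W] {n : ℕ}
    (i : Fin n) : (Finset (Fin n) → W) →ₗ[R] (Finset (Fin n) → W) := lower R i - raise R i

theorem cliffordPos_apply (i : Fin n) (f : Finset (Fin n) → W) :
    cliffordPos R i f = lower R i f + raise R i f := rfl

theorem cliffordNeg_apply (i : Fin n) (f : Finset (Fin n) → W) :
    cliffordNeg R i f = lower R i f - raise R i f := rfl

theorem clifford_anticomm (i j : Fin n) (f : Finset (Fin n) → W) :
    cliffordPos R i (cliffordPos R j f) +
      cliffordPos R j (cliffordPos R i f) = if i = j then (2 : R) • f else 0 := by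
  have h1 := lower_lower (R := R) i j f
  have h2 := raise_raise (R := R) i j f
  have h3 := lower_raise (R := R) i j f
  have h4 := lower_raise (R := R) j i f
  simp only [cliffordPos_apply, map_add]
  have h5 : (if i = j then (2 : R) • f else 0) =
      (if i = j then f else 0) + if j = i then f else 0 := by
    rcases eq_or_ne i j with rfl | h
    · simp [two_smul]
    · simp [h, h.symm]
  rw [h5, ← h3, ← h4, h1, h2]
  abel

theorem clifford_dual_anticomm (i j : Fin n) (f : Finset (Fin n) → W) :
    cliffordNeg R i (cliffordPos R j f) =
      -cliffordPos R j (cliffordNeg R i f) := by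
  have h1 := lower_lower (R := R) i j f
  have h2 := raise_raise (R := R) i j f
  have h3 := lower_raise (R := R) i j f
  have h4 := lower_raise (R := R) j i f
  have h5 : (if i = j then f else 0) = if j = i then f else 0 := by simp only [eq_comm]
  rw [← h3, ← h4] at h5
  simp only [cliffordPos_apply, cliffordNeg_apply, map_add, map_sub]
  rw [h1, h2]
  linear_combination (norm := module) h5

theorem dual_dual_anticomm {i j : Fin n} (hij : i ≠ j) (f : Finset (Fin n) → W) :
    cliffordNeg R i (cliffordNeg R j f) =
      -cliffordNeg R j (cliffordNeg R i f) := by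
  simp only [cliffordNeg_apply, map_sub]
  rw [lower_lower i j, raise_raise i j, lower_raise_of_ne hij, lower_raise_of_ne hij.symm]
  abel

theorem dual_dual_self (i : Fin n) (f : Finset (Fin n) → W) :
    cliffordNeg R i (cliffordNeg R i f) = -f := by
  have h3 := lower_raise_self (R := R) i f
  simp only [cliffordNeg_apply, map_sub, lower_lower_self, raise_raise_self]
  linear_combination (norm := module) -h3

theorem parity_clifford (i : Fin n) (f : Finset (Fin n) → W) :
    parity R (cliffordPos R i f) = -cliffordPos R i (parity R f) := by
  simp only [cliffordPos_apply, map_add, parity_lower, parity_raise]; abel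

theorem parity_dual (i : Fin n) (f : Finset (Fin n) → W) :
    parity R (cliffordNeg R i f) = -cliffordNeg R i (parity R f) := by
  simp only [cliffordNeg_apply, map_sub, parity_lower, parity_raise]; abel

end CliffordOperators

section Dirac

open MvPolynomial

variable {F : Type*} [Field F] {s : ℕ} {M : Type*} [AddCommGroup M]
    [Module (MvPolynomial (Fin s) F) M]

/-- The Dirac operator, a square root of `∑ i, X i ^ 2`. -/
noncomputable def dirac (F : Type*) [Field F] (s : ℕ) (M : Type*) [AddCommGroup M]
    [Module (MvPolynomial (Fin s) F) M] :
    (Finset (Fin s) → M) →ₗ[MvPolynomial (Fin s) F] (Finset (Fin s) → M) :=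
  ∑ i, (X i : MvPolynomial (Fin s) F) •
    cliffordPos (MvPolynomial (Fin s) F) i

theorem dirac_apply (f : Finset (Fin s) → M) :
    dirac F s M f = ∑ i, (X i : MvPolynomial (Fin s) F) •
      cliffordPos (MvPolynomial (Fin s) F) i f := by
  simp [dirac]

theorem clifford_dirac (i : Fin s) (f : Finset (Fin s) → M) :
    cliffordPos (MvPolynomial (Fin s) F) i (dirac F s M f) +
      dirac F s M (cliffordPos (MvPolynomial (Fin s) F) i f) =
      (2 : MvPolynomial (Fin s) F) • (X i : MvPolynomial (Fin s) F) • f := by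
  rw [dirac_apply, dirac_apply, map_sum, ← Finset.sum_add_distrib]
  simp_rw [map_smul, ← smul_add, clifford_anticomm, smul_ite, smul_zero]
  rw [Finset.sum_ite_eq, if_pos (Finset.mem_univ _), smul_comm]

theorem dual_dirac (i : Fin s) (f : Finset (Fin s) → M) :
    cliffordNeg (MvPolynomial (Fin s) F) i (dirac F s M f) =
      -dirac F s M
        (cliffordNeg (MvPolynomial (Fin s) F) i f) := by
  rw [dirac_apply, dirac_apply, map_sum, ← Finset.sum_neg_distrib]
  simp_rw [map_smul, clifford_dual_anticomm, smul_neg]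

theorem parity_dirac (f : Finset (Fin s) → M) :
    parity (MvPolynomial (Fin s) F) (dirac F s M f) =
      -dirac F s M (parity (MvPolynomial (Fin s) F) f) := by
  rw [dirac_apply, dirac_apply, map_sum, ← Finset.sum_neg_distrib]
  simp_rw [map_smul, parity_clifford, smul_neg]

/-- Operators that pairwise anticommute and anticommute with the Dirac operator. -/
noncomputable def diracSymmetry (F : Type*) [Field F] (s : ℕ) (M : Type*) [AddCommGroup M]
    [Module (MvPolynomial (Fin s) F) M] :
    Fin (s + 1) → (Finset (Fin s) → M) →ₗ[MvPolynomial (Fin s) F] (Finset (Fin s) → M) :=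
  Fin.cons (parity (MvPolynomial (Fin s) F)) fun j =>
    cliffordNeg (MvPolynomial (Fin s) F) j

theorem diracSymmetry_dirac (j : Fin (s + 1)) (f : Finset (Fin s) → M) :
    diracSymmetry F s M j (dirac F s M f) = -dirac F s M (diracSymmetry F s M j f) := by
  refine Fin.cases ?_ (fun j => ?_) j
  · exact parity_dirac (F := F) f
  · exact dual_dirac (F := F) j f

variable [Module F M]

theorem two_smul_eq (f : M) : (2 : MvPolynomial (Fin s) F) • f = (2 : F) • f := by
  rw [two_smul, two_smul]

section Stability

variable {R : Type*} [CommRing R] [Module R M] {n : ℕ} {p : Submodule F M}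

theorem lower_mem_pi (i : Fin n) {f : Finset (Fin n) → M}
    (hf : f ∈ Submodule.pi Set.univ (fun _ => p)) :
    lower R i f ∈ Submodule.pi Set.univ (fun _ => p) := by
  rw [mem_pi_univ] at hf ⊢
  intro T
  rw [lower_apply]
  split_ifs
  · exact p.zero_mem
  · exact zsmul_mem (hf _) _

theorem raise_mem_pi (i : Fin n) {f : Finset (Fin n) → M}
    (hf : f ∈ Submodule.pi Set.univ (fun _ => p)) :
    raise R i f ∈ Submodule.pi Set.univ (fun _ => p) := by
  rw [mem_pi_univ] at hf ⊢
  intro T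
  rw [raise_apply]
  split_ifs
  · exact zsmul_mem (hf _) _
  · exact p.zero_mem

theorem parity_mem_pi {f : Finset (Fin n) → M}
    (hf : f ∈ Submodule.pi Set.univ (fun _ => p)) :
    parity R f ∈ Submodule.pi Set.univ (fun _ => p) := by
  rw [mem_pi_univ] at hf ⊢
  intro T
  rw [parity_apply]
  exact zsmul_mem (hf _) _

end Stability

theorem diracSymmetry_mem_pi {p : Submodule F M} (j : Fin (s + 1)) {f : Finset (Fin s) → M}
    (hf : f ∈ Submodule.pi Set.univ (fun _ => p)) :
    diracSymmetry F s M j f ∈ Submodule.pi Set.univ (fun _ => p) := by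
  refine Fin.cases ?_ (fun j => ?_) j
  · exact parity_mem_pi hf
  · exact Submodule.sub_mem _ (lower_mem_pi j hf) (raise_mem_pi j hf)

theorem PolyGrading.IsGradedSub.pi {G : PolyGrading F s M} {N : ℕ → Submodule F M}
    (hN : G.IsGradedSub N) (κ : Type*) [Fintype κ] :
    (G.pi κ).IsGradedSub (fun k => Submodule.pi Set.univ (fun _ => N k)) where
  le k _ hv := (mem_pi_univ _ _).2 fun t => hN.le k ((mem_pi_univ _ _).1 hv t)
  X_smul_mem i hv := (mem_pi_univ _ _).2 fun t => hN.X_smul_mem i ((mem_pi_univ _ _).1 hv t)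

theorem dirac_dirac (h2 : (2 : F) ≠ 0) (f : Finset (Fin s) → M) :
    dirac F s M (dirac F s M f) = (∑ i, (X i : MvPolynomial (Fin s) F) ^ 2) • f := by
  have h : (2 : F) • dirac F s M (dirac F s M f) =
      (2 : F) • (∑ i, (X i : MvPolynomial (Fin s) F) ^ 2) • f := by
    rw [two_smul]
    nth_rewrite 1 [dirac_apply]
    nth_rewrite 3 [dirac_apply]
    rw [map_sum, ← Finset.sum_add_distrib]
    simp_rw [map_smul, ← smul_add, clifford_dirac]
    rw [← two_smul_eq (s := s), Finset.sum_smul, Finset.smul_sum]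
    refine Finset.sum_congr rfl fun i _ => ?_
    rw [smul_comm, pow_two, mul_smul]
  exact smul_right_injective _ h2 h

theorem PolyGrading.IsGradedSub.dirac_mem {G : PolyGrading F s M}
    {N : ℕ → Submodule F M} (hN : G.IsGradedSub N) {k : ℕ} {v : Finset (Fin s) → M}
    (hv : v ∈ Submodule.pi Set.univ (fun _ => N k)) :
    dirac F s M v ∈ Submodule.pi Set.univ (fun _ => N (k + 1)) := by
  rw [dirac_apply]
  exact Submodule.sum_mem _ fun i _ => (hN.pi _).X_smul_mem i
    (Submodule.add_mem _ (lower_mem_pi (R := MvPolynomial (Fin s) F) i hv)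
      (raise_mem_pi (R := MvPolynomial (Fin s) F) i hv))

variable [IsScalarTower F (MvPolynomial (Fin s) F) M]

theorem two_pow_dvd_finrank_of_diracSymmetry (h2 : (2 : F) ≠ 0)
    (U : Submodule F (Finset (Fin s) → M)) [FiniteDimensional F U]
    (hU : ∀ j, ∀ w ∈ U, diracSymmetry F s M j w ∈ U) :
    2 ^ ((s + 1) / 2) ∣ Module.finrank F U := by
  refine two_pow_dvd_finrank_submodule h2 (fun j => (diracSymmetry F s M j).restrictScalars F)
    (Fin.cons 1 fun _ => -1) ?_ ?_ ?_ U hU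
  · intro j
    refine Fin.cases ?_ (fun j => ?_) j <;> simp
  · intro j w
    refine Fin.cases ?_ (fun j => ?_) j
    · simpa using! parity_parity (R := MvPolynomial (Fin s) F) w
    · simpa using! dual_dual_self (R := MvPolynomial (Fin s) F) j w
  · intro i j
    refine Fin.cases ?_ (fun i => ?_) i <;> refine Fin.cases ?_ (fun j => ?_) j
    · simp
    · intro _ w
      exact parity_dual j w
    · intro _ w
      exact (neg_eq_iff_eq_neg.2 (parity_dual i w)).symm
    · intro h w
      exact dual_dual_anticomm (fun e => h (congrArg Fin.succ e)) w

namespace PolyGrading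

namespace IsGradedSub

variable {G : PolyGrading F s M} {N N' : ℕ → Submodule F M}

theorem two_pow_mul_eq [IsNoetherian (MvPolynomial (Fin s) F) M] (h2 : (2 : F) ≠ 0)
    (hN : G.IsGradedSub N) (hN' : G.IsGradedSub N')
    (hle : ∀ k, N' k ≤ N k)
    (hq : ∀ k, ∀ v ∈ N k, (∑ i, (X i : MvPolynomial (Fin s) F) ^ 2) • v ∈ N' (k + 2))
    {a : ℚ} (ha : HasAltSum (fun k => (Module.finrank F (N k) : ℚ) - Module.finrank F (N' k)) a) :
    ∃ z : ℤ, 2 ^ s * a = 2 ^ ((s + 1) / 2) * z := by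
  set A : ℕ → Submodule F (Finset (Fin s) → M) :=
    fun k => Submodule.pi Set.univ (fun _ => N k) with hA
  set A' : ℕ → Submodule F (Finset (Fin s) → M) :=
    fun k => Submodule.pi Set.univ (fun _ => N' k) with hA'
  set D := (dirac F s M).restrictScalars F with hD
  have gA : (G.pi _).IsGradedSub A := hN.pi _
  have gA' : (G.pi _).IsGradedSub A' := hN'.pi _
  have hleA : ∀ k, A' k ≤ A k := fun k v hv =>
    (mem_pi_univ _ _).2 fun t => hle k ((mem_pi_univ _ _).1 hv t)
  have hDX : ∀ (i : Fin s) v, D ((X i : MvPolynomial (Fin s) F) • v) =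
      (X i : MvPolynomial (Fin s) F) • D v := fun i v => (dirac F s M).map_smul _ v
  set Bd := supMap A A' D with hBd
  set Cyc : ℕ → Submodule F (Finset (Fin s) → M) :=
    fun k => A k ⊓ (A' (k + 1)).comap D with hCyc
  have gBd : (G.pi _).IsGradedSub Bd :=
    gA.supMap_isGradedSub gA' (fun k v hv => gA.le _ (hN.dirac_mem hv)) hDX
  have gCyc : (G.pi _).IsGradedSub Cyc := gA.infComap_isGradedSub gA' hDX
  have hA'Bd : ∀ k, A' k ≤ Bd k := by
    intro k
    cases k with
    | zero => exact le_rfl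
    | succ k => exact le_sup_left
  have hBdCyc : ∀ k, Bd k ≤ Cyc k := by
    intro k
    have h0 : A' k ≤ Cyc k := fun v hv => ⟨hleA k hv, hN'.dirac_mem hv⟩
    cases k with
    | zero => exact h0
    | succ k =>
      refine sup_le h0 ?_
      rintro _ ⟨v, hv, rfl⟩
      refine ⟨hN.dirac_mem hv, ?_⟩
      have : D (D v) = _ := dirac_dirac h2 v
      rw [SetLike.mem_coe, Submodule.mem_comap, this]
      exact (mem_pi_univ _ _).2 fun t => hq k _ ((mem_pi_univ _ _).1 hv t)
  have hX : ∀ k (i : Fin s), ∀ v ∈ Cyc k, (X i : MvPolynomial (Fin s) F) • v ∈ Bd (k + 1) := by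
    intro k i v hv
    have h := clifford_dirac (F := F) i v
    rw [two_smul_eq] at h
    have h' : (2 : F) • (X i : MvPolynomial (Fin s) F) • v ∈ Bd (k + 1) := by
      rw [← h]
      refine Submodule.add_mem _ (hA'Bd _ ?_) ?_
      · exact Submodule.add_mem _ (lower_mem_pi (R := MvPolynomial (Fin s) F) i hv.2)
          (raise_mem_pi (R := MvPolynomial (Fin s) F) i hv.2)
      · refine (le_sup_right : _ ≤ Bd (k + 1)) ⟨_, ?_, rfl⟩
        exact Submodule.add_mem _ (lower_mem_pi (R := MvPolynomial (Fin s) F) i hv.1)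
          (raise_mem_pi (R := MvPolynomial (Fin s) F) i hv.1)
    exact (Submodule.smul_mem_iff _ h2).1 h'
  obtain ⟨K, hK⟩ := gCyc.eventually_le
  have hev : ∀ k, K + 1 ≤ k → Cyc k = Bd k := by
    intro k hk
    obtain ⟨k, rfl⟩ : ∃ l, k = l + 1 := ⟨k - 1, by omega⟩
    exact le_antisymm (hK k (by omega) _ (hX k)) (hBdCyc _)
  have dvdCyc : ∀ k, 2 ^ ((s + 1) / 2) ∣ Module.finrank F (Cyc k) := by
    intro k
    have := gCyc.finiteDimensional k
    refine two_pow_dvd_finrank_of_diracSymmetry h2 _ fun j w hw => ⟨?_, ?_⟩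
    · exact diracSymmetry_mem_pi j hw.1
    · have h := diracSymmetry_mem_pi j hw.2
      have e : D (diracSymmetry F s M j w) = -diracSymmetry F s M j (D w) := by
        rw [eq_neg_iff_add_eq_zero, add_comm, ← eq_neg_iff_add_eq_zero]
        exact diracSymmetry_dirac j w
      rw [SetLike.mem_coe, Submodule.mem_comap, e]
      exact Submodule.neg_mem _ h
  have dvdBd : ∀ k, 2 ^ ((s + 1) / 2) ∣ Module.finrank F (Bd k) := by
    intro k
    have := gBd.finiteDimensional k
    refine two_pow_dvd_finrank_of_diracSymmetry h2 _ fun j w hw => ?_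
    cases k with
    | zero => exact diracSymmetry_mem_pi j hw
    | succ k =>
      obtain ⟨u, hu, _, ⟨v, hv, rfl⟩, rfl⟩ := Submodule.mem_sup.1 hw
      rw [map_add]
      refine Submodule.add_mem _ (hA'Bd _ (diracSymmetry_mem_pi j hu)) ?_
      have e : diracSymmetry F s M j (D v) = _ := diracSymmetry_dirac j v
      rw [e]
      exact Submodule.neg_mem _
        ((le_sup_right : _ ≤ Bd (k + 1)) ⟨_, diracSymmetry_mem_pi j hv, rfl⟩)
  have hsum := HasAltSum.of_finite_support
    (f := fun k => (Module.finrank F (Cyc k) : ℚ) - Module.finrank F (Bd k)) (K + 1)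
    (fun k hk => sub_eq_zero.2 (by rw [hev k hk]))
  obtain ⟨b, hb⟩ := gBd.exists_hasAltSum_sub gA' hA'Bd
  have hb' := hb.succ
  have h0 : Bd 0 = A' 0 := rfl
  have htot := (hsum.add hb).add hb'
  have hdimA : ∀ k, (Module.finrank F (A k) : ℚ) = 2 ^ s * Module.finrank F (N k) := by
    intro k
    have := hN.finiteDimensional k
    rw [hA, finrank_pi_univ]
    simp [Fintype.card_finset]
  have hdimA' : ∀ k, (Module.finrank F (A' k) : ℚ) = 2 ^ s * Module.finrank F (N' k) := by
    intro k
    have := hN'.finiteDimensional k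
    rw [hA', finrank_pi_univ]
    simp [Fintype.card_finset]
  have key := (ha.const_mul (2 ^ s)).unique (htot.congr fun k => by
    have h1 := gA.finrank_infComap_add_finrank_supMap gA' D k
    have h2 : (Module.finrank F (Cyc k) : ℚ) + Module.finrank F (Bd (k + 1)) =
        Module.finrank F (A k) + Module.finrank F (A' (k + 1)) := by exact_mod_cast h1
    have h3 := hdimA k
    have h4 := hdimA' k
    linear_combination h2 + h3 - h4)
  choose x hx using dvdCyc
  choose y hy using dvdBd
  refine ⟨∑ k ∈ Finset.range (K + 1), (-1) ^ k * ((x k : ℤ) - y k), ?_⟩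
  rw [key, h0]
  push_cast
  rw [Finset.mul_sum, sub_self, add_assoc, zero_sub, add_neg_cancel, add_zero]
  refine Finset.sum_congr rfl fun k _ => ?_
  rw [hx, hy]
  push_cast
  ring

end IsGradedSub

end PolyGrading

end Dirac

section Complex

open MvPolynomial

theorem finrank_homogeneousSubmodule (F : Type*) [Field F] (s k : ℕ) :
    Module.finrank F (homogeneousSubmodule (Fin s) F k) = s.multichoose k := by
  have hset : {d : Fin s →₀ ℕ | d.degree = k} =
      ((Finset.univ : Finset (Fin s)).finsuppAntidiag k : Set (Fin s →₀ ℕ)) := by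
    ext d
    simp [Finset.mem_finsuppAntidiag, Finsupp.degree_eq_sum]
  rw [homogeneousSubmodule_eq_finsupp_supported, hset,
    (AddMonoidAlgebra.supportedEquivFinsupp _).finrank_eq, Module.finrank_finsupp_self]
  simp [Finset.card_finsuppAntidiag_nat_eq_multichoose]

theorem one_sub_X_pow_mul_mk_multichoose (R : Type*) [CommRing R] (s : ℕ) :
    (1 - PowerSeries.X) ^ s * PowerSeries.mk (fun k => (s.multichoose k : R)) = 1 := by
  induction s with
  | zero =>
    ext k
    cases k <;> simp [PowerSeries.coeff_one]
  | succ s ih =>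
    rw [pow_succ, mul_assoc]
    convert ih using 2
    ext k
    rw [sub_mul, one_mul, map_sub, PowerSeries.coeff_mk, PowerSeries.coeff_mk]
    cases k with
    | zero => simp
    | succ k =>
      rw [PowerSeries.coeff_succ_X_mul, PowerSeries.coeff_mk, Nat.multichoose_succ_succ]
      push_cast
      ring

theorem hasAltSum_multichoose (s : ℕ) :
    HasAltSum (fun k => (s.multichoose k : ℚ)) (1 / 2 ^ s) :=
  ⟨s, 1, by rw [one_sub_X_pow_mul_mk_multichoose]; simp, by simp⟩

namespace PolyGrading

variable {F : Type*} [Field F] {s : ℕ} {M : Type*} [AddCommGroup M] [Module F M]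
    [Module (MvPolynomial (Fin s) F) M]

theorem quadric_smul_mem (G : PolyGrading F s M) {k : ℕ} {v : M} (hv : v ∈ G.piece k) :
    (∑ i, (X i : MvPolynomial (Fin s) F) ^ 2) • v ∈ G.piece (k + 2) := by
  rw [Finset.sum_smul]
  refine Submodule.sum_mem _ fun i _ => ?_
  rw [pow_two, mul_smul]
  exact G.X_smul_mem i (G.X_smul_mem i hv)

variable {G : PolyGrading F s M} {d : M →ₗ[MvPolynomial (Fin s) F] M}

theorem map_proj (hd : ∀ k, ∀ v ∈ G.piece k, d v ∈ G.piece (k + 1)) (k : ℕ) (w : M) :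
    G.proj (k + 1) (d w) = d (G.proj k w) := by
  have hw : w ∈ ⨆ l, G.piece l := by rw [G.iSup_piece]; trivial
  induction hw using Submodule.iSup_induction' with
  | mem l v hv =>
    rcases eq_or_ne l k with rfl | h
    · rw [G.proj_of_mem hv, G.proj_of_mem (hd _ v hv)]
    · rw [G.proj_of_mem_of_ne hv h, G.proj_of_mem_of_ne (hd _ v hv) (by omega), map_zero]
  | zero => simp
  | add x y _ _ hx hy => simp [hx, hy]

theorem proj_zero_map (hd : ∀ k, ∀ v ∈ G.piece k, d v ∈ G.piece (k + 1)) (w : M) :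
    G.proj 0 (d w) = 0 := by
  have hw : w ∈ ⨆ l, G.piece l := by rw [G.iSup_piece]; trivial
  induction hw using Submodule.iSup_induction' with
  | mem l v hv => rw [G.proj_of_mem_of_ne (hd _ v hv) (by omega)]
  | zero => simp
  | add x y _ _ hx hy => simp [hx, hy]

theorem proj_mem (G : PolyGrading F s M) (k : ℕ) (w : M) : G.proj k w ∈ G.piece k := by
  have hw : w ∈ ⨆ l, G.piece l := by rw [G.iSup_piece]; trivial
  induction hw using Submodule.iSup_induction' with
  | mem l v hv =>
    rcases eq_or_ne l k with rfl | h
    · rwa [G.proj_of_mem hv]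
    · rw [G.proj_of_mem_of_ne hv h]; exact Submodule.zero_mem _
  | zero => simp
  | add x y _ _ hx hy => rw [map_add]; exact Submodule.add_mem _ hx hy

variable [IsScalarTower F (MvPolynomial (Fin s) F) M]

theorem isGradedSub_inf (G : PolyGrading F s M) (P : Submodule (MvPolynomial (Fin s) F) M) :
    G.IsGradedSub (fun k => G.piece k ⊓ P.restrictScalars F) where
  le _ := inf_le_left
  X_smul_mem i hv := ⟨G.X_smul_mem i hv.1, P.smul_mem _ hv.2⟩

theorem map_piece (hd : ∀ k, ∀ v ∈ G.piece k, d v ∈ G.piece (k + 1)) (k : ℕ) :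
    (G.piece k).map (d.restrictScalars F) =
      G.piece (k + 1) ⊓ (LinearMap.range d).restrictScalars F := by
  ext v
  constructor
  · rintro ⟨w, hw, rfl⟩
    exact ⟨hd k w hw, w, rfl⟩
  · rintro ⟨hv, w, rfl⟩
    refine ⟨G.proj k w, G.proj_mem k w, ?_⟩
    rw [LinearMap.restrictScalars_apply, ← map_proj hd, G.proj_of_mem hv]

theorem piece_zero_inf_range (hd : ∀ k, ∀ v ∈ G.piece k, d v ∈ G.piece (k + 1)) :
    G.piece 0 ⊓ (LinearMap.range d).restrictScalars F = ⊥ := by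
  rw [eq_bot_iff]
  rintro v ⟨hv, w, rfl⟩
  rw [Submodule.mem_bot, ← G.proj_of_mem hv, proj_zero_map hd]

/-- If the homology of a differential of degree one is killed by a power of `∑ i, X i ^ 2`, then
the Euler characteristic of the module is divisible by a power of two. -/
theorem exists_two_pow_mul_eq [IsNoetherian (MvPolynomial (Fin s) F) M] (h2 : (2 : F) ≠ 0)
    (hd : ∀ k, ∀ v ∈ G.piece k, d v ∈ G.piece (k + 1)) (hdd : ∀ v, d (d v) = 0) (m : ℕ)
    (hq : ∀ z, d z = 0 → (∑ i, (X i : MvPolynomial (Fin s) F) ^ 2) ^ m • z ∈ LinearMap.range d)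
    {a : ℚ} (ha : HasAltSum (fun k => (Module.finrank F (G.piece k) : ℚ)) a) :
    ∃ z : ℤ, 2 ^ s * a = 2 ^ ((s + 1) / 2) * z := by
  set q : MvPolynomial (Fin s) F := ∑ i, (X i : MvPolynomial (Fin s) F) ^ 2 with hqdef
  let P : ℕ → Submodule (MvPolynomial (Fin s) F) M := fun t =>
    LinearMap.ker d ⊓ (LinearMap.range d).comap (LinearMap.lsmul _ M (q ^ t))
  have mem_P : ∀ t v, v ∈ P t ↔ d v = 0 ∧ q ^ t • v ∈ LinearMap.range d := fun t v => Iff.rfl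
  have P_zero : P 0 = LinearMap.range d := by
    ext v
    rw [mem_P, pow_zero, one_smul]
    refine ⟨fun h => h.2, fun h => ⟨?_, h⟩⟩
    obtain ⟨w, rfl⟩ := h
    exact hdd w
  have P_last : P m = LinearMap.ker d := by
    ext v
    rw [mem_P]
    exact ⟨fun h => h.1, fun h => ⟨h, hq v h⟩⟩
  have P_le : ∀ t, P t ≤ P (t + 1) := by
    intro t v hv
    rw [mem_P] at hv ⊢
    refine ⟨hv.1, ?_⟩
    rw [pow_succ', mul_smul]
    exact Submodule.smul_mem _ _ hv.2
  have hL := fun t => G.isGradedSub_inf (P t)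
  choose b hb using fun t => (hL t).exists_hasAltSum
  have step : ∀ t, ∃ z : ℤ, 2 ^ s * (b t - b 0) = 2 ^ ((s + 1) / 2) * z := by
    intro t
    induction t with
    | zero => exact ⟨0, by simp⟩
    | succ t ih =>
      obtain ⟨z, hz⟩ := ih
      obtain ⟨z', hz'⟩ := (hL (t + 1)).two_pow_mul_eq h2 (hL t)
        (fun k => inf_le_inf_left _ (P_le t)) (by
          rintro k v ⟨hv, hv'⟩
          refine ⟨G.quadric_smul_mem hv, (mem_P _ _).2 ?_⟩
          have hv' := (mem_P _ _).1 hv'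
          refine ⟨by rw [map_smul, hv'.1, smul_zero], ?_⟩
          rw [smul_smul, ← pow_succ]
          exact hv'.2) ((hb (t + 1)).sub (hb t))
      exact ⟨z + z', by push_cast; linear_combination hz + hz'⟩
  have htot := (hb m).add (hb 0).succ
  obtain ⟨z, hz⟩ := step m
  refine ⟨z, ?_⟩
  rw [← hz]
  have key := ha.unique (htot.congr fun k => by
    have := G.finite k
    have h := finrank_map_add_finrank_inf_ker (d.restrictScalars F) (G.piece k)
    rw [map_piece hd] at h
    rw [P_zero, P_last, ← h]
    push_cast
    rw [add_comm]
    rfl)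
  rw [key, P_zero, piece_zero_inf_range hd]
  simp
  ring

end PolyGrading

theorem two_pow_dvd_card {F : Type*} [Field F] (h2 : (2 : F) ≠ 0) {s : ℕ} {ι : Type*} [Fintype ι]
    (d : (ι → MvPolynomial (Fin s) F) →ₗ[MvPolynomial (Fin s) F] (ι → MvPolynomial (Fin s) F))
    (hd : ∀ k, ∀ v : ι → MvPolynomial (Fin s) F, (∀ t, (v t).IsHomogeneous k) →
      ∀ t, (d v t).IsHomogeneous (k + 1))
    (hdd : ∀ v, d (d v) = 0) (m : ℕ)
    (hq : ∀ z, d z = 0 → (∑ i, (X i : MvPolynomial (Fin s) F) ^ 2) ^ m • z ∈ LinearMap.range d) :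
    2 ^ ((s + 1) / 2) ∣ Fintype.card ι := by
  have ha : HasAltSum (fun k => (Module.finrank F
      (((PolyGrading.polynomial F s).pi ι).piece k) : ℚ)) (Fintype.card ι * (1 / 2 ^ s)) := by
    refine ((hasAltSum_multichoose s).const_mul (Fintype.card ι)).congr fun k => ?_
    have := (PolyGrading.polynomial F s).finite k
    have h : Module.finrank F (((PolyGrading.polynomial F s).pi ι).piece k) =
        Fintype.card ι * Module.finrank F ((PolyGrading.polynomial F s).piece k) :=
      finrank_pi_univ _
    rw [h, ← finrank_homogeneousSubmodule F s k]
    push_cast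
    rfl
  obtain ⟨z, hz⟩ := PolyGrading.exists_two_pow_mul_eq (G := (PolyGrading.polynomial F s).pi ι) h2
    (fun k v hv => (PolyGrading.mem_pi_piece _).2 fun t =>
      hd k v (fun t => (PolyGrading.mem_pi_piece _).1 hv t) t) hdd m hq ha
  have h : (Fintype.card ι : ℚ) = 2 ^ ((s + 1) / 2) * z := by
    rw [← hz]
    field_simp
  rw [← Int.natCast_dvd_natCast]
  exact ⟨z, by exact_mod_cast h⟩

end Complex

section Koszul

variable {R : Type*} [CommRing R]

section Operators

variable {W : Type*} [AddCommGroup W] [Module R W] {n : ℕ}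

/-- Contraction with a vector. -/
def contract (c : Fin n → R) : (Finset (Fin n) → W) →ₗ[R] (Finset (Fin n) → W) :=
  ∑ k, c k • lower R k

/-- Exterior multiplication by a vector. -/
def wedge (c : Fin n → R) : (Finset (Fin n) → W) →ₗ[R] (Finset (Fin n) → W) :=
  ∑ k, c k • raise R k

theorem contract_apply (c : Fin n → R) (f : Finset (Fin n) → W) :
    contract c f = ∑ k, c k • lower R k f := by
  simp [contract]

theorem wedge_apply (c : Fin n → R) (f : Finset (Fin n) → W) :
    wedge c f = ∑ k, c k • raise R k f := by
  simp [wedge]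

theorem contract_contract (c c' : Fin n → R) (f : Finset (Fin n) → W) :
    contract c (contract c' f) = -contract c' (contract c f) := by
  simp only [contract_apply, map_sum, map_smul, Finset.smul_sum]
  rw [Finset.sum_comm, ← Finset.sum_neg_distrib]
  refine Finset.sum_congr rfl fun k _ => ?_
  rw [← Finset.sum_neg_distrib]
  refine Finset.sum_congr rfl fun l _ => ?_
  rw [lower_lower k l, smul_neg, smul_neg, smul_comm]

theorem contract_wedge (c c' : Fin n → R) (f : Finset (Fin n) → W) :
    contract c (wedge c' f) + wedge c' (contract c f) = (∑ k, c k * c' k) • f := by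
  simp only [contract_apply, wedge_apply, map_sum, map_smul, Finset.smul_sum]
  conv_lhs => enter [1]; rw [Finset.sum_comm]
  rw [← Finset.sum_add_distrib, Finset.sum_smul]
  refine Finset.sum_congr rfl fun k _ => ?_
  have : ∀ l, c' l • c k • lower R k (raise R l f) + c k • c' l • raise R l (lower R k f) =
      if k = l then (c k * c' l) • f else 0 := by
    intro l
    rw [smul_comm (c k), ← smul_add, ← smul_add, lower_raise, smul_ite, smul_ite, smul_zero,
      smul_zero, mul_comm, mul_smul]
  rw [← Finset.sum_add_distrib, Finset.sum_congr rfl fun l _ => this l]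
  simp

theorem contract_compLeft (c : Fin n → R) (g : W →ₗ[R] W) (f : Finset (Fin n) → W) :
    contract c (g.compLeft _ f) = g.compLeft _ (contract c f) := by
  simp only [contract_apply, map_sum, map_smul]
  refine Finset.sum_congr rfl fun k _ => ?_
  congr 1
  funext T
  simp only [lower_apply, LinearMap.compLeft_apply, Function.comp_apply]
  split_ifs <;> simp

theorem wedge_compLeft (c : Fin n → R) (g : W →ₗ[R] W) (f : Finset (Fin n) → W) :
    wedge c (g.compLeft _ f) = g.compLeft _ (wedge c f) := by
  simp only [wedge_apply, map_sum, map_smul]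
  refine Finset.sum_congr rfl fun k _ => ?_
  congr 1
  funext T
  simp only [raise_apply, LinearMap.compLeft_apply, Function.comp_apply]
  split_ifs <;> simp

end Operators

section Variables

variable {r : ℕ}

/-- Multiplication of a power series, given by its coefficients, by a variable. -/
def mulVar (R : Type*) [CommRing R] {r : ℕ} (a : Fin r) :
    ((Fin r → ℕ) → R) →ₗ[R] ((Fin r → ℕ) → R) where
  toFun w α := if α a = 0 then 0 else w (α - Pi.single a 1)
  map_add' w w' := by
    funext α
    simp only [Pi.add_apply]
    split_ifs <;> simp
  map_smul' c w := by
    funext α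
    simp only [Pi.smul_apply, RingHom.id_apply]
    split_ifs <;> simp

/-- Division of a power series by a variable, discarding the remainder. -/
def divVar (R : Type*) [CommRing R] {r : ℕ} (a : Fin r) :
    ((Fin r → ℕ) → R) →ₗ[R] ((Fin r → ℕ) → R) where
  toFun w α := w (α + Pi.single a 1)
  map_add' _ _ := rfl
  map_smul' _ _ := rfl

/-- The remainder of the division of a power series by a variable. -/
def modVar (R : Type*) [CommRing R] {r : ℕ} (a : Fin r) :
    ((Fin r → ℕ) → R) →ₗ[R] ((Fin r → ℕ) → R) where
  toFun w α := if α a = 0 then w α else 0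
  map_add' w w' := by
    funext α
    simp only [Pi.add_apply]
    split_ifs <;> simp
  map_smul' c w := by
    funext α
    simp only [Pi.smul_apply, RingHom.id_apply]
    split_ifs <;> simp

theorem mulVar_apply (a : Fin r) (w : (Fin r → ℕ) → R) (α : Fin r → ℕ) :
    mulVar R a w α = if α a = 0 then 0 else w (α - Pi.single a 1) := rfl

theorem divVar_apply (a : Fin r) (w : (Fin r → ℕ) → R) (α : Fin r → ℕ) :
    divVar R a w α = w (α + Pi.single a 1) := rfl

theorem modVar_apply (a : Fin r) (w : (Fin r → ℕ) → R) (α : Fin r → ℕ) :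
    modVar R a w α = if α a = 0 then w α else 0 := rfl

theorem single_le_of_ne_zero {a : Fin r} {α : Fin r → ℕ} (h : α a ≠ 0) : Pi.single a 1 ≤ α := by
  intro b
  rcases eq_or_ne b a with rfl | hb
  · simpa [Nat.one_le_iff_ne_zero] using h
  · simp [hb]

theorem divVar_mulVar_self (a : Fin r) (w : (Fin r → ℕ) → R) :
    divVar R a (mulVar R a w) = w := by
  funext α
  simp [divVar_apply, mulVar_apply]

theorem mulVar_divVar_self (a : Fin r) (w : (Fin r → ℕ) → R) :
    mulVar R a (divVar R a w) = w - modVar R a w := by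
  funext α
  rw [mulVar_apply, Pi.sub_apply, modVar_apply]
  split_ifs with h
  · simp
  · rw [divVar_apply, tsub_add_cancel_of_le (single_le_of_ne_zero h), sub_zero]

theorem mulVar_comm (a b : Fin r) (w : (Fin r → ℕ) → R) :
    mulVar R a (mulVar R b w) = mulVar R b (mulVar R a w) := by
  rcases eq_or_ne a b with rfl | hab
  · rfl
  funext α
  simp only [mulVar_apply, Pi.sub_apply, Pi.single_eq_of_ne hab, Pi.single_eq_of_ne hab.symm,
    tsub_zero]
  rw [tsub_right_comm]
  split_ifs <;> rfl

theorem divVar_mulVar_of_ne {a b : Fin r} (hab : a ≠ b) (w : (Fin r → ℕ) → R) :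
    divVar R a (mulVar R b w) = mulVar R b (divVar R a w) := by
  funext α
  simp only [mulVar_apply, divVar_apply, Pi.add_apply, Pi.single_eq_of_ne hab.symm, add_zero]
  split_ifs with h
  · rfl
  · rw [tsub_add_eq_add_tsub (single_le_of_ne_zero h)]

end Variables

variable {r n : ℕ} {A : Fin r → Fin n → R} {q : R}

/-- The Koszul differential of the vectors `A a`. -/
def koszul (A : Fin r → Fin n → R) :
    (Finset (Fin n) → (Fin r → ℕ) → R) →ₗ[R] (Finset (Fin n) → (Fin r → ℕ) → R) :=
  ∑ a, (mulVar R a).compLeft _ ∘ₗ contract (A a)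

theorem koszul_apply (f : Finset (Fin n) → (Fin r → ℕ) → R) :
    koszul A f = ∑ a, (mulVar R a).compLeft _ (contract (A a) f) := by
  simp [koszul]

theorem koszul_koszul (h2 : IsUnit (2 : R)) (f : Finset (Fin n) → (Fin r → ℕ) → R) :
    koszul A (koszul A f) = 0 := by
  have h : koszul A (koszul A f) = -koszul A (koszul A f) := by
    simp only [koszul_apply, map_sum]
    conv_lhs => rw [Finset.sum_comm]
    rw [← Finset.sum_neg_distrib]
    refine Finset.sum_congr rfl fun a _ => ?_
    rw [← Finset.sum_neg_distrib]
    refine Finset.sum_congr rfl fun b _ => ?_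
    rw [contract_compLeft, contract_compLeft, contract_contract (A b), map_neg, map_neg, neg_neg]
    funext T
    exact mulVar_comm (R := R) _ _ _
  rw [eq_neg_iff_add_eq_zero, ← two_smul R] at h
  exact h2.smul_eq_zero.1 h

/-- Part of the homotopy of the Koszul complex. -/
def koszulHomotopy (A : Fin r → Fin n → R) (a : Fin r) :
    (Finset (Fin n) → (Fin r → ℕ) → R) →ₗ[R] (Finset (Fin n) → (Fin r → ℕ) → R) :=
  (divVar R a).compLeft _ ∘ₗ wedge (A a)

/-- Exterior multiplication by a vector after setting the corresponding variable to zero. -/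
def wedgeMod (A : Fin r → Fin n → R) (a : Fin r) :
    (Finset (Fin n) → (Fin r → ℕ) → R) →ₗ[R] (Finset (Fin n) → (Fin r → ℕ) → R) :=
  (modVar R a).compLeft _ ∘ₗ wedge (A a)

theorem contract_wedgeMod (hA : ∀ a b, ∑ k, A a k * A b k = if a = b then q else 0) {a b : Fin r}
    (hab : a ≠ b) (f : Finset (Fin n) → (Fin r → ℕ) → R) :
    wedgeMod A b (contract (A a) f) = -contract (A a) (wedgeMod A b f) := by
  have h := contract_wedge (A a) (A b) f
  rw [hA, if_neg hab, zero_smul, add_comm, ← eq_neg_iff_add_eq_zero] at h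
  simp only [wedgeMod, LinearMap.comp_apply]
  rw [contract_compLeft, h, map_neg]

theorem koszul_koszulHomotopy (hA : ∀ a b, ∑ k, A a k * A b k = if a = b then q else 0)
    (a : Fin r) (f : Finset (Fin n) → (Fin r → ℕ) → R) :
    koszul A (koszulHomotopy A a f) + koszulHomotopy A a (koszul A f) =
      q • f - contract (A a) (wedgeMod A a f) := by
  have term : ∀ b, (mulVar R b).compLeft _ (contract (A b) (koszulHomotopy A a f)) +
      koszulHomotopy A a ((mulVar R b).compLeft _ (contract (A b) f)) =
      if b = a then q • f - contract (A a) (wedgeMod A a f) else 0 := by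
    intro b
    have h := contract_wedge (A b) (A a) f
    rw [hA] at h
    simp only [koszulHomotopy, wedgeMod, LinearMap.comp_apply]
    rw [wedge_compLeft, contract_compLeft, contract_compLeft]
    split_ifs with hb
    · subst hb
      rw [if_pos rfl] at h
      rw [← h]
      funext T
      simp only [Pi.add_apply, Pi.sub_apply, LinearMap.compLeft_apply, Function.comp_apply]
      rw [divVar_mulVar_self, mulVar_divVar_self]
      abel
    · rw [if_neg hb, zero_smul, ← eq_neg_iff_add_eq_zero] at h
      rw [h]
      funext T
      simp only [Pi.add_apply, LinearMap.compLeft_apply, Function.comp_apply, Pi.neg_apply,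
        map_neg, Pi.zero_apply]
      rw [divVar_mulVar_of_ne (Ne.symm hb)]
      abel
  rw [koszul_apply, koszul_apply, map_sum, ← Finset.sum_add_distrib,
    Finset.sum_congr rfl fun b _ => term b]
  simp

/-- Successive exterior multiplication by the vectors in a list. -/
def wedgeModList (A : Fin r → Fin n → R) :
    List (Fin r) → (Finset (Fin n) → (Fin r → ℕ) → R) → (Finset (Fin n) → (Fin r → ℕ) → R)
  | [], f => f
  | a :: l, f => wedgeModList A l (wedgeMod A a f)

theorem wedgeModList_neg (l : List (Fin r)) :
    ∀ f, wedgeModList A l (-f) = -wedgeModList A l f := by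
  induction l with
  | nil => intro f; rfl
  | cons a l ih => intro f; rw [wedgeModList, wedgeModList, map_neg, ih]

theorem wedgeModList_contract (hA : ∀ a b, ∑ k, A a k * A b k = if a = b then q else 0)
    {a : Fin r} (l : List (Fin r)) (ha : a ∉ l) :
    ∀ f, wedgeModList A l f = 0 → wedgeModList A l (contract (A a) f) = 0 := by
  induction l with
  | nil => intro f hf; rw [wedgeModList] at hf ⊢; rw [hf, map_zero]
  | cons b l ih =>
    intro f hf
    rw [List.mem_cons, not_or] at ha
    rw [wedgeModList] at hf ⊢
    rw [contract_wedgeMod hA ha.1, wedgeModList_neg, ih ha.2 _ hf, neg_zero]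

theorem pow_length_smul_mem_range (h2 : IsUnit (2 : R))
    (hA : ∀ a b, ∑ k, A a k * A b k = if a = b then q else 0)
    (l : List (Fin r)) (hl : l.Nodup) :
    ∀ f, koszul A f = 0 → wedgeModList A l f = 0 →
      q ^ l.length • f ∈ LinearMap.range (koszul A) := by
  induction l with
  | nil =>
    intro f _ hf
    rw [wedgeModList] at hf
    rw [hf, smul_zero]
    exact Submodule.zero_mem _
  | cons a l ih =>
    intro f hf hlf
    rw [List.nodup_cons] at hl
    have hom := koszul_koszulHomotopy hA a f
    rw [hf, map_zero, add_zero, eq_sub_iff_add_eq] at hom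
    have hc : koszul A (contract (A a) (wedgeMod A a f)) = 0 := by
      have := congrArg (koszul A) hom
      rwa [map_add, koszul_koszul h2, map_smul, hf, smul_zero, zero_add] at this
    rw [List.length_cons, pow_succ, mul_smul, ← hom, smul_add]
    refine Submodule.add_mem _ (Submodule.smul_mem _ _ ⟨_, rfl⟩) ?_
    exact ih hl.2 _ hc (wedgeModList_contract hA l hl.1 _ hlf)

/-- The coefficients of total degree `i` vanish. -/
def VanishAt (i : ℕ) (f : Finset (Fin n) → (Fin r → ℕ) → R) : Prop :=
  ∀ T α, T.card + ∑ a, α a = i → f T α = 0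

theorem sum_sub_single {a : Fin r} {α : Fin r → ℕ} (h : α a ≠ 0) :
    ∑ b, (α - Pi.single a 1 : Fin r → ℕ) b + 1 = ∑ b, α b := by
  conv_rhs => rw [← tsub_add_cancel_of_le (single_le_of_ne_zero h)]
  simp [Finset.sum_add_distrib]

theorem koszul_apply_apply (f : Finset (Fin n) → (Fin r → ℕ) → R) (T : Finset (Fin n))
    (α : Fin r → ℕ) :
    koszul A f T α = ∑ a, if α a = 0 then 0 else ∑ k, A a k *
      if k ∈ T then 0 else fockSign k T • f (insert k T) (α - Pi.single a 1) := by
  rw [koszul_apply, Finset.sum_apply, Finset.sum_apply]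
  refine Finset.sum_congr rfl fun a _ => ?_
  rw [LinearMap.compLeft_apply, Function.comp_apply, mulVar_apply, contract_apply,
    Finset.sum_apply, Finset.sum_apply]
  split_ifs
  · rfl
  · refine Finset.sum_congr rfl fun k _ => ?_
    rw [Pi.smul_apply, Pi.smul_apply, lower_apply, smul_eq_mul]
    split_ifs <;> rfl

theorem VanishAt.koszul {i : ℕ} {f : Finset (Fin n) → (Fin r → ℕ) → R} (hf : VanishAt i f) :
    VanishAt i (koszul A f) := by
  intro T α h
  rw [koszul_apply_apply]
  refine Finset.sum_eq_zero fun a _ => ?_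
  split_ifs with ha
  · rfl
  refine Finset.sum_eq_zero fun k _ => ?_
  split_ifs with hk
  · rw [mul_zero]
  rw [hf, smul_zero, mul_zero]
  rw [Finset.card_insert_of_notMem hk]
  have := sum_sub_single ha
  omega

theorem wedgeMod_apply_apply (a : Fin r) (f : Finset (Fin n) → (Fin r → ℕ) → R)
    (T : Finset (Fin n)) (α : Fin r → ℕ) :
    wedgeMod A a f T α = if α a = 0 then ∑ k, A a k *
      (if k ∈ T then fockSign k T • f (T.erase k) α else 0) else 0 := by
  rw [wedgeMod, LinearMap.comp_apply, LinearMap.compLeft_apply, Function.comp_apply, modVar_apply,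
    wedge_apply, Finset.sum_apply, Finset.sum_apply]
  refine if_congr Iff.rfl (Finset.sum_congr rfl fun k _ => ?_) rfl
  rw [Pi.smul_apply, Pi.smul_apply, raise_apply, smul_eq_mul]
  split_ifs <;> rfl

theorem wedgeModList_eq_zero_of_forall (l : List (Fin r)) {α : Fin r → ℕ} :
    ∀ f : Finset (Fin n) → (Fin r → ℕ) → R, (∀ T, f T α = 0) →
      ∀ T, wedgeModList A l f T α = 0 := by
  induction l with
  | nil => intro f hf; exact hf
  | cons a l ih =>
    intro f hf
    refine ih _ fun T => ?_
    simp [wedgeMod_apply_apply, hf]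

theorem wedgeModList_eq_zero_of_mem {a : Fin r} {α : Fin r → ℕ} (ha : α a ≠ 0)
    (l : List (Fin r)) (hl : a ∈ l) :
    ∀ (f : Finset (Fin n) → (Fin r → ℕ) → R) T, wedgeModList A l f T α = 0 := by
  induction l with
  | nil => simp at hl
  | cons b l ih =>
    intro f
    rcases List.mem_cons.1 hl with rfl | h
    · refine wedgeModList_eq_zero_of_forall l _ fun T => ?_
      rw [wedgeMod_apply_apply, if_neg ha]
    · exact ih h _

theorem wedgeModList_eq_zero_of_card (l : List (Fin r)) {α : Fin r → ℕ} :
    ∀ (p : ℕ) (f : Finset (Fin n) → (Fin r → ℕ) → R), (∀ T, T.card ≠ p → f T α = 0) →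
      ∀ T, T.card ≠ p + l.length → wedgeModList A l f T α = 0 := by
  induction l with
  | nil => intro p f hf; exact hf
  | cons a l ih =>
    intro p f hf T hT
    refine ih (p + 1) _ (fun T hT => ?_) T (by rw [List.length_cons] at hT; omega)
    rw [wedgeMod_apply_apply]
    split_ifs
    · refine Finset.sum_eq_zero fun k _ => ?_
      split_ifs with hk
      · have := Finset.card_erase_add_one hk
        rw [hf _ (by omega), smul_zero, mul_zero]
      · rw [mul_zero]
    · rfl

theorem wedgeModList_finRange_eq_zero {i : ℕ} (hi : n < i + r)
    {f : Finset (Fin n) → (Fin r → ℕ) → R} (hf : ∀ j, j ≠ i → VanishAt j f) :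
    wedgeModList A (List.finRange r) f = 0 := by
  funext T α
  by_cases h : ∃ a, α a ≠ 0
  · obtain ⟨a, ha⟩ := h
    exact wedgeModList_eq_zero_of_mem ha _ (List.mem_finRange a) f T
  · push Not at h
    refine wedgeModList_eq_zero_of_card _ i f (fun T hT => hf _ hT T α (by simp [h])) T ?_
    have := T.card_le_univ
    rw [Fintype.card_fin] at this
    rw [List.length_finRange]
    omega

/-- The exponents of total degree `i` in the Koszul complex. -/
def koszulIndex (n r i : ℕ) : Finset (Finset (Fin n) × (Fin r → ℕ)) :=
  (Finset.HasAntidiagonal.antidiagonal i).biUnion fun p =>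
    Finset.powersetCard p.1 Finset.univ ×ˢ Finset.piAntidiag Finset.univ p.2

theorem mem_koszulIndex {i : ℕ} {t : Finset (Fin n) × (Fin r → ℕ)} :
    t ∈ koszulIndex n r i ↔ t.1.card + ∑ a, t.2 a = i := by
  simp only [koszulIndex, Finset.mem_biUnion, Finset.HasAntidiagonal.mem_antidiagonal,
    Finset.mem_product, Finset.mem_powersetCard_univ, Finset.mem_piAntidiag]
  constructor
  · rintro ⟨p, hp, h1, h2, _⟩
    rw [h1, h2, hp]
  · intro h
    exact ⟨(_, _), h, rfl, rfl, by simp⟩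

theorem card_koszulIndex (n r i : ℕ) :
    (koszulIndex n r i).card =
      ∑ p ∈ Finset.HasAntidiagonal.antidiagonal i, n.choose p.1 * r.multichoose p.2 := by
  rw [koszulIndex, Finset.card_biUnion]
  · refine Finset.sum_congr rfl fun p _ => ?_
    rw [Finset.card_product, Finset.card_powersetCard, Finset.card_univ, Fintype.card_fin]
    congr 1
    have h := Finset.card_finsuppAntidiag_nat_eq_multichoose
      (s := (Finset.univ : Finset (Fin r))) p.2
    rwa [Finset.finsuppAntidiag, Finset.card_map, Finset.card_attach, Finset.card_univ,
      Fintype.card_fin] at h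
  · intro p _ p' _ hp
    refine Finset.disjoint_left.2 fun t ht ht' => ?_
    simp only [Finset.mem_product, Finset.mem_powersetCard_univ, Finset.mem_piAntidiag] at ht ht'
    exact hp (Prod.ext (ht.1.symm.trans ht'.1) (ht.2.1.symm.trans ht'.2.1))

/-- Extension by zero of functions on the exponents of total degree `i`. -/
def koszulExtend (R : Type*) [CommRing R] (n r i : ℕ) :
    (koszulIndex n r i → R) →ₗ[R] (Finset (Fin n) → (Fin r → ℕ) → R) where
  toFun z T α := if h : (T, α) ∈ koszulIndex n r i then z ⟨_, h⟩ else 0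
  map_add' z z' := by
    funext T α
    simp only [Pi.add_apply]
    split_ifs <;> simp
  map_smul' c z := by
    funext T α
    simp only [Pi.smul_apply, RingHom.id_apply]
    split_ifs <;> simp

/-- Restriction of functions to the exponents of total degree `i`. -/
def koszulRestrict (R : Type*) [CommRing R] (n r i : ℕ) :
    (Finset (Fin n) → (Fin r → ℕ) → R) →ₗ[R] (koszulIndex n r i → R) where
  toFun f t := f t.1.1 t.1.2
  map_add' _ _ := rfl
  map_smul' _ _ := rfl

theorem koszulRestrict_koszulExtend (i : ℕ) (z : koszulIndex n r i → R) :
    koszulRestrict R n r i (koszulExtend R n r i z) = z := by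
  funext t
  simp [koszulRestrict, koszulExtend]

theorem vanishAt_koszulExtend {i j : ℕ} (hij : j ≠ i) (z : koszulIndex n r i → R) :
    VanishAt j (koszulExtend R n r i z) := by
  intro T α h
  refine dif_neg fun h' => hij ?_
  rw [mem_koszulIndex] at h'
  exact h.symm.trans h'

theorem koszulExtend_koszulRestrict {i : ℕ} {f : Finset (Fin n) → (Fin r → ℕ) → R}
    (hf : ∀ j, j ≠ i → VanishAt j f) :
    koszulExtend R n r i (koszulRestrict R n r i f) = f := by
  funext T α
  by_cases h : (T, α) ∈ koszulIndex n r i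
  · exact dif_pos h
  · have h' := h
    rw [mem_koszulIndex] at h'
    exact (dif_neg h).trans (hf _ h' T α rfl).symm

theorem koszulRestrict_koszul (i : ℕ) (f : Finset (Fin n) → (Fin r → ℕ) → R) :
    koszulRestrict R n r i (koszul A (koszulExtend R n r i (koszulRestrict R n r i f))) =
      koszulRestrict R n r i (koszul A f) := by
  rw [← sub_eq_zero, ← map_sub, ← map_sub]
  have h : VanishAt i (koszulExtend R n r i (koszulRestrict R n r i f) - f) := by
    intro T α h
    exact sub_eq_zero.2 (dif_pos (mem_koszulIndex.2 h))
  funext t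
  exact h.koszul _ _ (mem_koszulIndex.1 t.2)

/-- The part of total degree `i` of the Koszul differential. -/
def koszulPart (A : Fin r → Fin n → R) (i : ℕ) :
    (koszulIndex n r i → R) →ₗ[R] (koszulIndex n r i → R) :=
  koszulRestrict R n r i ∘ₗ koszul A ∘ₗ koszulExtend R n r i

theorem koszulExtend_koszulPart (i : ℕ) (z : koszulIndex n r i → R) :
    koszulExtend R n r i (koszulPart A i z) = koszul A (koszulExtend R n r i z) :=
  koszulExtend_koszulRestrict fun _ hj => (vanishAt_koszulExtend hj z).koszul

theorem koszulPart_koszulPart (h2 : IsUnit (2 : R)) (i : ℕ) (z : koszulIndex n r i → R) :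
    koszulPart A i (koszulPart A i z) = 0 := by
  change koszulRestrict R n r i (koszul A (koszulExtend R n r i (koszulPart A i z))) = 0
  rw [koszulExtend_koszulPart, koszul_koszul h2, map_zero]

theorem pow_smul_mem_range_koszulPart (h2 : IsUnit (2 : R))
    (hA : ∀ a b, ∑ k, A a k * A b k = if a = b then q else 0) {i : ℕ} (hi : n < i + r)
    (z : koszulIndex n r i → R) (hz : koszulPart A i z = 0) :
    q ^ r • z ∈ LinearMap.range (koszulPart A i) := by
  have hz' : koszul A (koszulExtend R n r i z) = 0 := by
    rw [← koszulExtend_koszulPart, hz, map_zero]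
  obtain ⟨w, hw⟩ := pow_length_smul_mem_range h2 hA (List.finRange r) (List.nodup_finRange r) _ hz'
    (wedgeModList_finRange_eq_zero hi fun j hj => vanishAt_koszulExtend hj z)
  refine ⟨koszulRestrict R n r i w, ?_⟩
  rw [koszulPart, LinearMap.comp_apply, LinearMap.comp_apply, koszulRestrict_koszul, hw, map_smul,
    koszulRestrict_koszulExtend, List.length_finRange]

end Koszul

section Formula

open MvPolynomial

theorem isHomogeneous_koszulPart {F : Type*} [Field F] {s r n : ℕ}
    {A : Fin r → Fin n → MvPolynomial (Fin s) F} (hA : ∀ a k, (A a k).IsHomogeneous 1) {i k : ℕ}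
    {z : koszulIndex n r i → MvPolynomial (Fin s) F} (hz : ∀ t, (z t).IsHomogeneous k)
    (t : koszulIndex n r i) : (koszulPart A i z t).IsHomogeneous (k + 1) := by
  have hext : ∀ T α, (koszulExtend _ n r i z T α).IsHomogeneous k := by
    intro T α
    change (dite _ _ _ : MvPolynomial (Fin s) F).IsHomogeneous k
    split_ifs
    · exact hz _
    · exact isHomogeneous_zero _ _ _
  change (koszul A (koszulExtend _ n r i z) t.1.1 t.1.2).IsHomogeneous (k + 1)
  rw [koszul_apply_apply]
  refine IsHomogeneous.sum _ _ _ fun a _ => ?_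
  split_ifs
  · exact isHomogeneous_zero _ _ _
  refine IsHomogeneous.sum _ _ _ fun l _ => ?_
  rw [add_comm]
  refine (hA a l).mul ?_
  split_ifs
  · exact isHomogeneous_zero _ _ _
  · exact zsmul_mem (K := homogeneousSubmodule (Fin s) F k) (hext _ _) _

variable {F : Type*} [Field F] {r s n : ℕ}
  {φ : (Fin r → F) →ₗ[F] (Fin s → F) →ₗ[F] (Fin n → F)}

theorem polarize_right (h2 : (2 : F) ≠ 0) (hφ : ∀ (x : Fin r → F) (y : Fin s → F),
      (∑ i, x i ^ 2) * (∑ j, y j ^ 2) = ∑ k, φ x y k ^ 2) (x : Fin r → F) (y y' : Fin s → F) :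
    ∑ k, φ x y k * φ x y' k = (∑ i, x i ^ 2) * ∑ j, y j * y' j := by
  have h := hφ x (y + y')
  have h0 := hφ x y
  have h1 := hφ x y'
  simp only [map_add, Pi.add_apply, add_sq, Finset.sum_add_distrib, mul_assoc,
    ← Finset.mul_sum] at h
  apply mul_left_cancel₀ h2
  linear_combination h0 + h1 - h

theorem polarize (h2 : (2 : F) ≠ 0) (hφ : ∀ (x : Fin r → F) (y : Fin s → F),
      (∑ i, x i ^ 2) * (∑ j, y j ^ 2) = ∑ k, φ x y k ^ 2) (x x' : Fin r → F) (y y' : Fin s → F) :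
    ∑ k, φ x y k * φ x' y' k + ∑ k, φ x y' k * φ x' y k =
      2 * ((∑ i, x i * x' i) * ∑ j, y j * y' j) := by
  have h := polarize_right h2 hφ (x + x') y y'
  have h0 := polarize_right h2 hφ x y y'
  have h1 := polarize_right h2 hφ x' y y'
  simp only [map_add, LinearMap.add_apply, Pi.add_apply, add_sq, Finset.sum_add_distrib, mul_assoc,
    ← Finset.mul_sum, add_mul, mul_add] at h
  have e : ∑ k, φ x y' k * φ x' y k = ∑ k, φ x' y k * φ x y' k :=
    Finset.sum_congr rfl fun k _ => mul_comm _ _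
  rw [e]
  linear_combination h - h0 - h1

/-- The matrix of linear forms of a bilinear map. -/
noncomputable def formMatrix (φ : (Fin r → F) →ₗ[F] (Fin s → F) →ₗ[F] (Fin n → F)) (a : Fin r)
    (k : Fin n) : MvPolynomial (Fin s) F :=
  ∑ j, C (φ (Pi.single a 1) (Pi.single j 1) k) * X j

theorem isHomogeneous_formMatrix (a : Fin r) (k : Fin n) : (formMatrix φ a k).IsHomogeneous 1 :=
  IsHomogeneous.sum _ _ _ fun j _ => by
    simpa using (isHomogeneous_C (Fin s) _).mul (isHomogeneous_X F j)

theorem formMatrix_orthogonal (h2 : (2 : F) ≠ 0) (hφ : ∀ (x : Fin r → F) (y : Fin s → F),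
      (∑ i, x i ^ 2) * (∑ j, y j ^ 2) = ∑ k, φ x y k ^ 2) (a b : Fin r) :
    ∑ k, formMatrix φ a k * formMatrix φ b k =
      if a = b then ∑ i, (X i : MvPolynomial (Fin s) F) ^ 2 else 0 := by
  have h : (C 2 : MvPolynomial (Fin s) F) ≠ 0 := by
    rw [Ne, C_eq_zero]; exact h2
  apply mul_left_cancel₀ h
  have expand : ∑ k, formMatrix φ a k * formMatrix φ b k = ∑ i, ∑ j,
      C (∑ k, φ (Pi.single a 1) (Pi.single i 1) k * φ (Pi.single b 1) (Pi.single j 1) k) *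
        (X i * X j) := by
    simp only [formMatrix, map_sum, Finset.sum_mul, Finset.mul_sum, map_mul]
    conv_rhs => rw [Finset.sum_comm]
    rw [Finset.sum_comm]
    refine Finset.sum_congr rfl fun i _ => ?_
    rw [Finset.sum_comm]
    refine Finset.sum_congr rfl fun j _ => Finset.sum_congr rfl fun k _ => ?_
    ring
  have expand' := expand
  rw [Finset.sum_comm] at expand'
  have hC : (C 2 : MvPolynomial (Fin s) F) = 2 := map_ofNat C 2
  rw [hC, two_mul]
  nth_rewrite 1 [expand]
  rw [expand', ← Finset.sum_add_distrib]
  have term : ∀ i j : Fin s,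
      C (∑ k, φ (Pi.single a 1) (Pi.single i 1) k * φ (Pi.single b 1) (Pi.single j 1) k) *
          (X i * X j) +
        C (∑ k, φ (Pi.single a 1) (Pi.single j 1) k * φ (Pi.single b 1) (Pi.single i 1) k) *
          (X j * X i) =
      if i = j then (if a = b then 2 * (X i : MvPolynomial (Fin s) F) ^ 2 else 0) else 0 := by
    intro i j
    have hp := polarize h2 hφ (Pi.single a 1) (Pi.single b 1) (Pi.single i 1) (Pi.single j 1)
    rw [mul_comm (X j), ← add_mul, ← map_add, hp]
    have hs : ∀ {m : ℕ} (u v : Fin m),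
        ∑ l, (Pi.single u 1 : Fin m → F) l * (Pi.single v 1 : Fin m → F) l =
          if u = v then 1 else 0 := by
      intro m u v
      simp [Pi.single_apply, eq_comm]
    rw [hs, hs]
    rcases eq_or_ne i j with rfl | hij <;> rcases eq_or_ne a b with rfl | hab <;>
      simp [*, pow_two]
  simp_rw [← Finset.sum_add_distrib, term]
  simp only [Finset.sum_ite_eq, Finset.mem_univ, if_true]
  split_ifs
  · rw [Finset.mul_sum]
  · simp

theorem two_pow_dvd_sum_choose_mul_multichoose (h2 : (2 : F) ≠ 0)
    (hφ : ∀ (x : Fin r → F) (y : Fin s → F),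
      (∑ i, x i ^ 2) * (∑ j, y j ^ 2) = ∑ k, φ x y k ^ 2) {i : ℕ} (hi : n < i + r) :
    2 ^ ((s + 1) / 2) ∣
      ∑ p ∈ Finset.HasAntidiagonal.antidiagonal i, n.choose p.1 * r.multichoose p.2 := by
  have h2' : IsUnit (2 : MvPolynomial (Fin s) F) := by
    have := (IsUnit.mk0 _ h2).map (C : F →+* MvPolynomial (Fin s) F)
    rwa [map_ofNat] at this
  rw [← card_koszulIndex, ← Fintype.card_coe]
  exact two_pow_dvd_card h2 (koszulPart (formMatrix φ) i)
    (fun k v hv => isHomogeneous_koszulPart isHomogeneous_formMatrix hv)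
    (koszulPart_koszulPart h2' i) r
    (pow_smul_mem_range_koszulPart h2' (formMatrix_orthogonal h2 hφ) hi)

end Formula

section Binomial

open PowerSeries

theorem two_pow_mul_multichoose_eq_zero {S : Type*} [CommRing S] {N r : ℕ}
    (h : ∀ i, N < i → coeff i ((1 + X) ^ (N + r) * mk fun k => (r.multichoose k : S)) = 0)
    {i : ℕ} (hi : N < i) : (2 ^ i * r.multichoose i : S) = 0 := by
  set M : S⟦X⟧ := mk fun k => (r.multichoose k : S)
  have hM : (1 - X) ^ r * M = 1 := one_sub_X_pow_mul_mk_multichoose S r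
  set e : ℕ → S := fun j => coeff j ((1 + X) ^ (N + r) * M)
  set Q : Polynomial S := ∑ j ∈ Finset.range (N + 1), Polynomial.C (e j) * Polynomial.X ^ j with hQ
  have hQM : (Q : S⟦X⟧) = (1 + X) ^ (N + r) * M := by
    ext j
    simp only [hQ, Polynomial.coeff_coe, Polynomial.finsetSum_coeff, Polynomial.coeff_C_mul_X_pow,
      Finset.sum_ite_eq, Finset.mem_range]
    split_ifs with hj
    · rfl
    · exact (h j (by omega)).symm
  have hpoly : (1 + Polynomial.X) ^ (N + r) = Q * (1 - Polynomial.X) ^ r := by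
    apply Polynomial.coe_injective S
    push_cast
    rw [hQM]
    linear_combination (-(1 + X) ^ (N + r)) * hM
  obtain ⟨v, hv⟩ : ∃ v : S⟦X⟧, (1 - X) * v = 1 :=
    ⟨_, by simpa using one_sub_X_pow_mul_mk_multichoose S 1⟩
  have hsubst := congrArg (Polynomial.aeval (X * v)) hpoly
  have h1 : 1 + X * v = v := by linear_combination -hv
  have h2 : 1 - X * v = v * (1 - 2 * X) := by linear_combination -hv
  simp only [map_pow, map_add, map_sub, map_mul, map_one, Polynomial.aeval_X, h1, h2] at hsubst
  set P : Polynomial S :=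
    ∑ j ∈ Finset.range (N + 1),
      Polynomial.C (e j) * (Polynomial.X ^ j * (1 - Polynomial.X) ^ (N - j)) with hP
  have hPQ : (P : S⟦X⟧) = (1 - X) ^ N * Polynomial.aeval (X * v) Q := by
    rw [hP, hQ, ← Polynomial.coeToPowerSeries.ringHom_apply, map_sum, map_sum, Finset.mul_sum]
    refine Finset.sum_congr rfl fun j hj => ?_
    obtain ⟨l, rfl⟩ := Nat.exists_eq_add_of_le (Nat.lt_succ_iff.1 (Finset.mem_range.1 hj))
    have hvj : (1 - X) ^ j * v ^ j = 1 := by rw [← mul_pow, hv, one_pow]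
    simp only [Polynomial.coeToPowerSeries.ringHom_apply, Polynomial.coe_sub, Polynomial.coe_one,
      Polynomial.coe_X, Polynomial.coe_C, map_mul, map_pow,
      Polynomial.aeval_C, Polynomial.aeval_X, add_tsub_cancel_left, PowerSeries.algebraMap_apply,
      Algebra.algebraMap_self, RingHom.id_apply]
    linear_combination (-(C (e j)) * X ^ j * (1 - X) ^ l) * hvj
  have hinv : (P : S⟦X⟧) * (1 - 2 * X) ^ r = 1 := by
    have hv' : ∀ m, (1 - X) ^ m * v ^ m = 1 := fun m => by rw [← mul_pow, hv, one_pow]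
    have hN := hv' (N + r)
    rw [hsubst, mul_pow, pow_add] at hN
    rw [hPQ]
    linear_combination hN - (1 - X) ^ N * Polynomial.aeval (X * v) Q * (1 - 2 * X) ^ r * hv' r
  have hresc : (1 - 2 * X) ^ r * rescale (2 : S) M = 1 := by
    have := congrArg (rescale (2 : S)) hM
    simpa [rescale_X, map_ofNat C 2] using this
  have hPM : (P : S⟦X⟧) = rescale (2 : S) M := by
    linear_combination (-(P : S⟦X⟧)) * hresc + rescale (2 : S) M * hinv
  have hcoeff := congrArg (coeff i) hPM
  rw [coeff_rescale, coeff_mk, Polynomial.coeff_coe] at hcoeff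
  rw [← hcoeff]
  refine Polynomial.coeff_eq_zero_of_natDegree_lt (lt_of_le_of_lt ?_ hi)
  refine Polynomial.natDegree_sum_le_of_forall_le _ _ fun j hj => ?_
  rw [Finset.mem_range] at hj
  compute_degree!
  omega

theorem two_pow_dvd_multichoose {m n r : ℕ} (hm : m ≠ 0)
    (h : ∀ i, n < i + r → 2 ^ m ∣
      ∑ p ∈ Finset.HasAntidiagonal.antidiagonal i, n.choose p.1 * r.multichoose p.2)
    {i : ℕ} (hi : n < i + r) (him : i ≤ m) : 2 ^ (m - i) ∣ r.multichoose i := by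
  have hrn : r ≤ n := by
    by_contra! hlt
    have := h 0 (by simpa using hlt)
    simp [hm] at this
  obtain ⟨N, rfl⟩ := Nat.exists_eq_add_of_le' hrn
  have h0 : (2 ^ i * r.multichoose i : ZMod (2 ^ m)) = 0 := by
    refine two_pow_mul_multichoose_eq_zero (N := N) (fun j hj => ?_) (by omega)
    have hj := (CharP.cast_eq_zero_iff (ZMod (2 ^ m)) (2 ^ m) _).2 (h j (by omega))
    have hX : ((1 + X) ^ (N + r) : (ZMod (2 ^ m))⟦X⟧) =
        ((1 + Polynomial.X) ^ (N + r) : Polynomial (ZMod (2 ^ m))) := by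
      push_cast
      rfl
    rw [coeff_mul, ← hj, Nat.cast_sum]
    refine Finset.sum_congr rfl fun p _ => ?_
    rw [hX, Polynomial.coeff_coe, Polynomial.coeff_one_add_X_pow, coeff_mk, Nat.cast_mul]
  have hdvd : 2 ^ m ∣ 2 ^ i * r.multichoose i := by
    rw [← CharP.cast_eq_zero_iff (ZMod (2 ^ m))]
    push_cast
    exact h0
  rw [← Nat.sub_add_cancel him, pow_add, mul_comm] at hdvd
  exact Nat.dvd_of_mul_dvd_mul_left (by positivity) hdvd

end Binomial

theorem stmt_17 (F : Type*) [Field F] (hchar : ringChar F ≠ 2) (r s n : ℕ)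
    (φ : (Fin r → F) →ₗ[F] (Fin s → F) →ₗ[F] (Fin n → F))
    (hφ : ∀ (x : Fin r → F) (y : Fin s → F),
      (∑ i, x i ^ 2) * (∑ j, y j ^ 2) = ∑ k, φ x y k ^ 2) :
    ∀ i, n - r < i → i ≤ (s - 1) / 2 →
      2 ^ ((s - 1) / 2 - i + 1) ∣ (r + i - 1).choose i := by
  intro i hi his
  have h := two_pow_dvd_multichoose (m := (s + 1) / 2) (by omega)
    (fun _ => two_pow_dvd_sum_choose_mul_multichoose (Ring.two_ne_zero hchar) hφ)
    (show n < i + r by omega) (by omega)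
  rwa [Nat.multichoose_eq, show (s + 1) / 2 - i = (s - 1) / 2 - i + 1 by omega] at h
end

section
/- There is no sums-of-squares formula of type [13, 13, 16] over any field of characteristic different from 2; equivalently, the divisibility conditions of the main theorem fail for (r,s,n) = (13,13,16): with c = 6, the condition 2^(c-i+1) | C(16, i) fails for some i with 3 < i ≤ 6. -/
open Filter MvPolynomial Module

/-- Integer sequences that are eventually annihilated by a power of the forward difference. -/
def eventuallyPoly : AddSubgroup (ℕ → ℤ) where
  carrier := {a | ∃ K, ∀ᶠ j in atTop, (fwdDiff 1)^[K] a j = 0}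
  zero_mem' := ⟨0, by simp⟩
  neg_mem' := by
    rintro a ⟨K, hK⟩
    refine ⟨K, hK.mono fun j hj => ?_⟩
    have := congrFun (fwdDiff_iter_const_smul (1 : ℕ) (-1 : ℤ) a K) j
    simpa [hj] using this
  add_mem' := by
    have key : ∀ (a : ℕ → ℤ) (K m : ℕ), (∀ᶠ j in atTop, (fwdDiff 1)^[K] a j = 0) →
        ∀ᶠ j in atTop, (fwdDiff 1)^[K + m] a j = 0 := by
      intro a K m h
      induction m with
      | zero => exact h
      | succ m ih =>
        rw [← add_assoc, Function.iterate_succ_apply']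
        filter_upwards [ih, (tendsto_add_atTop_nat 1).eventually ih] with j h₁ h₂
        rw [fwdDiff, h₁, h₂, sub_zero]
    rintro a b ⟨K, hK⟩ ⟨L, hL⟩
    refine ⟨K + L, ?_⟩
    filter_upwards [key a K L hK, add_comm K L ▸ key b L K hL] with j h₁ h₂
    simp [h₁, h₂]

lemma eventuallyPoly_of_fwdDiff {a : ℕ → ℤ} (h : fwdDiff 1 a ∈ eventuallyPoly) :
    a ∈ eventuallyPoly := by
  obtain ⟨K, hK⟩ := h
  exact ⟨K + 1, by simpa only [Function.iterate_succ_apply] using hK⟩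

lemma shift_mem_eventuallyPoly {a : ℕ → ℤ} (h : a ∈ eventuallyPoly) (d : ℕ) :
    (fun j => a (j + d)) ∈ eventuallyPoly := by
  obtain ⟨K, hK⟩ := h
  refine ⟨K, ((tendsto_add_atTop_nat d).eventually hK).mono fun j hj => ?_⟩
  rw [fwdDiff_iter_comp_add]
  exact hj

/-- Sequences whose `c`-fold multiple is eventually of the form `z j + z (j + 1)`,
with `z` eventually polynomial. -/
def alternatingSums (c : ℤ) : AddSubgroup (ℕ → ℤ) where
  carrier := {a | ∃ z ∈ eventuallyPoly, ∀ᶠ j in atTop, c * a j = z j + z (j + 1)}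
  zero_mem' := ⟨0, zero_mem _, by simp⟩
  neg_mem' := by
    rintro a ⟨z, hz, h⟩
    refine ⟨-z, neg_mem hz, h.mono fun j hj => ?_⟩
    simp only [Pi.neg_apply]
    linarith
  add_mem' := by
    rintro a b ⟨z, hz, h⟩ ⟨w, hw, h'⟩
    refine ⟨z + w, add_mem hz hw, ?_⟩
    filter_upwards [h, h'] with j h₁ h₂
    simp only [Pi.add_apply]
    linarith

lemma shift_sub_mem_alternatingSums (c : ℤ) {a : ℕ → ℤ} (h : a ∈ eventuallyPoly) (d : ℕ) :
    (fun j => a (j + d)) - (-1) ^ d • a ∈ alternatingSums c := by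
  induction d with
  | zero => simp
  | succ d ih =>
    have h₁ : (fun j => a (j + d) + a (j + d + 1)) ∈ alternatingSums c :=
      ⟨c • (fun j => a (j + d)), zsmul_mem (shift_mem_eventuallyPoly h d) _,
        Eventually.of_forall fun j => by
          simp only [Pi.smul_apply, smul_eq_mul, add_right_comm j 1 d]; ring⟩
    convert sub_mem h₁ ih using 1
    ext j
    simp only [Pi.sub_apply, Pi.smul_apply, pow_succ, smul_eq_mul, add_assoc]
    ring

/-- The two-adic obstruction: with `n + 1` variables, the Hilbert function of the polynomial ring is
not an alternating sum up to a factor exactly divisible by `2 ^ n`. -/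
lemma smul_choose_notMem_alternatingSums (n : ℕ) {c m : ℤ} (u : ℤ) (hu : Odd u)
    (hc : c * m = 2 ^ n * u) :
    (m • fun j : ℕ => ((j + n).choose n : ℤ)) ∉ alternatingSums c := by
  rintro ⟨z, ⟨K, hK⟩, h⟩
  have hh : ∀ k ≤ n, ∀ j, (fwdDiff 1)^[k] (fun j : ℕ => ((j + n).choose n : ℤ)) j
      = ((j + n).choose (n - k) : ℤ) := by
    intro k hk j
    have := congrFun (fwdDiff_iter_choose (n - k) k) (j + n)
    rw [Nat.add_sub_cancel' hk] at this
    rw [← this, ← fwdDiff_iter_comp_add]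
  have hh' : ∀ k > n, ∀ j, (fwdDiff 1)^[k] (fun j : ℕ => ((j + n).choose n : ℤ)) j = 0 := by
    intro k hk
    induction k, hk using Nat.le_induction with
    | base =>
      intro j
      rw [Nat.succ_eq_add_one, Function.iterate_succ_apply', fwdDiff, hh n le_rfl, hh n le_rfl]
      simp
    | succ k hk ih =>
      intro j
      rw [Function.iterate_succ_apply', fwdDiff, ih, ih, sub_zero]
  have hrec : ∀ k, ∀ᶠ j in atTop, 2 * (fwdDiff 1)^[k] z j + (fwdDiff 1)^[k + 1] z j
      = 2 ^ n * u * (fwdDiff 1)^[k] (fun j : ℕ => ((j + n).choose n : ℤ)) j := by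
    intro k
    induction k with
    | zero =>
      filter_upwards [h] with j hj
      simp only [Pi.smul_apply, smul_eq_mul, ← mul_assoc, hc] at hj
      simp only [Function.iterate_zero, id, Function.iterate_succ, Function.comp_apply, fwdDiff]
      linarith
    | succ k ih =>
      filter_upwards [ih, (tendsto_add_atTop_nat 1).eventually ih] with j h₁ h₂
      rw [Function.iterate_succ_apply'] at h₁ h₂
      rw [Function.iterate_succ_apply' _ (k + 1), Function.iterate_succ_apply' _ k,
        Function.iterate_succ_apply' _ k]
      simp only [fwdDiff] at h₁ h₂ ⊢
      linarith
  have hzero : ∀ᶠ j in atTop, (fwdDiff 1)^[n + 1] z j = 0 := by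
    suffices ∀ m, ∀ k, n + 1 ≤ k → (∀ᶠ j in atTop, (fwdDiff 1)^[k + m] z j = 0) →
        ∀ᶠ j in atTop, (fwdDiff 1)^[k] z j = 0 by
      refine this K _ le_rfl ?_
      have := eventually_atTop.mp hK
      obtain ⟨J, hJ⟩ := this
      refine eventually_atTop.mpr ⟨J, fun j hj => ?_⟩
      rw [Function.iterate_add_apply, fwdDiff_iter_eq_sum_shift]
      exact Finset.sum_eq_zero fun i _ => by rw [hJ _ (by simp; omega), smul_zero]
    intro m
    induction m with
    | zero => exact fun k _ h => h
    | succ m ih =>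
      intro k hk h0
      have h1 := ih (k + 1) (by omega) (by rwa [add_right_comm, add_assoc])
      filter_upwards [h1, hrec k] with j h₁ h₂
      rw [h₁, hh' k (by omega)] at h₂
      linarith
  have hodd : ∀ i ≤ n, ∀ᶠ j in atTop, ∃ v,
      Odd v ∧ 2 * (fwdDiff 1)^[n - i] z j = 2 ^ (n - i) * v := by
    intro i
    induction i with
    | zero =>
      intro _
      filter_upwards [hzero, hrec n] with j h₁ h₂
      refine ⟨u, hu, ?_⟩
      rw [h₁, hh n le_rfl] at h₂
      simpa using h₂
    | succ i ih =>
      intro hi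
      filter_upwards [ih (by omega), hrec (n - (i + 1))] with j h₁ h₂
      obtain ⟨v, hv, hv'⟩ := h₁
      obtain ⟨k, hk⟩ : ∃ k, n = k + (i + 1) := ⟨n - (i + 1), by omega⟩
      have e1 : n - (i + 1) = k := by omega
      have e2 : n - i = k + 1 := by omega
      rw [e1] at h₂ ⊢
      rw [e2] at hv'
      rw [hh k (by omega)] at h₂
      refine ⟨2 * (2 ^ i * u * ((j + n).choose (n - k) : ℤ)) - v, (even_two_mul _).sub_odd hv, ?_⟩
      have e3 : (2 : ℤ) ^ n = 2 ^ k * (2 * 2 ^ i) := by rw [hk]; ring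
      rw [e3] at h₂
      rw [pow_succ] at hv'
      have hv'' : (fwdDiff 1)^[k + 1] z j = 2 ^ k * v := by linarith
      linear_combination h₂ - hv''
  obtain ⟨j, v, hv, hv'⟩ := (hodd n le_rfl).exists
  simp only [Nat.sub_self, pow_zero, one_mul] at hv'
  exact (Int.not_even_iff_odd.mpr hv) (hv' ▸ even_two_mul _)

section Graded

variable {K : Type*} [Field K] {σ ι κ : Type*}

/-- The componentwise homogeneous part of degree `j` of a vector of polynomials. -/
noncomputable def vecComponent (j : ℕ) : (ι → MvPolynomial σ K) →ₗ[K] (ι → MvPolynomial σ K) :=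
  LinearMap.pi fun i => homogeneousComponent j ∘ₗ LinearMap.proj i

@[simp]
lemma vecComponent_apply (j : ℕ) (g : ι → MvPolynomial σ K) (i : ι) :
    vecComponent j g i = homogeneousComponent j (g i) := rfl

/-- Vectors of polynomials all of whose entries are homogeneous of degree `j`. -/
noncomputable def degreePart (K σ ι : Type*) [Field K] (j : ℕ) :
    Submodule K (ι → MvPolynomial σ K) :=
  Submodule.pi Set.univ fun _ => homogeneousSubmodule σ K j

lemma mem_degreePart {j : ℕ} {g : ι → MvPolynomial σ K} :
    g ∈ degreePart K σ ι j ↔ ∀ i, (g i).IsHomogeneous j := by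
  simp [degreePart]

lemma vecComponent_mem (j : ℕ) (g : ι → MvPolynomial σ K) :
    vecComponent j g ∈ degreePart K σ ι j :=
  mem_degreePart.mpr fun i => homogeneousComponent_isHomogeneous j (g i)

lemma vecComponent_of_mem {j k : ℕ} {g : ι → MvPolynomial σ K} (hg : g ∈ degreePart K σ ι k) :
    vecComponent j g = if k = j then g else 0 := by
  ext1 i
  rw [vecComponent_apply, homogeneousComponent_of_mem (mem_degreePart.mp hg i)]
  by_cases h : k = j
  · rw [if_pos h.symm, if_pos h]
  · rw [if_neg (Ne.symm h), if_neg h, Pi.zero_apply]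

lemma vecComponent_self {j : ℕ} {g : ι → MvPolynomial σ K} (hg : g ∈ degreePart K σ ι j) :
    vecComponent j g = g := by
  simp [vecComponent_of_mem hg]

lemma exists_sum_vecComponent [Finite ι] (g : ι → MvPolynomial σ K) :
    ∃ N, g = ∑ j ∈ Finset.range N, vecComponent j g := by
  cases nonempty_fintype ι
  refine ⟨Finset.univ.sup (fun i => (g i).totalDegree) + 1, funext fun i => ?_⟩
  rw [Finset.sum_apply]
  conv_lhs => rw [← sum_homogeneousComponent (g i)]
  simp only [vecComponent_apply]
  refine Finset.sum_subset ?_ ?_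
  · intro x hx
    simp only [Finset.mem_range] at hx ⊢
    exact hx.trans_le (Nat.succ_le_succ (Finset.le_sup (f := fun i => (g i).totalDegree)
      (Finset.mem_univ i)))
  · intro x _ hx
    exact homogeneousComponent_eq_zero _ _ (by simpa using hx)

/-- A linear map raising degrees by `d`. -/
def RaisesDegree (T : (ι → MvPolynomial σ K) →ₗ[MvPolynomial σ K] (κ → MvPolynomial σ K)) (d : ℕ) :
    Prop :=
  ∀ j, ∀ g ∈ degreePart K σ ι j, T g ∈ degreePart K σ κ (j + d)

/-- Graded submodules of a free module. -/
def IsGradedSub (B : Submodule (MvPolynomial σ K) (ι → MvPolynomial σ K)) : Prop :=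
  ∀ g ∈ B, ∀ j, vecComponent j g ∈ B

/-- The degree `j` part of a submodule of a free module. -/
noncomputable def Submodule.degPart (B : Submodule (MvPolynomial σ K) (ι → MvPolynomial σ K))
    (j : ℕ) : Submodule K (ι → MvPolynomial σ K) :=
  B.restrictScalars K ⊓ degreePart K σ ι j

/-- The Hilbert function of a submodule of a free module. -/
noncomputable def hilb (B : Submodule (MvPolynomial σ K) (ι → MvPolynomial σ K)) (j : ℕ) : ℤ :=
  finrank K (B.degPart j)

instance [Finite σ] [Finite ι] (j : ℕ) : FiniteDimensional K (degreePart K σ ι j) := by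
  have := Module.Finite.iff_fg.mpr (homogeneousSubmodule_fg (σ := σ) K j)
  refine Module.Finite.of_injective
    (LinearMap.pi (fun i => ((LinearMap.proj i).comp (degreePart K σ ι j).subtype).codRestrict
      (homogeneousSubmodule σ K j) fun g => mem_degreePart.mp g.2 i)) fun g h hgh => ?_
  ext1
  funext i
  exact congrArg Subtype.val (congrFun hgh i)

instance [Finite σ] [Finite ι] (B : Submodule (MvPolynomial σ K) (ι → MvPolynomial σ K)) (j : ℕ) :
    FiniteDimensional K (B.degPart j) :=
  Submodule.finiteDimensional_of_le (inf_le_right : B.degPart j ≤ degreePart K σ ι j)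

section Maps

variable [Finite ι] {T : (ι → MvPolynomial σ K) →ₗ[MvPolynomial σ K] (κ → MvPolynomial σ K)} {d : ℕ}

lemma RaisesDegree.vecComponent_add (hT : RaisesDegree T d) (g : ι → MvPolynomial σ K) (j : ℕ) :
    vecComponent (j + d) (T g) = T (vecComponent j g) := by
  obtain ⟨N, hN⟩ := exists_sum_vecComponent g
  have h : ∀ k, vecComponent (j + d) (T (vecComponent k g))
      = T (vecComponent j (vecComponent k g)) := by
    intro k
    rw [vecComponent_of_mem (hT k _ (vecComponent_mem k g)),
      vecComponent_of_mem (vecComponent_mem k g)]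
    simp only [add_left_inj]
    split_ifs <;> simp
  conv_lhs => rw [hN]
  conv_rhs => rw [hN]
  simp only [map_sum, h]

lemma RaisesDegree.vecComponent_of_lt (hT : RaisesDegree T d) (g : ι → MvPolynomial σ K) {j : ℕ}
    (hj : j < d) : vecComponent j (T g) = 0 := by
  obtain ⟨N, hN⟩ := exists_sum_vecComponent g
  rw [hN, map_sum, map_sum]
  refine Finset.sum_eq_zero fun k _ => ?_
  rw [vecComponent_of_mem (hT k _ (vecComponent_mem k g)), if_neg (by omega)]

lemma RaisesDegree.isGradedSub_map (hT : RaisesDegree T d)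
    {B : Submodule (MvPolynomial σ K) (ι → MvPolynomial σ K)} (hB : IsGradedSub B) :
    IsGradedSub (B.map T) := by
  rintro _ ⟨g, hg, rfl⟩ j
  rcases lt_or_ge j d with h | h
  · rw [hT.vecComponent_of_lt g h]
    exact zero_mem _
  · obtain ⟨k, rfl⟩ := Nat.exists_eq_add_of_le' h
    rw [hT.vecComponent_add]
    exact ⟨_, hB g hg k, rfl⟩

lemma RaisesDegree.isGradedSub_comap (hT : RaisesDegree T d)
    {A : Submodule (MvPolynomial σ K) (κ → MvPolynomial σ K)} (hA : IsGradedSub A) :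
    IsGradedSub (A.comap T) := by
  intro g hg j
  rw [Submodule.mem_comap, ← hT.vecComponent_add]
  exact hA _ hg _

end Maps

lemma isGradedSub_top : IsGradedSub (⊤ : Submodule (MvPolynomial σ K) (ι → MvPolynomial σ K)) :=
  fun _ _ _ => trivial

lemma isGradedSub_bot : IsGradedSub (⊥ : Submodule (MvPolynomial σ K) (ι → MvPolynomial σ K)) := by
  rintro g (rfl : g = 0) j
  simp

lemma IsGradedSub.inf {A B : Submodule (MvPolynomial σ K) (ι → MvPolynomial σ K)}
    (hA : IsGradedSub A) (hB : IsGradedSub B) : IsGradedSub (A ⊓ B) :=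
  fun g hg j => ⟨hA g hg.1 j, hB g hg.2 j⟩

lemma IsGradedSub.sup {A B : Submodule (MvPolynomial σ K) (ι → MvPolynomial σ K)}
    (hA : IsGradedSub A) (hB : IsGradedSub B) : IsGradedSub (A ⊔ B) := by
  intro g hg j
  obtain ⟨a, ha, b, hb, rfl⟩ := Submodule.mem_sup.mp hg
  rw [map_add]
  exact add_mem (Submodule.mem_sup_left (hA a ha j)) (Submodule.mem_sup_right (hB b hb j))

lemma finrank_add_finrank_eq_of_comap {V W : Type*} [AddCommGroup V] [Module K V] [AddCommGroup W]
    [Module K W] (T : V →ₗ[K] W) (B : Submodule K V) (A : Submodule K W)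
    [FiniteDimensional K B] [FiniteDimensional K A] :
    finrank K B + finrank K A
      = finrank K (B ⊓ A.comap T : Submodule K V) + finrank K (B.map T ⊔ A : Submodule K W) := by
  have h₁ := Submodule.finrank_sup_add_finrank_inf_eq (B.map T) A
  have h₂ := LinearMap.finrank_range_add_finrank_ker (T.domRestrict B)
  have h₃ := LinearMap.finrank_range_add_finrank_ker (T.domRestrict (B ⊓ A.comap T))
  rw [LinearMap.range_domRestrict] at h₂ h₃
  have e₁ : (B ⊓ A.comap T).map T = B.map T ⊓ A := by
    ext w
    constructor
    · rintro ⟨v, ⟨hv, hv'⟩, rfl⟩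
      exact ⟨⟨v, hv, rfl⟩, hv'⟩
    · rintro ⟨⟨v, hv, rfl⟩, hv'⟩
      exact ⟨v, ⟨hv, hv'⟩, rfl⟩
  have e₂ : finrank K (LinearMap.ker (T.domRestrict (B ⊓ A.comap T)))
      = finrank K (LinearMap.ker (T.domRestrict B)) := by
    rw [LinearMap.ker_domRestrict, LinearMap.ker_domRestrict, ← Submodule.finrank_map_subtype_eq,
      ← Submodule.finrank_map_subtype_eq, Submodule.map_comap_subtype, Submodule.map_comap_subtype,
      inf_assoc, inf_eq_right.mpr (LinearMap.ker_le_comap T)]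
  rw [e₁] at h₃
  omega

lemma RaisesDegree.hilb_add_hilb [Finite σ] [Finite ι] [Finite κ]
    {T : (ι → MvPolynomial σ K) →ₗ[MvPolynomial σ K] (κ → MvPolynomial σ K)} {d : ℕ}
    (hT : RaisesDegree T d)
    {B : Submodule (MvPolynomial σ K) (ι → MvPolynomial σ K)} (hB : IsGradedSub B)
    {A : Submodule (MvPolynomial σ K) (κ → MvPolynomial σ K)} (hA : IsGradedSub A) (j : ℕ) :
    hilb B j + hilb A (j + d) = hilb (B ⊓ A.comap T) j + hilb (B.map T ⊔ A) (j + d) := by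
  have h := finrank_add_finrank_eq_of_comap (T.restrictScalars K) (B.degPart j) (A.degPart (j + d))
  have e₁ : B.degPart j ⊓ (A.degPart (j + d)).comap (T.restrictScalars K)
      = (B ⊓ A.comap T).degPart j := by
    ext g
    exact ⟨fun h => ⟨⟨h.1.1, h.2.1⟩, h.1.2⟩, fun h => ⟨⟨h.1.1, h.2⟩, h.1.2, hT j g h.2⟩⟩
  have e₂ : (B.degPart j).map (T.restrictScalars K) ⊔ A.degPart (j + d)
      = (B.map T ⊔ A).degPart (j + d) := by
    apply le_antisymm
    · refine sup_le ?_ fun a ha => ⟨Submodule.mem_sup_right ha.1, ha.2⟩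
      rintro _ ⟨g, hg, rfl⟩
      exact ⟨Submodule.mem_sup_left ⟨g, hg.1, rfl⟩, hT j g hg.2⟩
    · rintro w ⟨hw, hw'⟩
      obtain ⟨_, ⟨g, hg, rfl⟩, a, ha, rfl⟩ := Submodule.mem_sup.mp hw
      rw [← vecComponent_self hw', map_add, hT.vecComponent_add]
      exact Submodule.add_mem_sup ⟨_, ⟨hB g hg j, vecComponent_mem j g⟩, rfl⟩
        ⟨hA a ha _, vecComponent_mem _ a⟩
  rw [e₁, e₂] at h
  simp only [hilb]
  exact_mod_cast h

lemma hilb_bot (j : ℕ) :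
    hilb (⊥ : Submodule (MvPolynomial σ K) (ι → MvPolynomial σ K)) j = 0 := by
  have : (⊥ : Submodule (MvPolynomial σ K) (ι → MvPolynomial σ K)).degPart j = ⊥ :=
    eq_bot_iff.mpr fun g hg => hg.1
  rw [hilb, this, finrank_bot, Nat.cast_zero]

lemma raisesDegree_lsmul {p : MvPolynomial σ K} {d : ℕ} (hp : p.IsHomogeneous d) :
    RaisesDegree (LinearMap.lsmul (MvPolynomial σ K) (ι → MvPolynomial σ K) p) d := by
  intro j g hg
  rw [mem_degreePart] at hg ⊢
  intro i
  rw [add_comm]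
  exact hp.mul (hg i)

lemma vecComponent_X_smul [Finite ι] (i : σ) (g : ι → MvPolynomial σ K) (j : ℕ) :
    vecComponent (j + 1) ((X i : MvPolynomial σ K) • g)
      = (X i : MvPolynomial σ K) • vecComponent j g :=
  (raisesDegree_lsmul (isHomogeneous_X K i)).vecComponent_add g j

/-- In large degrees a graded submodule is generated by the preceding degree. -/
lemma IsGradedSub.exists_forall_degPart_succ_le [Finite σ] [Finite ι]
    {B : Submodule (MvPolynomial σ K) (ι → MvPolynomial σ K)} (hB : IsGradedSub B) :
    ∃ J, ∀ j ≥ J, ∀ V : Submodule K (ι → MvPolynomial σ K),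
      (∀ i, ∀ g ∈ B.degPart j, (X i : MvPolynomial σ K) • g ∈ V) → B.degPart (j + 1) ≤ V := by
  obtain ⟨s, hs⟩ := (IsNoetherian.noetherian B : B.FG)
  have hJ : ∃ J, ∀ g ∈ s, ∀ j ≥ J, vecComponent j g = 0 := by
    have : ∀ g : ι → MvPolynomial σ K, ∃ J, ∀ j ≥ J, vecComponent j g = 0 := by
      intro g
      obtain ⟨N, hN⟩ := exists_sum_vecComponent g
      refine ⟨N, fun j hj => ?_⟩
      rw [hN, map_sum]
      refine Finset.sum_eq_zero fun k hk => ?_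
      rw [vecComponent_of_mem (vecComponent_mem k g), if_neg]
      have := Finset.mem_range.mp hk
      omega
    choose f hf using this
    exact ⟨s.sup f, fun g hg j hj => hf g j ((Finset.le_sup hg).trans hj)⟩
  obtain ⟨J, hJ⟩ := hJ
  refine ⟨J, fun j hj V hV g hg => ?_⟩
  rw [← vecComponent_self hg.2]
  have hg' : g ∈ Submodule.span (MvPolynomial σ K) (s : Set (ι → MvPolynomial σ K)) := hs ▸ hg.1
  clear hg
  induction hg' using Submodule.span_induction with
  | mem x hx =>
    rw [hJ x hx (j + 1) (by omega)]
    exact zero_mem _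
  | zero => simp
  | add x y _ _ hx hy =>
    rw [map_add]
    exact add_mem hx hy
  | smul r x hx ih =>
    rw [hs] at hx
    induction r using MvPolynomial.induction_on with
    | C c =>
      have : (C c : MvPolynomial σ K) • x = c • x := algebraMap_smul _ c x
      rw [this, map_smul]
      exact V.smul_mem c ih
    | add p q hp hq =>
      rw [add_smul, map_add]
      exact add_mem hp hq
    | mul_X p i _ =>
      rw [mul_comm, mul_smul, vecComponent_X_smul]
      exact hV i _ ⟨hB _ (B.smul_mem p hx) j, vecComponent_mem _ _⟩

/-- Hilbert–Serre for subquotients of a free module annihilated by all variables outside `s`. -/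
lemma hilb_sub_mem_eventuallyPoly [Finite σ] [Finite ι] (s : Finset σ)
    {A B : Submodule (MvPolynomial σ K) (ι → MvPolynomial σ K)} (hA : IsGradedSub A)
    (hB : IsGradedSub B) (hAB : A ≤ B) (hs : ∀ i ∉ s, ∀ g ∈ B, (X i : MvPolynomial σ K) • g ∈ A) :
    hilb B - hilb A ∈ eventuallyPoly := by
  classical
  induction s using Finset.induction_on generalizing A B with
  | empty =>
    obtain ⟨J, hJ⟩ := hB.exists_forall_degPart_succ_le
    have : ∀ j ≥ J, B.degPart (j + 1) = A.degPart (j + 1) := fun j hj =>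
      le_antisymm (hJ j hj _ fun i g hg => ⟨hs i (by simp) g hg.1,
        raisesDegree_lsmul (isHomogeneous_X K i) j g hg.2⟩) (inf_le_inf_right _ hAB)
    refine ⟨0, eventually_atTop.mpr ⟨J + 1, fun j hj => ?_⟩⟩
    obtain ⟨k, rfl⟩ := Nat.exists_eq_add_of_le' (show 1 ≤ j by omega)
    simp only [Function.iterate_zero, id, Pi.sub_apply, hilb]
    rw [this k (by omega), sub_self]
  | insert i s hi ih =>
    have hT := raisesDegree_lsmul (ι := ι) (isHomogeneous_X K i)
    set T := LinearMap.lsmul (MvPolynomial σ K) (ι → MvPolynomial σ K) (X i) with hTdef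
    have hTB : B.map T ≤ B := by
      rintro _ ⟨g, hg, rfl⟩
      exact B.smul_mem _ hg
    have hTA : A ≤ A.comap T := fun g hg => A.smul_mem _ hg
    have h₁ : hilb B - hilb (B.map T ⊔ A) ∈ eventuallyPoly := by
      refine ih ((hT.isGradedSub_map hB).sup hA) hB (sup_le hTB hAB) fun k hk g hg => ?_
      by_cases hki : k = i
      · subst hki
        exact Submodule.mem_sup_left ⟨g, hg, rfl⟩
      · exact Submodule.mem_sup_right (hs k (by simp [hki, hk]) g hg)
    have h₂ : hilb (B ⊓ A.comap T) - hilb A ∈ eventuallyPoly := by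
      refine ih hA (hB.inf (hT.isGradedSub_comap hA)) (le_inf hAB hTA) fun k hk g hg => ?_
      by_cases hki : k = i
      · subst hki
        exact hg.2
      · exact hs k (by simp [hki, hk]) g hg.1
    refine eventuallyPoly_of_fwdDiff ?_
    convert sub_mem (shift_mem_eventuallyPoly h₁ 1) h₂ using 1
    ext j
    have := hT.hilb_add_hilb hB hA j
    simp only [fwdDiff, Pi.sub_apply]
    linarith

lemma IsGradedSub.hilb_mem_eventuallyPoly [Finite σ] [Finite ι]
    {B : Submodule (MvPolynomial σ K) (ι → MvPolynomial σ K)} (hB : IsGradedSub B) :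
    hilb B ∈ eventuallyPoly := by
  cases nonempty_fintype σ
  have := hilb_sub_mem_eventuallyPoly Finset.univ isGradedSub_bot hB bot_le (by simp)
  convert this using 1
  ext j
  simp [hilb_bot]

end Graded

section Clifford

variable {K : Type*} [Field K] {σ ι κ n : Type*}

/-- The submodule of families of elements of `B` indexed by `n`. -/
noncomputable def copies (n : Type*) (B : Submodule (MvPolynomial σ K) (ι → MvPolynomial σ K)) :
    Submodule (MvPolynomial σ K) (n × ι → MvPolynomial σ K) :=
  ⨅ s, B.comap (LinearMap.funLeft _ _ fun i => (s, i))

lemma mem_copies {B : Submodule (MvPolynomial σ K) (ι → MvPolynomial σ K)}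
    {g : n × ι → MvPolynomial σ K} : g ∈ copies n B ↔ ∀ s, (fun i => g (s, i)) ∈ B := by
  simp only [copies, Submodule.mem_iInf, Submodule.mem_comap]
  rfl

lemma IsGradedSub.copies {B : Submodule (MvPolynomial σ K) (ι → MvPolynomial σ K)}
    (hB : IsGradedSub B) : IsGradedSub (copies n B) := by
  intro g hg j
  rw [mem_copies] at hg ⊢
  exact fun s => hB _ (hg s) j

lemma hilb_copies [Fintype n] [Finite σ] [Finite ι]
    (B : Submodule (MvPolynomial σ K) (ι → MvPolynomial σ K)) (j : ℕ) :
    hilb (copies n B) j = Fintype.card n * hilb B j := by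
  let e : (copies n B).degPart j ≃ₗ[K] (n → B.degPart j) :=
    { toFun := fun g s => ⟨fun i => g.1 (s, i), mem_copies.mp g.2.1 s,
        mem_degreePart.mpr fun i => mem_degreePart.mp g.2.2 (s, i)⟩
      map_add' := fun _ _ => rfl
      map_smul' := fun _ _ => rfl
      invFun := fun h => ⟨fun p => (h p.1).1 p.2, mem_copies.mpr fun s => (h s).2.1,
        mem_degreePart.mpr fun p => mem_degreePart.mp (h p.1).2.2 p.2⟩
      left_inv := fun _ => rfl
      right_inv := fun _ => rfl }
  rw [hilb, e.finrank_eq, Module.finrank_pi_fintype]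
  simp [hilb]

variable [Fintype n]

/-- A scalar matrix acting on families of vectors of polynomials. -/
noncomputable def matAct (M : Matrix n n K) :
    (n × ι → MvPolynomial σ K) →ₗ[MvPolynomial σ K] (n × ι → MvPolynomial σ K) :=
  LinearMap.pi fun p => ∑ t, (C (M p.1 t) : MvPolynomial σ K) •
    (LinearMap.proj (t, p.2) : (n × ι → MvPolynomial σ K) →ₗ[MvPolynomial σ K] _)

lemma matAct_apply (M : Matrix n n K) (g : n × ι → MvPolynomial σ K) (s : n) (i : ι) :
    matAct M g (s, i) = ∑ t, C (M s t) * g (t, i) := by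
  simp [matAct]

lemma matAct_matAct (M N : Matrix n n K) (g : n × ι → MvPolynomial σ K) :
    matAct M (matAct N g) = matAct (M * N) g := by
  ext1 ⟨s, i⟩
  simp only [matAct_apply, Matrix.mul_apply, map_sum, map_mul, Finset.mul_sum, Finset.sum_mul,
    mul_assoc]
  rw [Finset.sum_comm]

lemma matAct_add (M N : Matrix n n K) (g : n × ι → MvPolynomial σ K) :
    matAct M g + matAct N g = matAct (M + N) g := by
  ext1 ⟨s, i⟩
  simp [matAct_apply, add_mul, Finset.sum_add_distrib]

lemma matAct_scalar [DecidableEq n] (c : K) (g : n × ι → MvPolynomial σ K) :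
    matAct (Matrix.scalar n c) g = (C c : MvPolynomial σ K) • g := by
  ext1 ⟨s, i⟩
  rw [matAct_apply, Finset.sum_eq_single s] <;>
    simp +contextual [Matrix.scalar_apply, eq_comm]

lemma matAct_mem_copies (M : Matrix n n K)
    {B : Submodule (MvPolynomial σ K) (ι → MvPolynomial σ K)} {g : n × ι → MvPolynomial σ K}
    (hg : g ∈ copies n B) : matAct M g ∈ copies n B := by
  rw [mem_copies] at hg ⊢
  intro s
  have : (fun i => matAct M g (s, i))
      = ∑ t, (C (M s t) : MvPolynomial σ K) • fun i => g (t, i) := by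
    ext1 i
    simp [matAct_apply]
  rw [this]
  exact sum_mem fun t _ => B.smul_mem _ (hg t)

variable [Fintype σ]

/-- Clifford multiplication by the generic vector. -/
noncomputable def cliffordMul (c : σ → Matrix n n K) :
    (n × ι → MvPolynomial σ K) →ₗ[MvPolynomial σ K] (n × ι → MvPolynomial σ K) :=
  ∑ w, (X w : MvPolynomial σ K) • matAct (c w)

lemma cliffordMul_apply (c : σ → Matrix n n K) (g : n × ι → MvPolynomial σ K) :
    cliffordMul c g = ∑ w, (X w : MvPolynomial σ K) • matAct (c w) g := by
  simp [cliffordMul]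

lemma raisesDegree_cliffordMul (c : σ → Matrix n n K) :
    RaisesDegree (cliffordMul c : (n × ι → MvPolynomial σ K) →ₗ[MvPolynomial σ K] _) 1 := by
  intro j g hg
  rw [cliffordMul_apply]
  refine sum_mem fun w _ => raisesDegree_lsmul (isHomogeneous_X K w) j _ ?_
  rw [mem_degreePart] at hg ⊢
  rintro ⟨s, i⟩
  rw [matAct_apply]
  exact IsHomogeneous.sum _ _ _ fun t _ => (hg _).C_mul _

lemma cliffordMul_mem_copies (c : σ → Matrix n n K)
    {B : Submodule (MvPolynomial σ K) (ι → MvPolynomial σ K)} {g : n × ι → MvPolynomial σ K}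
    (hg : g ∈ copies n B) : cliffordMul c g ∈ copies n B := by
  rw [cliffordMul_apply]
  exact sum_mem fun w _ => Submodule.smul_mem _ _ (matAct_mem_copies _ hg)

variable [DecidableEq n] [DecidableEq σ]

lemma matAct_cliffordMul_add {c : σ → Matrix n n K}
    (hc : ∀ i k, c i * c k + c k * c i = Matrix.scalar n (if i = k then 2 else 0)) (v : σ)
    (g : n × ι → MvPolynomial σ K) :
    matAct (c v) (cliffordMul c g) + cliffordMul c (matAct (c v) g)
      = (2 * X v : MvPolynomial σ K) • g := by
  simp only [cliffordMul_apply, map_sum, map_smul, matAct_matAct]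
  rw [← Finset.sum_add_distrib]
  simp only [← smul_add, matAct_add, hc, matAct_scalar]
  rw [Finset.sum_eq_single v]
  · rw [if_pos rfl, smul_smul, map_ofNat C 2, mul_comm]
  · intro w _ hw
    simp [hw.symm]
  · simp

lemma cliffordMul_cliffordMul (h2 : (2 : K) ≠ 0) {c : σ → Matrix n n K}
    (hc : ∀ i k, c i * c k + c k * c i = Matrix.scalar n (if i = k then 2 else 0))
    (g : n × ι → MvPolynomial σ K) :
    cliffordMul c (cliffordMul c g) = (∑ v, X v ^ 2 : MvPolynomial σ K) • g := by
  have h : (2 : MvPolynomial σ K) • cliffordMul c (cliffordMul c g)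
      = (2 : MvPolynomial σ K) • (∑ v, X v ^ 2 : MvPolynomial σ K) • g := by
    have e₁ : cliffordMul c (cliffordMul c g)
        = ∑ v, (X v : MvPolynomial σ K) • matAct (c v) (cliffordMul c g) := cliffordMul_apply _ _
    have e₂ : cliffordMul c (cliffordMul c g)
        = ∑ v, (X v : MvPolynomial σ K) • cliffordMul c (matAct (c v) g) := by
      conv_lhs => rw [cliffordMul_apply c g, map_sum]
      simp only [map_smul]
    rw [two_smul]
    conv_lhs => rw [e₁]; arg 2; rw [← e₁, e₂]
    rw [← Finset.sum_add_distrib, Finset.sum_smul, Finset.smul_sum]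
    refine Finset.sum_congr rfl fun v _ => ?_
    rw [← smul_add, matAct_cliffordMul_add hc, smul_smul, smul_smul]
    congr 1
    ring
  have h2' : (2 : MvPolynomial σ K) ≠ 0 := by
    rw [← map_ofNat C 2]
    exact (map_ne_zero_iff _ (C_injective σ K)).mpr h2
  exact smul_right_injective _ h2' h

lemma hilb_sub_mem_alternatingSums_of_smul_mem [Finite ι] (h2 : (2 : K) ≠ 0)
    {c : σ → Matrix n n K}
    (hc : ∀ i k, c i * c k + c k * c i = Matrix.scalar n (if i = k then 2 else 0))
    {A B : Submodule (MvPolynomial σ K) (ι → MvPolynomial σ K)} (hA : IsGradedSub A)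
    (hB : IsGradedSub B) (hAB : A ≤ B)
    (hq : ∀ g ∈ B, (∑ v, X v ^ 2 : MvPolynomial σ K) • g ∈ A) :
    hilb B - hilb A ∈ alternatingSums (Fintype.card n) := by
  have hD := raisesDegree_cliffordMul (ι := ι) c
  set D : (n × ι → MvPolynomial σ K) →ₗ[MvPolynomial σ K] _ := cliffordMul c with hDdef
  set Z := copies n B ⊓ (copies n A).comap D with hZdef
  have hZ : IsGradedSub Z := hB.copies.inf (hD.isGradedSub_comap hA.copies)
  have hABc : copies n A ≤ copies n B := fun g hg =>
    mem_copies.mpr fun s => hAB (mem_copies.mp hg s)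
  have hle : (copies n B).map D ⊔ copies n A ≤ Z := by
    refine sup_le ?_ fun g hg => ⟨hABc hg, cliffordMul_mem_copies c hg⟩
    rintro _ ⟨g, hg, rfl⟩
    refine ⟨cliffordMul_mem_copies c hg, ?_⟩
    change D (D g) ∈ copies n A
    rw [hDdef, cliffordMul_cliffordMul h2 hc, mem_copies]
    exact fun s => hq _ (mem_copies.mp hg s)
  obtain ⟨J, hJ⟩ := hZ.exists_forall_degPart_succ_le
  have hge : ∀ j ≥ J, Z.degPart (j + 1) = ((copies n B).map D ⊔ copies n A).degPart (j + 1) := by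
    intro j hj
    refine le_antisymm (hJ j hj _ fun v g hg => ⟨?_, ?_⟩) (inf_le_inf_right _ hle)
    · have h : (X v : MvPolynomial σ K) • g
          = (C 2⁻¹ : MvPolynomial σ K) • (D (matAct (c v) g) + matAct (c v) (D g)) := by
        rw [add_comm, hDdef, matAct_cliffordMul_add hc, smul_smul, ← mul_assoc, ← map_ofNat C 2,
          ← map_mul, inv_mul_cancel₀ h2, map_one, one_mul]
      change (X v : MvPolynomial σ K) • g ∈ _
      rw [h]
      exact Submodule.smul_mem _ _ (Submodule.add_mem_sup
        (Submodule.mem_map_of_mem (matAct_mem_copies _ hg.1.1)) (matAct_mem_copies _ hg.1.2))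
    · exact raisesDegree_lsmul (isHomogeneous_X K v) j g hg.2
  refine ⟨hilb Z - hilb (copies n A),
    sub_mem hZ.hilb_mem_eventuallyPoly hA.copies.hilb_mem_eventuallyPoly,
    eventually_atTop.mpr ⟨J, fun j hj => ?_⟩⟩
  have h₁ := hD.hilb_add_hilb hB.copies hA.copies j
  have h₂ : hilb Z (j + 1) = hilb ((copies n B).map D ⊔ copies n A) (j + 1) := by
    simp only [hilb]
    rw [hge j hj]
  simp only [Pi.sub_apply]
  rw [← hZdef, ← h₂] at h₁
  have e₁ := hilb_copies (n := n) B j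
  have e₂ := hilb_copies (n := n) A j
  linear_combination h₁ - e₁ + e₂

/-- Graded subquotients of a free module annihilated by a power of the quadratic form have Hilbert
functions that are alternating sums up to the dimension of a Clifford module. -/
lemma hilb_sub_mem_alternatingSums [Finite ι] (h2 : (2 : K) ≠ 0) {c : σ → Matrix n n K}
    (hc : ∀ i k, c i * c k + c k * c i = Matrix.scalar n (if i = k then 2 else 0)) (m : ℕ)
    {A B : Submodule (MvPolynomial σ K) (ι → MvPolynomial σ K)} (hA : IsGradedSub A)
    (hB : IsGradedSub B) (hAB : A ≤ B)
    (hq : ∀ g ∈ B, (∑ v, X v ^ 2 : MvPolynomial σ K) ^ m • g ∈ A) :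
    hilb B - hilb A ∈ alternatingSums (Fintype.card n) := by
  induction m generalizing B with
  | zero =>
    have : A = B := le_antisymm hAB fun g hg => by simpa using hq g hg
    simp [this]
  | succ m ih =>
    have hQ : (∑ v, X v ^ 2 : MvPolynomial σ K).IsHomogeneous 2 :=
      IsHomogeneous.sum _ _ _ fun v _ => isHomogeneous_X_pow v 2
    have hT := raisesDegree_lsmul (ι := ι) hQ
    set T := LinearMap.lsmul (MvPolynomial σ K) (ι → MvPolynomial σ K) (∑ v, X v ^ 2) with hTdef
    have hTB : B.map T ≤ B := by
      rintro _ ⟨g, hg, rfl⟩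
      exact B.smul_mem _ hg
    have hG := (hT.isGradedSub_map hB).sup hA
    have h₁ := hilb_sub_mem_alternatingSums_of_smul_mem h2 hc hG hB (sup_le hTB hAB)
      fun g hg => Submodule.mem_sup_left ⟨g, hg, rfl⟩
    have h₂ := ih hG le_sup_right fun g hg => by
      obtain ⟨_, ⟨b, hb, rfl⟩, a, ha, rfl⟩ := Submodule.mem_sup.mp hg
      rw [smul_add]
      refine add_mem ?_ (A.smul_mem _ ha)
      have := hq b hb
      rwa [pow_succ, mul_smul] at this
    simpa using add_mem h₁ h₂

/-- Additivity of Hilbert functions along a map whose image agrees with `B'` up to a power of the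
quadratic form. -/
lemma hilb_relation [Finite ι] [Finite κ] (h2 : (2 : K) ≠ 0) {c : σ → Matrix n n K}
    (hc : ∀ i k, c i * c k + c k * c i = Matrix.scalar n (if i = k then 2 else 0)) (m : ℕ) {d : ℕ}
    {T : (ι → MvPolynomial σ K) →ₗ[MvPolynomial σ K] (κ → MvPolynomial σ K)}
    (hT : RaisesDegree T d)
    {B : Submodule (MvPolynomial σ K) (ι → MvPolynomial σ K)} (hB : IsGradedSub B)
    {B' : Submodule (MvPolynomial σ K) (κ → MvPolynomial σ K)} (hB' : IsGradedSub B')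
    (hTB : ∀ g ∈ B, T g ∈ B')
    (hq : ∀ w ∈ B', ∃ g ∈ B, T g = (∑ v, X v ^ 2 : MvPolynomial σ K) ^ m • w) :
    hilb B - hilb (B ⊓ LinearMap.ker T) - (-1) ^ d • hilb B'
      ∈ alternatingSums (Fintype.card n) := by
  have hmap := hT.isGradedSub_map hB
  have h₁ := hilb_sub_mem_alternatingSums h2 hc m hmap hB'
    (Submodule.map_le_iff_le_comap.mpr hTB) hq
  have h₂ := shift_sub_mem_alternatingSums (Fintype.card n) hmap.hilb_mem_eventuallyPoly d
  have h₃ : hilb B - hilb (B ⊓ LinearMap.ker T) = fun j => hilb (B.map T) (j + d) := by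
    ext j
    have := hT.hilb_add_hilb hB isGradedSub_bot j
    rw [hilb_bot, sup_bot_eq] at this
    simp only [Pi.sub_apply, LinearMap.ker]
    linarith
  rw [h₃]
  convert sub_mem h₂ (zsmul_mem h₁ ((-1) ^ d)) using 1
  rw [smul_sub]
  abel

end Clifford

/-- Clifford modules: `2 k + 1` anticommuting involutions of size `2 ^ k`. -/
lemma exists_clifford_matrices {K : Type*} [Field K] {I : K} (hI : I * I = -1) (k : ℕ) :
    ∃ (n : Type) (_ : Fintype n) (_ : DecidableEq n) (c : Fin (2 * k + 1) → Matrix n n K),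
      Fintype.card n = 2 ^ k ∧
      ∀ i j, c i * c j + c j * c i = Matrix.scalar n (if i = j then 2 else 0) := by
  induction k with
  | zero =>
    refine ⟨Unit, inferInstance, inferInstance, fun _ => 1, rfl, fun i j => ?_⟩
    rw [if_pos (Subsingleton.elim (α := Fin 1) i j)]
    ext
    simp [Matrix.scalar_apply]
    norm_num
  | succ k ih =>
    obtain ⟨n, _, _, c, hn, hc⟩ := ih
    refine ⟨n ⊕ n, inferInstance, inferInstance,
      Fin.cons (Matrix.fromBlocks 1 0 0 (-1)) (Fin.cons (Matrix.fromBlocks 0 (-Matrix.scalar n I)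
        (Matrix.scalar n I) 0) fun i => Matrix.fromBlocks 0 (c i) (c i) 0), ?_, ?_⟩
    · rw [Fintype.card_sum, hn]
      ring
    · have hs : ∀ x : K, Matrix.scalar (n ⊕ n) x
          = Matrix.fromBlocks (Matrix.scalar n x) 0 0 (Matrix.scalar n x) := by
        intro x
        ext (i | i) (j | j) <;> simp [Matrix.scalar_apply, Matrix.diagonal_apply]
      have h2 : (2 : Matrix n n K) = Matrix.scalar n 2 := (map_ofNat (Matrix.scalar n) 2).symm
      have hII : Matrix.scalar n I * Matrix.scalar n I = -1 := by
        rw [← map_mul, hI, map_neg, map_one]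
      have hcI : ∀ i, Matrix.scalar n I * c i = c i * Matrix.scalar n I := fun i =>
        Matrix.scalar_commute I (Commute.all I) (c i)
      intro i j
      rw [hs]
      refine Fin.cases ?_ (fun i => Fin.cases ?_ (fun i => ?_) i) i <;>
      refine Fin.cases ?_ (fun j => Fin.cases ?_ (fun j => ?_) j) j <;>
      simp only [Fin.cons_zero, Fin.cons_succ, Matrix.fromBlocks_multiply, Matrix.fromBlocks_add]
      all_goals simp only [Fin.succ_inj, Fin.succ_ne_zero, (Fin.succ_ne_zero _).symm,
        if_true, if_false]
      all_goals simp [hII, hcI, hc, one_add_one_eq_two, -Matrix.scalar_apply, h2]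

lemma finrank_homogeneousSubmodule_s18 (K : Type*) [Field K] (n j : ℕ) :
    finrank K (homogeneousSubmodule (Fin (n + 1)) K j) = (j + n).choose n := by
  have e : {d : Fin (n + 1) →₀ ℕ | d.degree = j}
      = ((Finset.univ : Finset (Fin (n + 1))).finsuppAntidiag j : Set (Fin (n + 1) →₀ ℕ)) := by
    ext d
    simp [Finset.mem_finsuppAntidiag, Finsupp.degree_eq_sum]
  rw [homogeneousSubmodule_eq_finsupp_supported, e]
  rw [(AddMonoidAlgebra.supportedEquivFinsupp (S := K) (R := K) _).finrank_eq,
    Module.finrank_finsupp_self, ← Set.toFinset_card, Finset.toFinset_coe,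
    Finset.card_finsuppAntidiag_nat_eq_choose]
  simp only [Finset.card_univ, Fintype.card_fin, Nat.add_right_comm, Nat.add_sub_cancel]
  rw [add_comm, Nat.choose_symm_add]

lemma hilb_top (K : Type*) [Field K] (n : ℕ) (ι : Type*) [Fintype ι] :
    hilb (⊤ : Submodule (MvPolynomial (Fin (n + 1)) K) (ι → MvPolynomial (Fin (n + 1)) K))
      = (Fintype.card ι : ℤ) • fun j => ((j + n).choose n : ℤ) := by
  ext j
  let e : (⊤ : Submodule (MvPolynomial (Fin (n + 1)) K)
      (ι → MvPolynomial (Fin (n + 1)) K)).degPart j ≃ₗ[K]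
      (ι → homogeneousSubmodule (Fin (n + 1)) K j) :=
    { toFun := fun g i => ⟨g.1 i, mem_degreePart.mp g.2.2 i⟩
      map_add' := fun _ _ => rfl
      map_smul' := fun _ _ => rfl
      invFun := fun h => ⟨fun i => h i, trivial, mem_degreePart.mpr fun i => (h i).2⟩
      left_inv := fun _ => rfl
      right_inv := fun _ => rfl }
  have := Module.Finite.iff_fg.mpr (homogeneousSubmodule_fg (σ := Fin (n + 1)) K j)
  rw [hilb, e.finrank_eq, Module.finrank_pi_fintype]
  simp [finrank_homogeneousSubmodule_s18]

section Star

variable {R : Type*} [CommRing R] {α β : Type*} [Fintype α] [Fintype β] [DecidableEq α]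
  [DecidableEq β]

/-- The complement of the columns of `F`, scaled by `q`. -/
def complProj (F : Matrix α β R) (q : R) : Matrix α α R := q • 1 - F * F.transpose

/-- The square matrix whose columns are three standard basis vectors followed by those of `F`. -/
def completion (F : Matrix α β R) (e : Fin 3 ⊕ β ≃ α) (a : Fin 3 → α) :
    Matrix (Fin 3 ⊕ β) (Fin 3 ⊕ β) R :=
  Matrix.of fun r => Sum.elim (fun t => (1 : Matrix α α R) (e r) (a t)) (F (e r))

/-- The volume of three standard basis vectors together with the columns of `F`. -/
def starTensor (F : Matrix α β R) (e : Fin 3 ⊕ β ≃ α) (a b c : α) : R :=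
  (completion F e ![a, b, c]).det

lemma transpose_completion_mul (F : Matrix α β R) (e : Fin 3 ⊕ β ≃ α) (q : R)
    (hF : F.transpose * F = q • 1) (a b : Fin 3 → α) :
    (completion F e a).transpose * completion F e b
      = Matrix.fromBlocks ((1 : Matrix α α R).submatrix a b) (F.submatrix a id)
          (F.transpose.submatrix id b) (q • 1) := by
  have key : ∀ f g : α → R, ∑ r, f (e r) * g (e r) = ∑ x, f x * g x := fun f g =>
    Equiv.sum_comp e fun x => f x * g x
  ext (i | i) (j | j)
  · rw [Matrix.mul_apply]
    simp only [completion, Matrix.transpose_apply, Matrix.of_apply, Sum.elim_inl]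
    rw [key (fun x => (1 : Matrix α α R) x (a i)) fun x => (1 : Matrix α α R) x (b j)]
    simp [Matrix.one_apply, eq_comm]
  · rw [Matrix.mul_apply]
    simp only [completion, Matrix.transpose_apply, Matrix.of_apply, Sum.elim_inl, Sum.elim_inr]
    rw [key (fun x => (1 : Matrix α α R) x (a i)) fun x => F x j]
    simp [Matrix.one_apply]
  · rw [Matrix.mul_apply]
    simp only [completion, Matrix.transpose_apply, Matrix.of_apply, Sum.elim_inl, Sum.elim_inr]
    rw [key (fun x => F x i) fun x => (1 : Matrix α α R) x (b j)]
    simp [Matrix.one_apply]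
  · rw [Matrix.mul_apply]
    simp only [completion, Matrix.transpose_apply, Matrix.of_apply, Sum.elim_inr]
    rw [key (fun x => F x i) fun x => F x j]
    simp only [Matrix.fromBlocks_apply₂₂]
    rw [← hF, Matrix.mul_apply]
    rfl

lemma pow_three_mul_det_completion (F : Matrix α β R) (e : Fin 3 ⊕ β ≃ α) (q : R)
    (hF : F.transpose * F = q • 1) (a b : Fin 3 → α) :
    q ^ 3 * ((completion F e a).det * (completion F e b).det)
      = q ^ Fintype.card β * ((complProj F q).submatrix a b).det := by
  have h : (completion F e a).transpose * completion F e b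
      * Matrix.fromBlocks (q • 1) 0 (-F.transpose.submatrix id b) 1
      = Matrix.fromBlocks ((complProj F q).submatrix a b) (F.submatrix a id) 0 (q • 1) := by
    rw [transpose_completion_mul F e q hF, Matrix.fromBlocks_multiply]
    congr 1
    · ext i j
      simp [complProj, Matrix.mul_apply, sub_eq_add_neg]
    · simp
    · simp
    · simp
  have h' := congrArg Matrix.det h
  rw [Matrix.det_mul, Matrix.det_mul, Matrix.det_transpose, Matrix.det_fromBlocks_zero₁₂,
    Matrix.det_fromBlocks_zero₂₁, Matrix.det_smul, Matrix.det_smul] at h'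
  simp only [Matrix.det_one, Fintype.card_fin, mul_one] at h'
  linear_combination h'

end Star

section Star

variable {R : Type*} [CommRing R] {α β : Type*} [Fintype β] [DecidableEq α]

lemma complProj_apply (F : Matrix α β R) (q : R) (a b : α) :
    complProj F q a b = (if a = b then q else 0) - ∑ v, F a v * F b v := by
  simp [complProj, Matrix.mul_apply, Matrix.one_apply]

lemma starTensor_isHomogeneous [DecidableEq β] (e : Fin 3 ⊕ β ≃ α) {K σ : Type*} [Field K]
    {F : Matrix α β (MvPolynomial σ K)} (h : ∀ a v, (F a v).IsHomogeneous 1) (a b c : α) :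
    (starTensor F e a b c).IsHomogeneous (Fintype.card β) := by
  rw [starTensor, Matrix.det_apply]
  refine IsHomogeneous.sum _ _ _ fun τ _ => ?_
  have hp : (∏ i, completion F e ![a, b, c] (τ i) i).IsHomogeneous
      (∑ i : Fin 3 ⊕ β, Sum.elim (fun _ => 0) (fun _ => 1) i) := by
    refine IsHomogeneous.prod _ _ _ fun i _ => ?_
    rcases i with i | i
    · simp only [completion, Matrix.of_apply, Sum.elim_inl, Matrix.one_apply]
      split_ifs
      · exact isHomogeneous_one σ K
      · exact isHomogeneous_zero σ K 0
    · exact h _ _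
  simp only [Fintype.sum_sum_type, Sum.elim_inl, Sum.elim_inr, Finset.sum_const_zero, zero_add,
    Finset.sum_const, Finset.card_univ, smul_eq_mul, mul_one] at hp
  rcases Int.units_eq_one_or (Equiv.Perm.sign τ) with h | h <;> rw [h]
  · simpa using hp
  · simpa using hp.neg

variable [Fintype α]

lemma sum_complProj_mul_of_sum_eq_zero {F : Matrix α β R} {q : R} {z : α → R}
    (hz : ∀ v, ∑ a, F a v * z a = 0) (b : α) : ∑ a, complProj F q b a * z a = q * z b := by
  simp only [complProj_apply, sub_mul, Finset.sum_sub_distrib, ite_mul, zero_mul,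
    Finset.sum_ite_eq, Finset.mem_univ, if_true, Finset.sum_mul, mul_assoc]
  rw [Finset.sum_comm]
  simp [← Finset.mul_sum, hz]

variable [DecidableEq β]

lemma sum_complProj_self {F : Matrix α β R} {q : R} (hF : F.transpose * F = q • 1)
    (hα : Fintype.card α = Fintype.card β + 3) : ∑ a, complProj F q a a = 3 * q := by
  have h : Matrix.trace (F * F.transpose) = Fintype.card β * q := by
    rw [Matrix.trace_mul_comm, hF, Matrix.trace_smul, Matrix.trace_one, smul_eq_mul, mul_comm]
  change Matrix.trace (complProj F q) = _
  rw [complProj, Matrix.trace_sub, Matrix.trace_smul, Matrix.trace_one, h, hα, smul_eq_mul]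
  push_cast
  ring

lemma sum_mul_complProj {F : Matrix α β R} {q : R} (hF : F.transpose * F = q • 1) (v : β) (b : α) :
    ∑ a, F a v * complProj F q a b = 0 := by
  have : F.transpose * complProj F q = 0 := by
    rw [complProj, Matrix.mul_sub, ← Matrix.mul_assoc, hF]
    simp
  exact congrFun (congrFun this v) b

lemma sum_complProj_mul_complProj {F : Matrix α β R} {q : R} (hF : F.transpose * F = q • 1)
    (a b : α) : ∑ c, complProj F q a c * complProj F q c b = q * complProj F q a b :=
  sum_complProj_mul_of_sum_eq_zero (fun v => sum_mul_complProj hF v b) a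

variable [IsDomain R] {F : Matrix α β R} {q : R} {m : ℕ} (e : Fin 3 ⊕ β ≃ α)

lemma starTensor_mul_starTensor (hF : F.transpose * F = q • 1) (hq : q ≠ 0)
    (hβ : Fintype.card β = m + 3) (a b c x y z : α) :
    starTensor F e a b c * starTensor F e x y z =
      q ^ m * (complProj F q a x * (complProj F q b y * complProj F q c z
          - complProj F q b z * complProj F q c y)
        - complProj F q a y * (complProj F q b x * complProj F q c z
          - complProj F q b z * complProj F q c x)
        + complProj F q a z * (complProj F q b x * complProj F q c y
          - complProj F q b y * complProj F q c x)) := by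
  have h := pow_three_mul_det_completion F e q hF ![a, b, c] ![x, y, z]
  rw [hβ, Matrix.det_fin_three] at h
  simp only [Matrix.submatrix_apply, Matrix.cons_val] at h
  apply mul_left_cancel₀ (pow_ne_zero 3 hq)
  rw [starTensor, starTensor, h]
  ring

lemma starTensor_swap (hF : F.transpose * F = q • 1) (hq : q ≠ 0)
    (hβ : Fintype.card β = m + 3) (a b c : α) :
    starTensor F e a b c = -starTensor F e b a c := by
  rw [eq_neg_iff_add_eq_zero, ← mul_self_eq_zero]
  simp only [add_mul, mul_add, starTensor_mul_starTensor e hF hq hβ]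
  ring

lemma eq_zero_of_forall_mul_starTensor {t : R} {f : α → R} {g : α → α × α × α}
    (ht : t = ∑ c, f c * starTensor F e (g c).1 (g c).2.1 (g c).2.2)
    (h : ∀ x y z, t * starTensor F e x y z = 0) : t = 0 := by
  rw [← mul_self_eq_zero]
  nth_rw 2 [ht]
  rw [Finset.mul_sum]
  refine Finset.sum_eq_zero fun c _ => ?_
  rw [mul_left_comm, h, mul_zero]

lemma sum_mul_starTensor_right (hF : F.transpose * F = q • 1) (hq : q ≠ 0)
    (hβ : Fintype.card β = m + 3) (a b : α) (v : β) :
    ∑ c, F c v * starTensor F e a b c = 0 := by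
  refine eq_zero_of_forall_mul_starTensor e (g := fun c => (a, b, c)) rfl fun x y z => ?_
  have hs := sum_mul_complProj hF v
  simp only [Finset.sum_mul, mul_assoc, starTensor_mul_starTensor e hF hq hβ]
  generalize complProj F q = p at *
  calc _ = q ^ m * ((p a x * p b y - p a y * p b x) * ∑ c, F c v * p c z
        - (p a x * p b z - p a z * p b x) * ∑ c, F c v * p c y
        + (p a y * p b z - p a z * p b y) * ∑ c, F c v * p c x) := by
        simp only [Finset.mul_sum, ← Finset.sum_sub_distrib, ← Finset.sum_add_distrib]
        exact Finset.sum_congr rfl fun c _ => by ring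
    _ = 0 := by simp only [hs]; ring

lemma sum_mul_starTensor_middle (hF : F.transpose * F = q • 1) (hq : q ≠ 0)
    (hβ : Fintype.card β = m + 3) (a c : α) (v : β) :
    ∑ b, F b v * starTensor F e a b c = 0 := by
  refine eq_zero_of_forall_mul_starTensor e (g := fun b => (a, b, c)) rfl fun x y z => ?_
  have hs := sum_mul_complProj hF v
  simp only [Finset.sum_mul, mul_assoc, starTensor_mul_starTensor e hF hq hβ]
  generalize complProj F q = p at *
  calc _ = q ^ m * ((p a x * p c z - p a z * p c x) * ∑ b, F b v * p b y
        - (p a x * p c y - p a y * p c x) * ∑ b, F b v * p b z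
        + (p a z * p c y - p a y * p c z) * ∑ b, F b v * p b x) := by
        simp only [Finset.mul_sum, ← Finset.sum_sub_distrib, ← Finset.sum_add_distrib]
        exact Finset.sum_congr rfl fun c _ => by ring
    _ = 0 := by simp only [hs]; ring

lemma sum_starTensor_mul_starTensor (hF : F.transpose * F = q • 1) (hq : q ≠ 0)
    (hβ : Fintype.card β = m + 3) (hα : Fintype.card α = Fintype.card β + 3) (a b c d : α) :
    ∑ k, starTensor F e a b k * starTensor F e c d k
      = q ^ (m + 1) * (complProj F q a c * complProj F q b d
        - complProj F q a d * complProj F q b c) := by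
  have h₁ := sum_complProj_mul_complProj hF
  have h₂ := sum_complProj_self hF hα
  simp only [starTensor_mul_starTensor e hF hq hβ]
  generalize complProj F q = p at *
  calc _ = q ^ m * ((p a c * p b d - p a d * p b c) * (∑ k, p k k)
        - p a c * (∑ k, p b k * p k d) + p a d * (∑ k, p b k * p k c)
        + p b c * (∑ k, p a k * p k d) - p b d * ∑ k, p a k * p k c) := by
        simp only [Finset.mul_sum, ← Finset.sum_sub_distrib, ← Finset.sum_add_distrib]
        exact Finset.sum_congr rfl fun k _ => by ring
    _ = _ := by
        simp only [h₁, h₂]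
        ring

lemma sum_sum_starTensor_mul_starTensor (hF : F.transpose * F = q • 1) (hq : q ≠ 0)
    (hβ : Fintype.card β = m + 3) (hα : Fintype.card α = Fintype.card β + 3) (k l : α) :
    ∑ a, ∑ b, starTensor F e a b k * starTensor F e a b l
      = 2 * q ^ (m + 2) * complProj F q k l := by
  have h₁ := sum_complProj_mul_complProj hF
  have h₂ := sum_complProj_self hF hα
  simp only [starTensor_mul_starTensor e hF hq hβ]
  generalize complProj F q = p at *
  calc _ = ∑ a, q ^ m * (p a a * p k l * (∑ b, p b b) - p a a * (∑ b, p k b * p b l)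
        - p k l * (∑ b, p a b * p b a) + p k a * (∑ b, p a b * p b l)
        + p a l * (∑ b, p k b * p b a) - p k a * p a l * (∑ b, p b b)) := by
        simp only [Finset.mul_sum, ← Finset.sum_sub_distrib, ← Finset.sum_add_distrib]
        exact Finset.sum_congr rfl fun a _ => Finset.sum_congr rfl fun b _ => by ring
    _ = ∑ a, q ^ (m + 1) * (p k l * p a a - p k a * p a l) := by
        refine Finset.sum_congr rfl fun a _ => ?_
        rw [h₁, h₁, h₁, h₁, h₂]
        ring
    _ = q ^ (m + 1) * (p k l * (∑ a, p a a) - ∑ a, p k a * p a l) := by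
        simp only [Finset.mul_sum, Finset.sum_sub_distrib, mul_sub]
    _ = _ := by
        simp only [h₁, h₂]
        ring

end Star

section Maps

variable {K : Type*} [Field K] {σ α β ι κ : Type*}

lemma raisesDegree_mulVecLin [Fintype ι] {M : Matrix κ ι (MvPolynomial σ K)} {d : ℕ}
    (h : ∀ i j, (M i j).IsHomogeneous d) : RaisesDegree M.mulVecLin d := by
  intro j g hg
  rw [mem_degreePart] at hg ⊢
  intro i
  rw [add_comm]
  exact IsHomogeneous.sum _ _ _ fun k _ => (h i k).mul (hg k)

/-- Skew-symmetric matrices, as vectors indexed by pairs. -/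
def skew (K σ α : Type*) [Field K] : Submodule (MvPolynomial σ K) (α × α → MvPolynomial σ K) where
  carrier := {g | ∀ a b, g (a, b) = -g (b, a)}
  add_mem' {f g} hf hg a b := by
    rw [Pi.add_apply, Pi.add_apply, hf, hg, neg_add]
  zero_mem' a b := by simp
  smul_mem' r g hg a b := by
    rw [Pi.smul_apply, Pi.smul_apply, hg, smul_neg]

lemma mem_skew_iff_transpose {g : α × α → MvPolynomial σ K} :
    g ∈ skew K σ α ↔ (Matrix.of g.curry).transpose = -Matrix.of g.curry :=
  ⟨fun h => Matrix.ext fun a b => h b a, fun h a b => congrFun (congrFun h b) a⟩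

lemma isGradedSub_skew : IsGradedSub (skew K σ α) := by
  intro g hg j a b
  rw [vecComponent_apply, vecComponent_apply, hg, map_neg]

variable [Fintype α]

/-- The vectors orthogonal to all columns of `F`. -/
noncomputable def columnPerp (F : Matrix α β (MvPolynomial σ K)) :
    Submodule (MvPolynomial σ K) (α → MvPolynomial σ K) :=
  LinearMap.ker F.transpose.mulVecLin

lemma mem_columnPerp {F : Matrix α β (MvPolynomial σ K)} {z : α → MvPolynomial σ K} :
    z ∈ columnPerp F ↔ ∀ v, ∑ a, F a v * z a = 0 := by
  rw [columnPerp, LinearMap.mem_ker, funext_iff]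
  rfl

lemma RaisesDegree.isGradedSub_ker [Finite ι]
    {T : (ι → MvPolynomial σ K) →ₗ[MvPolynomial σ K] (κ → MvPolynomial σ K)} {d : ℕ}
    (hT : RaisesDegree T d) : IsGradedSub (LinearMap.ker T) :=
  hT.isGradedSub_comap isGradedSub_bot

lemma isGradedSub_columnPerp {F : Matrix α β (MvPolynomial σ K)}
    (h1 : ∀ a v, (F a v).IsHomogeneous 1) :
    IsGradedSub (columnPerp F) :=
  (raisesDegree_mulVecLin fun v a => h1 a v).isGradedSub_ker

/-- The linear map `X ↦ Fᵀ X F`. -/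
noncomputable def congruenceMap (F : Matrix α β (MvPolynomial σ K)) :
    (α × α → MvPolynomial σ K) →ₗ[MvPolynomial σ K] (β × β → MvPolynomial σ K) :=
  (Matrix.of fun (p : β × β) (r : α × α) => F r.1 p.1 * F r.2 p.2).mulVecLin

lemma congruenceMap_apply (F : Matrix α β (MvPolynomial σ K)) (g : α × α → MvPolynomial σ K)
    (v w : β) : congruenceMap F g (v, w) = (F.transpose * Matrix.of g.curry * F) v w := by
  simp only [congruenceMap, Matrix.mulVecLin_apply, Matrix.mulVec, dotProduct, Matrix.of_apply,
    Fintype.sum_prod_type, Matrix.mul_apply, Matrix.transpose_apply, Finset.sum_mul,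
    Function.curry_apply]
  rw [Finset.sum_comm]
  exact Finset.sum_congr rfl fun a _ => Finset.sum_congr rfl fun b _ => by ring

lemma congruenceMap_eq_zero {F : Matrix α β (MvPolynomial σ K)} {g : α × α → MvPolynomial σ K} :
    congruenceMap F g = 0 ↔ F.transpose * Matrix.of g.curry * F = 0 := by
  rw [← Matrix.ext_iff, funext_iff, Prod.forall]
  simp only [congruenceMap_apply, Pi.zero_apply, Matrix.zero_apply]

lemma raisesDegree_congruenceMap {F : Matrix α β (MvPolynomial σ K)}
    (h : ∀ a v, (F a v).IsHomogeneous 1) : RaisesDegree (congruenceMap F) 2 :=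
  raisesDegree_mulVecLin fun _ _ => (h _ _).mul (h _ _)

variable [DecidableEq α]

/-- The linear map `X ↦ X F`, where the result is indexed by columns first. -/
noncomputable def rightMulMap (F : Matrix α β (MvPolynomial σ K)) :
    (α × α → MvPolynomial σ K) →ₗ[MvPolynomial σ K] (β × α → MvPolynomial σ K) :=
  (Matrix.of fun (p : β × α) (r : α × α) => if r.1 = p.2 then F r.2 p.1 else 0).mulVecLin

lemma rightMulMap_apply (F : Matrix α β (MvPolynomial σ K)) (g : α × α → MvPolynomial σ K)
    (v : β) (a : α) : rightMulMap F g (v, a) = (Matrix.of g.curry * F) a v := by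
  simp only [rightMulMap, Matrix.mulVecLin_apply, Matrix.mulVec, dotProduct, Matrix.of_apply,
    Fintype.sum_prod_type_right, Matrix.mul_apply, Function.curry_apply, ite_mul, zero_mul,
    Finset.sum_ite_eq', Finset.mem_univ, if_true]
  exact Finset.sum_congr rfl fun b _ => mul_comm _ _

lemma rightMulMap_eq_zero {F : Matrix α β (MvPolynomial σ K)} {g : α × α → MvPolynomial σ K} :
    rightMulMap F g = 0 ↔ Matrix.of g.curry * F = 0 := by
  rw [← Matrix.ext_iff, funext_iff, Prod.forall, forall_comm]
  simp only [rightMulMap_apply, Pi.zero_apply, Matrix.zero_apply]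

lemma raisesDegree_rightMulMap {F : Matrix α β (MvPolynomial σ K)}
    (h : ∀ a v, (F a v).IsHomogeneous 1) : RaisesDegree (rightMulMap F) 1 := by
  refine raisesDegree_mulVecLin fun p r => ?_
  rw [Matrix.of_apply]
  split_ifs
  · exact h _ _
  · exact isHomogeneous_zero σ K 1

/-- Skew-symmetric matrices annihilated by the congruence map and by right multiplication. -/
noncomputable def skewPerp (F : Matrix α β (MvPolynomial σ K)) :
    Submodule (MvPolynomial σ K) (α × α → MvPolynomial σ K) :=
  (skew K σ α ⊓ LinearMap.ker (congruenceMap F)) ⊓ LinearMap.ker (rightMulMap F)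

lemma mem_skewPerp {F : Matrix α β (MvPolynomial σ K)}
    {g : α × α → MvPolynomial σ K} :
    g ∈ skewPerp F ↔ g ∈ skew K σ α ∧ Matrix.of g.curry * F = 0 := by
  rw [skewPerp, Submodule.mem_inf, Submodule.mem_inf, LinearMap.mem_ker, LinearMap.mem_ker,
    congruenceMap_eq_zero, rightMulMap_eq_zero, Matrix.mul_assoc]
  refine ⟨fun h => ⟨h.1.1, h.2⟩, fun h => ⟨⟨h.1, ?_⟩, h.2⟩⟩
  rw [h.2, Matrix.mul_zero]

lemma isGradedSub_skewPerp {F : Matrix α β (MvPolynomial σ K)}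
    (h1 : ∀ a v, (F a v).IsHomogeneous 1) : IsGradedSub (skewPerp F) :=
  (isGradedSub_skew.inf (raisesDegree_congruenceMap h1).isGradedSub_ker).inf
    (raisesDegree_rightMulMap h1).isGradedSub_ker

variable [Fintype β] [DecidableEq β]

/-- Contraction of a skew-symmetric matrix with the star tensor. -/
noncomputable def starMap (F : Matrix α β (MvPolynomial σ K)) (e : Fin 3 ⊕ β ≃ α) :
    (α × α → MvPolynomial σ K) →ₗ[MvPolynomial σ K] (α → MvPolynomial σ K) :=
  (Matrix.of fun (k : α) (r : α × α) => starTensor F e r.1 r.2 k).mulVecLin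

lemma starMap_apply (F : Matrix α β (MvPolynomial σ K)) (e : Fin 3 ⊕ β ≃ α)
    (g : α × α → MvPolynomial σ K) (k : α) :
    starMap F e g k = ∑ a, ∑ b, starTensor F e a b k * g (a, b) := by
  simp only [starMap, Matrix.mulVecLin_apply, Matrix.mulVec, dotProduct, Matrix.of_apply,
    Fintype.sum_prod_type]

lemma raisesDegree_starMap {F : Matrix α β (MvPolynomial σ K)} (e : Fin 3 ⊕ β ≃ α)
    (h : ∀ a v, (F a v).IsHomogeneous 1) : RaisesDegree (starMap F e) (Fintype.card β) :=
  raisesDegree_mulVecLin fun _ _ => starTensor_isHomogeneous e h _ _ _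

end Maps

section Relations

variable {K : Type*} [Field K] {σ α β n : Type*} [Fintype σ] [DecidableEq σ] [Fintype n]
  [DecidableEq n] [Fintype α] {c : σ → Matrix n n K}

lemma hilb_skew_sub_mem [LinearOrder α] (h2 : (2 : K) ≠ 0)
    (hc : ∀ i k, c i * c k + c k * c i = Matrix.scalar n (if i = k then 2 else 0)) :
    hilb (skew K σ α) - hilb (⊤ : Submodule (MvPolynomial σ K)
      ({p : α × α // p.1 < p.2} → MvPolynomial σ K)) ∈ alternatingSums (Fintype.card n) := by
  have h2' : (2 : MvPolynomial σ K) ≠ 0 := by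
    rw [← map_ofNat C 2]
    exact (C_ne_zero).mpr h2
  let T : (α × α → MvPolynomial σ K) →ₗ[MvPolynomial σ K]
      ({p : α × α // p.1 < p.2} → MvPolynomial σ K) := LinearMap.funLeft _ _ Subtype.val
  have hT : RaisesDegree T 0 := fun j g hg =>
    mem_degreePart.mpr fun i => mem_degreePart.mp hg i
  have hker : skew K σ α ⊓ LinearMap.ker T = ⊥ := by
    refine eq_bot_iff.mpr fun g hg => funext fun ⟨a, b⟩ => ?_
    have h₀ : ∀ a b, a < b → g (a, b) = 0 := fun a b hab => congrFun hg.2 ⟨(a, b), hab⟩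
    rcases lt_trichotomy a b with h | h | h
    · exact h₀ a b h
    · subst h
      have := hg.1 a a
      rw [eq_neg_iff_add_eq_zero, ← two_mul] at this
      exact (mul_eq_zero.mp this).resolve_left h2'
    · rw [hg.1 a b, h₀ b a h, neg_zero, Pi.zero_apply]
  have h := hilb_relation h2 hc 0 hT isGradedSub_skew isGradedSub_top (fun _ _ => trivial)
    fun w _ => ?_
  · have h₀ : hilb (skew K σ α ⊓ LinearMap.ker T) = 0 := by
      rw [hker]
      exact funext hilb_bot
    rwa [h₀, sub_zero, pow_zero, one_smul] at h
  · refine ⟨fun p => if h : p.1 < p.2 then w ⟨p, h⟩ else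
      if h : p.2 < p.1 then -w ⟨(p.2, p.1), h⟩ else 0, fun a b => ?_, ?_⟩
    · rcases lt_trichotomy a b with h | h | h
      · simp [h, h.not_gt]
      · simp [h]
      · simp [h, h.not_gt]
    · rw [pow_zero, one_smul]
      funext p
      exact dif_pos p.2

variable [Fintype β] [DecidableEq β] {F : Matrix α β (MvPolynomial σ K)}

lemma hilb_columnPerp_relation (h2 : (2 : K) ≠ 0)
    (hc : ∀ i k, c i * c k + c k * c i = Matrix.scalar n (if i = k then 2 else 0))
    (h1 : ∀ a v, (F a v).IsHomogeneous 1)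
    (hF : F.transpose * F = (∑ v, X v ^ 2 : MvPolynomial σ K) • 1) :
    hilb (⊤ : Submodule (MvPolynomial σ K) (α → MvPolynomial σ K)) - hilb (columnPerp F)
      + hilb (⊤ : Submodule (MvPolynomial σ K) (β → MvPolynomial σ K))
      ∈ alternatingSums (Fintype.card n) := by
  have h := hilb_relation h2 hc 1 (raisesDegree_mulVecLin fun v a => h1 a v)
    (T := F.transpose.mulVecLin) isGradedSub_top isGradedSub_top (fun _ _ => trivial)
    fun w _ => ⟨F.mulVec w, trivial, ?_⟩
  · rwa [top_inf_eq, pow_one, neg_smul, one_smul, sub_neg_eq_add] at h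
  · rw [Matrix.mulVecLin_apply, Matrix.mulVec_mulVec, hF, Matrix.smul_mulVec, Matrix.one_mulVec,
      pow_one]

lemma hilb_congruenceMap_relation (h2 : (2 : K) ≠ 0)
    (hc : ∀ i k, c i * c k + c k * c i = Matrix.scalar n (if i = k then 2 else 0))
    (h1 : ∀ a v, (F a v).IsHomogeneous 1)
    (hF : F.transpose * F = (∑ v, X v ^ 2 : MvPolynomial σ K) • 1) :
    hilb (skew K σ α) - hilb (skew K σ α ⊓ LinearMap.ker (congruenceMap F)) - hilb (skew K σ β)
      ∈ alternatingSums (Fintype.card n) := by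
  have h := hilb_relation h2 hc 2 (raisesDegree_congruenceMap h1) isGradedSub_skew
    (isGradedSub_skew (α := β)) (fun g hg => ?_) fun w hw =>
      ⟨fun p => (F * Matrix.of w.curry * F.transpose) p.1 p.2, ?_, ?_⟩
  · rwa [neg_one_sq, one_smul] at h
  · rw [mem_skew_iff_transpose] at hg
    have hg' : (F.transpose * Matrix.of g.curry * F).transpose
        = -(F.transpose * Matrix.of g.curry * F) := by
      simp only [Matrix.transpose_mul, Matrix.transpose_transpose, hg, Matrix.mul_assoc,
        Matrix.mul_neg, Matrix.neg_mul]
    intro v w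
    rw [congruenceMap_apply, congruenceMap_apply]
    exact congrFun (congrFun hg' w) v
  · rw [mem_skew_iff_transpose] at hw
    have hw' : (F * Matrix.of w.curry * F.transpose).transpose
        = -(F * Matrix.of w.curry * F.transpose) := by
      simp only [Matrix.transpose_mul, Matrix.transpose_transpose, hw, Matrix.mul_assoc,
        Matrix.mul_neg, Matrix.neg_mul]
    exact fun v w => congrFun (congrFun hw' w) v
  · funext ⟨v, u⟩
    rw [congruenceMap_apply]
    change (F.transpose * (F * Matrix.of w.curry * F.transpose) * F) v u = _
    rw [← Matrix.mul_assoc, ← Matrix.mul_assoc, hF, Matrix.mul_assoc, hF]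
    simp [pow_two, mul_assoc]

variable [DecidableEq α]

lemma hilb_rightMulMap_relation (h2 : (2 : K) ≠ 0)
    (hc : ∀ i k, c i * c k + c k * c i = Matrix.scalar n (if i = k then 2 else 0))
    (h1 : ∀ a v, (F a v).IsHomogeneous 1)
    (hF : F.transpose * F = (∑ v, X v ^ 2 : MvPolynomial σ K) • 1) :
    hilb (skew K σ α ⊓ LinearMap.ker (congruenceMap F)) - hilb (skewPerp F)
      + (Fintype.card β : ℤ) • hilb (columnPerp F) ∈ alternatingSums (Fintype.card n) := by
  have h := hilb_relation h2 hc 1 (raisesDegree_rightMulMap h1)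
    (isGradedSub_skew.inf (raisesDegree_congruenceMap h1).isGradedSub_ker)
    ((isGradedSub_columnPerp h1).copies (n := β)) (fun g hg => ?_) fun w hw => ?_
  · have hcop : hilb (copies β (columnPerp F)) = (Fintype.card β : ℤ) • hilb (columnPerp F) :=
      funext (hilb_copies _)
    rwa [pow_one, neg_smul, one_smul, sub_neg_eq_add, hcop] at h
  · have hz := congruenceMap_eq_zero.mp hg.2
    rw [mem_copies]
    intro v
    rw [mem_columnPerp]
    intro u
    simp only [rightMulMap_apply]
    rw [Matrix.mul_assoc] at hz
    exact congrFun (congrFun hz u) v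
  · let E : Matrix α β (MvPolynomial σ K) := Matrix.of fun a v => w (v, a)
    have hE : F.transpose * E = 0 := by
      ext v u
      exact congrArg (coeff _) (mem_columnPerp.mp (mem_copies.mp hw u) v)
    have hE' : E.transpose * F = 0 := by
      simpa [Matrix.transpose_mul] using congrArg Matrix.transpose hE
    refine ⟨fun p => (E * F.transpose - F * E.transpose) p.1 p.2, ⟨?_, ?_⟩, ?_⟩
    · have : (E * F.transpose - F * E.transpose).transpose
          = -(E * F.transpose - F * E.transpose) := by
        simp [Matrix.transpose_mul]
      exact fun a b => congrFun (congrFun this b) a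
    · refine congruenceMap_eq_zero.mpr ?_
      change F.transpose * (E * F.transpose - F * E.transpose) * F = 0
      rw [Matrix.mul_sub, ← Matrix.mul_assoc, hE, Matrix.zero_mul, zero_sub, Matrix.neg_mul,
        Matrix.mul_assoc, Matrix.mul_assoc, hE', Matrix.mul_zero, Matrix.mul_zero, neg_zero]
    · funext ⟨v, a⟩
      rw [rightMulMap_apply]
      change ((E * F.transpose - F * E.transpose) * F) a v = _
      rw [Matrix.sub_mul, Matrix.mul_assoc, Matrix.mul_assoc, hF, hE']
      simp [E]

lemma hilb_starMap_relation (h2 : (2 : K) ≠ 0)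
    (hc : ∀ i k, c i * c k + c k * c i = Matrix.scalar n (if i = k then 2 else 0))
    (h1 : ∀ a v, (F a v).IsHomogeneous 1)
    (hF : F.transpose * F = (∑ v, X v ^ 2 : MvPolynomial σ K) • 1)
    (hq : (∑ v, X v ^ 2 : MvPolynomial σ K) ≠ 0) (e : Fin 3 ⊕ β ≃ α) {m : ℕ}
    (hβ : Fintype.card β = m + 3) :
    hilb (skewPerp F) - (-1) ^ (m + 3) • hilb (columnPerp F)
      ∈ alternatingSums (Fintype.card n) := by
  have h2' : (2 : MvPolynomial σ K) ≠ 0 := by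
    rw [← map_ofNat C 2]
    exact (C_ne_zero).mpr h2
  have hα : Fintype.card α = Fintype.card β + 3 := by
    rw [← Fintype.card_congr e, Fintype.card_sum, Fintype.card_fin, add_comm]
  have hker : skewPerp F ⊓ LinearMap.ker (starMap F e) = ⊥ := by
    refine eq_bot_iff.mpr fun g hg => funext fun ⟨c, d⟩ => ?_
    obtain ⟨hskew, hgF⟩ := mem_skewPerp.mp hg.1
    have hright : ∀ a v, ∑ b, F b v * g (a, b) = 0 := fun a v => by
      have := congrFun (congrFun hgF a) v
      simpa [Matrix.mul_apply, mul_comm] using this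
    have hP := fun a => sum_complProj_mul_of_sum_eq_zero
      (q := (∑ v, X v ^ 2 : MvPolynomial σ K)) (hright a)
    have hstar : ∀ k, ∑ a, ∑ b, starTensor F e a b k * g (a, b) = 0 := fun k => by
      rw [← starMap_apply, hg.2, Pi.zero_apply]
    have hsum := sum_starTensor_mul_starTensor e hF hq hβ hα c d
    have hPP : ∀ c d, ∑ a, complProj F (∑ v, X v ^ 2) c a *
        ∑ b, complProj F (∑ v, X v ^ 2) d b * g (a, b) = (∑ v, X v ^ 2) ^ 2 * g (c, d) := by
      intro c d
      simp only [hP, hskew _ d, mul_neg, Finset.sum_neg_distrib, mul_left_comm, ← Finset.mul_sum]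
      ring
    have hzero : ∑ k, starTensor F e c d k * ∑ a, ∑ b, starTensor F e a b k * g (a, b) = 0 := by
      simp only [hstar, mul_zero, Finset.sum_const_zero]
    have hcd : 2 * (∑ v, X v ^ 2 : MvPolynomial σ K) ^ (m + 3) * g (c, d) = 0 := by
      calc _ = (∑ v, X v ^ 2) ^ (m + 1) * ((∑ v, X v ^ 2) ^ 2 * g (c, d)
              - (∑ v, X v ^ 2) ^ 2 * g (d, c)) := by
            rw [hskew d c]
            ring
        _ = ∑ a, ∑ b, (∑ k, starTensor F e c d k * starTensor F e a b k) * g (a, b) := by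
            simp only [← hPP, hsum, Finset.mul_sum, ← Finset.sum_sub_distrib]
            exact Finset.sum_congr rfl fun a _ => Finset.sum_congr rfl fun b _ => by ring
        _ = 0 := by
            rw [← hzero]
            simp only [Finset.mul_sum, Finset.sum_mul, mul_assoc]
            rw [Finset.sum_comm]
            conv_rhs => rw [Finset.sum_comm]
            rw [Finset.sum_comm]
            exact Finset.sum_congr rfl fun a _ => Finset.sum_comm
    exact (mul_eq_zero.mp hcd).resolve_left (mul_ne_zero h2' (pow_ne_zero _ hq))
  have h := hilb_relation h2 hc (m + 3) (raisesDegree_starMap e h1) (isGradedSub_skewPerp h1)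
    (isGradedSub_columnPerp h1) (fun g hg => ?_) fun z hz => ?_
  · have h₀ : hilb (skewPerp F ⊓ LinearMap.ker (starMap F e)) = 0 := by
      rw [hker]
      exact funext hilb_bot
    rwa [h₀, sub_zero, hβ] at h
  · rw [mem_columnPerp]
    intro v
    calc _ = ∑ a, ∑ b, (∑ k, F k v * starTensor F e a b k) * g (a, b) := by
          simp only [starMap_apply, Finset.mul_sum, Finset.sum_mul, mul_assoc]
          rw [Finset.sum_comm]
          exact Finset.sum_congr rfl fun a _ => Finset.sum_comm
      _ = 0 := by simp only [sum_mul_starTensor_right e hF hq hβ, zero_mul, Finset.sum_const_zero]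
  · have hPz := sum_complProj_mul_of_sum_eq_zero (q := (∑ v, X v ^ 2 : MvPolynomial σ K))
      (mem_columnPerp.mp hz)
    have hhalf : (C 2⁻¹ : MvPolynomial σ K) * 2 = 1 := by
      rw [← map_ofNat C 2, ← C_mul, inv_mul_cancel₀ h2, C_1]
    refine ⟨fun p => C 2⁻¹ * ∑ k, starTensor F e p.1 p.2 k * z k, mem_skewPerp.mpr ⟨?_, ?_⟩, ?_⟩
    · intro a b
      simp only [starTensor_swap e hF hq hβ a b, neg_mul, Finset.sum_neg_distrib, mul_neg]
    · refine Matrix.ext fun a v => ?_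
      rw [Matrix.mul_apply, Matrix.zero_apply]
      calc _ = C 2⁻¹ * ∑ k, (∑ b, F b v * starTensor F e a b k) * z k := by
            simp only [Matrix.of_apply, Function.curry_apply, Finset.mul_sum, Finset.sum_mul]
            rw [Finset.sum_comm]
            exact Finset.sum_congr rfl fun a _ => Finset.sum_congr rfl fun b _ => by ring
        _ = 0 := by
            simp only [sum_mul_starTensor_middle e hF hq hβ, zero_mul, Finset.sum_const_zero,
              mul_zero]
    · funext l
      rw [starMap_apply, Pi.smul_apply, smul_eq_mul]
      calc _ = C 2⁻¹ * ∑ k, (∑ a, ∑ b, starTensor F e a b l * starTensor F e a b k) * z k := by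
            simp only [Finset.mul_sum, Finset.sum_mul]
            conv_rhs => rw [Finset.sum_comm]
            refine Finset.sum_congr rfl fun a _ => ?_
            rw [Finset.sum_comm]
            exact Finset.sum_congr rfl fun k _ => Finset.sum_congr rfl fun b _ => by ring
        _ = C 2⁻¹ * 2 * (∑ v, X v ^ 2) ^ (m + 2) *
              ∑ k, complProj F (∑ v, X v ^ 2) l k * z k := by
            simp only [sum_sum_starTensor_mul_starTensor e hF hq hβ hα, Finset.mul_sum]
            exact Finset.sum_congr rfl fun k _ => by ring
        _ = _ := by
            rw [hPz, hhalf]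
            ring

end Relations

lemma sum_X_sq_ne_zero (K : Type*) [Field K] {σ : Type*} [Fintype σ] [Nonempty σ] :
    (∑ v, X v ^ 2 : MvPolynomial σ K) ≠ 0 := by
  classical
  obtain ⟨i⟩ := ‹Nonempty σ›
  intro h
  have := congrArg (eval (Pi.single i (1 : K))) h
  simp [Pi.single_apply] at this

/-- A `16 × 13` matrix of linear forms in `13` variables cannot have orthogonal columns of norm the
sum of squares of the variables. -/
lemma transpose_mul_self_ne {K : Type*} [Field K] (h2 : (2 : K) ≠ 0) {I : K} (hI : I * I = -1)
    (F : Matrix (Fin 16) (Fin 13) (MvPolynomial (Fin 13) K))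
    (h1 : ∀ a v, (F a v).IsHomogeneous 1) : 
    F.transpose * F ≠ (∑ v, X v ^ 2 : MvPolynomial (Fin 13) K) • 1 := by
  intro hF
  obtain ⟨n, _, _, c, hn, hc⟩ := exists_clifford_matrices hI 6
  have hperp := hilb_columnPerp_relation h2 hc h1 hF
  have hskew := hilb_skew_sub_mem (α := Fin 16) h2 hc
  have hskew' := hilb_skew_sub_mem (α := Fin 13) h2 hc
  have hcongr := hilb_congruenceMap_relation h2 hc h1 hF
  have hright := hilb_rightMulMap_relation h2 hc h1 hF
  have hstar := hilb_starMap_relation h2 hc h1 hF (sum_X_sq_ne_zero K) finSumFinEquiv (m := 10)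
    (Fintype.card_fin 13)
  have hcard : Fintype.card {p : Fin 16 × Fin 16 // p.1 < p.2} = 120 := by decide +kernel
  have hcard' : Fintype.card {p : Fin 13 × Fin 13 // p.1 < p.2} = 78 := by decide +kernel
  rw [hilb_top K 12, hcard] at hskew
  rw [hilb_top K 12, hcard'] at hskew'
  rw [hilb_top K 12, hilb_top K 12, Fintype.card_fin, Fintype.card_fin] at hperp
  rw [Fintype.card_fin] at hright
  rw [hn] at *
  refine smul_choose_notMem_alternatingSums 12 (c := (2 ^ 6 : ℕ)) (m := 448) 7 (by decide)
    (by norm_num) ?_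
  convert add_mem (add_mem (add_mem (sub_mem (add_mem hcongr hskew') hskew) hright) hstar)
    (zsmul_mem hperp 14) using 1
  ext j
  simp only [Pi.add_apply, Pi.sub_apply, Pi.smul_apply, smul_eq_mul]
  push_cast
  ring

lemma sum_add_sq {R ι : Type*} [CommRing R] [Fintype ι] (f g : ι → R) :
    ∑ i, (f i + g i) ^ 2 = ∑ i, f i ^ 2 + 2 * ∑ i, f i * g i + ∑ i, g i ^ 2 := by
  simp only [Finset.mul_sum, ← Finset.sum_add_distrib]
  exact Finset.sum_congr rfl fun i _ => by ring

/-- Full polarization of a sums-of-squares formula. -/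
lemma sum_mul_add_mul_of_sum_sq {R ι κ τ : Type*} [Field R] [Fintype ι] [Fintype κ]
    [Fintype τ] (h2 : (2 : R) ≠ 0) (φ : (ι → R) →ₗ[R] (κ → R) →ₗ[R] (τ → R))
    (h : ∀ x y, (∑ i, x i ^ 2) * (∑ j, y j ^ 2) = ∑ k, φ x y k ^ 2) (x x' : ι → R)
    (y y' : κ → R) :
    ∑ k, (φ x y k * φ x' y' k + φ x y' k * φ x' y k)
      = 2 * ((∑ i, x i * x' i) * ∑ j, y j * y' j) := by
  have hpol : ∀ y, ∑ k, φ x y k * φ x' y k = (∑ i, x i * x' i) * ∑ j, y j ^ 2 := by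
    intro y
    have h₀ := h (x + x') y
    simp only [map_add, LinearMap.add_apply, Pi.add_apply, sum_add_sq, ← h] at h₀
    apply mul_left_cancel₀ h2
    linear_combination -h₀
  have h₀ := hpol (y + y')
  simp only [map_add, Pi.add_apply, sum_add_sq] at h₀
  calc _ = ∑ k, (φ x y k + φ x y' k) * (φ x' y k + φ x' y' k) - ∑ k, φ x y k * φ x' y k
        - ∑ k, φ x y' k * φ x' y' k := by
        simp only [← Finset.sum_sub_distrib]
        exact Finset.sum_congr rfl fun k _ => by ring
    _ = _ := by
        rw [h₀, hpol, hpol]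
        ring

/-- The matrix of linear forms attached to the coefficients of a sums-of-squares formula. -/
noncomputable def linearFormMatrix {K α β σ : Type*} [Field K] [Fintype σ] (t : α → β → σ → K) :
    Matrix α β (MvPolynomial σ K) :=
  Matrix.of fun a v => ∑ w, C (t a v w) * X w

lemma linearFormMatrix_isHomogeneous {K α β σ : Type*} [Field K] [Fintype σ] (t : α → β → σ → K)
    (a : α) (v : β) : (linearFormMatrix t a v).IsHomogeneous 1 := by
  rw [linearFormMatrix, Matrix.of_apply]
  exact IsHomogeneous.sum _ _ _ fun w _ => isHomogeneous_C_mul_X _ w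

lemma transpose_linearFormMatrix_mul {K α β σ : Type*} [Field K] [Fintype α] [Fintype σ]
    [DecidableEq β] [DecidableEq σ] (h2 : (2 : K) ≠ 0) (t : α → β → σ → K)
    (ht : ∀ v v' w w', ∑ a, (t a v w * t a v' w' + t a v w' * t a v' w)
      = if v = v' then if w = w' then 2 else 0 else 0) :
    (linearFormMatrix t).transpose * linearFormMatrix t
      = (∑ v, X v ^ 2 : MvPolynomial σ K) • 1 := by
  have h2' : (2 : MvPolynomial σ K) ≠ 0 := by
    rw [← map_ofNat C 2]
    exact C_ne_zero.mpr h2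
  refine Matrix.ext fun v v' => mul_left_cancel₀ h2' ?_
  have hexp : ((linearFormMatrix t).transpose * linearFormMatrix t) v v'
      = ∑ w, ∑ w', C (∑ a, t a v w * t a v' w') * (X w * X w') := by
    simp only [Matrix.mul_apply, Matrix.transpose_apply, linearFormMatrix, Matrix.of_apply,
      Finset.sum_mul_sum]
    simp only [map_sum, Finset.sum_mul, C_mul]
    rw [Finset.sum_comm]
    refine Finset.sum_congr rfl fun w _ => ?_
    rw [Finset.sum_comm]
    exact Finset.sum_congr rfl fun w' _ => Finset.sum_congr rfl fun a _ => by ring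
  calc _ = ∑ w, ∑ w', C (∑ a, (t a v w * t a v' w' + t a v w' * t a v' w)) * (X w * X w') := by
        simp only [Finset.sum_add_distrib, C_add, add_mul]
        rw [hexp, two_mul]
        congr 1
        rw [Finset.sum_comm]
        exact Finset.sum_congr rfl fun w _ => Finset.sum_congr rfl fun w' _ => by
          rw [mul_comm (X w)]
    _ = _ := by
        simp only [ht]
        by_cases hv : v = v'
        · have hC : (C 2 : MvPolynomial σ K) = 2 := map_ofNat C 2
          simp [hv, apply_ite C, hC, Finset.mul_sum, pow_two]
        · simp [hv]

theorem stmt_18 :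
    (∀ (F : Type*) [Field F], ringChar F ≠ 2 →
      ¬ ∃ φ : (Fin 13 → F) →ₗ[F] (Fin 13 → F) →ₗ[F] (Fin 16 → F),
        ∀ (x : Fin 13 → F) (y : Fin 13 → F),
          (∑ i, x i ^ 2) * (∑ j, y j ^ 2) = ∑ k, φ x y k ^ 2) ∧
    (∃ i, 3 < i ∧ i ≤ 6 ∧ ¬ (2 ^ (6 - i + 1) ∣ Nat.choose 16 i)) := by
  refine ⟨?_, 4, by norm_num, by norm_num, by decide⟩
  rintro F _ hchar ⟨φ, hφ⟩
  have h2F : (2 : F) ≠ 0 := Ring.two_ne_zero hchar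
  let ψ := algebraMap F (AlgebraicClosure F)
  have h2 : (2 : AlgebraicClosure F) ≠ 0 := by
    rw [← map_ofNat ψ 2]
    exact (map_ne_zero ψ).mpr h2F
  obtain ⟨I, hI⟩ := IsAlgClosed.exists_eq_mul_self (-1 : AlgebraicClosure F)
  let t : Fin 16 → Fin 13 → Fin 13 → F := fun a v w => φ (Pi.single v 1) (Pi.single w 1) a
  have ht : ∀ v v' w w', ∑ a, (t a v w * t a v' w' + t a v w' * t a v' w)
      = if v = v' then if w = w' then 2 else 0 else 0 := by
    intro v v' w w'
    rw [sum_mul_add_mul_of_sum_sq h2F φ hφ]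
    simp only [Pi.single_apply, ite_mul, one_mul, zero_mul, Finset.sum_ite_eq', Finset.mem_univ,
      if_true]
    split_ifs <;> simp
  refine transpose_mul_self_ne h2 hI.symm (linearFormMatrix fun a v w => ψ (t a v w))
    (linearFormMatrix_isHomogeneous _)
    (transpose_linearFormMatrix_mul h2 _ fun v v' w w' => ?_)
  simp only [← map_mul, ← map_add, ← map_sum, ht, apply_ite ψ, map_ofNat, map_zero]
end
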